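/- Let P = P^{m_1} × ⋯ × P^{m_k} be a product of k ≥ 2 complex projective spaces and let X ⊂ P be a very general hypersurface in the linear system |O_P(d_1,…,d_k)|. Set p = min_i(d_i − m_i − 1) and m = max_i m_i. If p ≥ m, then irredirr(X) = min_i d_i; that is, the degree of irrationality of X equals the minimum of the multidegrees d_1,…,d_k. -/

import Mathlib

open MvPolynomial

noncomputable section

/-- Points of the complex projective space whose homogeneous coordinates are
indexed by `ι` (so for `ι = Fin (N+1)` this is `ℙ^N`). -/
abbrev PPt (ι : Type) : Type := Projectivization ℂ (ι → ℂ)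

/-- A polynomial vanishes at a projective point if it vanishes at every
representative vector of the point. -/
def PVanish {ι : Type} (f : MvPolynomial ι ℂ) (x : PPt ι) : Prop :=
  ∀ (v : ι → ℂ) (hv : v ≠ 0), Projectivization.mk ℂ v hv = x → eval v f = 0

/-- The zero locus of a polynomial in projective space. -/
def ZeroSet {ι : Type} (f : MvPolynomial ι ℂ) : Set (PPt ι) :=
  {x | PVanish f x}

/-- Zariski-closed subsets of projective space: common zero loci of families of
homogeneous polynomials. -/
def IsZClosed {ι : Type} (Y : Set (PPt ι)) : Prop :=
  ∃ fs : Set (MvPolynomial ι ℂ),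
    (∀ f ∈ fs, ∃ e, f.IsHomogeneous e) ∧ Y = {x | ∀ f ∈ fs, PVanish f x}

/-- `U` contains a dense (Zariski-)open subset of `X`: there is a Zariski-closed
set `Y` not containing `X` with `X \ Y ⊆ U`.  Taking `X = Set.univ` this is the
notion of a set containing "the general point" of the ambient projective space. -/
def ContainsDenseOpenOf {ι : Type} (X U : Set (PPt ι)) : Prop :=
  ∃ Y : Set (PPt ι), IsZClosed Y ∧ ¬ X ⊆ Y ∧ X \ Y ⊆ U

/-- The set of projective points lying in (the projectivization of) a linear
subspace `W`. -/
def LinSet {ι : Type} (W : Submodule ℂ (ι → ℂ)) : Set (PPt ι) :=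
  {x | x.submodule ≤ W}

/-- A line in projective space: the projectivization of a 2-dimensional
linear subspace. -/
def IsLine {ι : Type} (L : Set (PPt ι)) : Prop :=
  ∃ W : Submodule ℂ (ι → ℂ), Module.finrank ℂ W = 2 ∧ L = LinSet W

/-- A smooth plane conic with supporting plane `P(W)`: the zero locus, inside the
projective plane `P(W)`, of a quadric which does not vanish identically on `W`
and whose restriction to `W` has no singular points. -/
def IsConicIn {ι : Type} [Fintype ι] (W : Submodule ℂ (ι → ℂ))
    (C : Set (PPt ι)) : Prop :=
  Module.finrank ℂ W = 3 ∧
  ∃ f : MvPolynomial ι ℂ, f.IsHomogeneous 2 ∧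
    C = {x | x.submodule ≤ W ∧ PVanish f x} ∧
    (∃ v ∈ W, eval v f ≠ 0) ∧
    (∀ v ∈ W, v ≠ 0 → eval v f = 0 →
      ∃ w ∈ W, (∑ i, eval v (pderiv i f) * w i) ≠ 0)

/-- A smooth plane conic in projective space. -/
def IsSmoothConic {ι : Type} [Fintype ι] (C : Set (PPt ι)) : Prop :=
  ∃ W, IsConicIn W C

/-- The Cayley–Bacharach condition `CB(m)`: every degree-`m` hypersurface
containing all points of `S` but one contains all of `S`. -/
def SatisfiesCB {ι : Type} (m : ℕ) (S : Finset (PPt ι)) : Prop :=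
  ∀ f : MvPolynomial ι ℂ, f.IsHomogeneous m →
    ∀ p ∈ S, (∀ q ∈ S, q ≠ p → PVanish f q) → PVanish f p

/-- A smooth projective hypersurface of degree `e`: the partial derivatives of
its (homogeneous) equation have no common nontrivial zero. -/
def IsSmoothHyp {ι : Type} [Fintype ι] (f : MvPolynomial ι ℂ) (e : ℕ) : Prop :=
  f.IsHomogeneous e ∧ f ≠ 0 ∧
    ∀ v : ι → ℂ, v ≠ 0 → ¬ (∀ i, eval v (pderiv i f) = 0)

/-- `{f = g = 0}` is a smooth complete intersection: at every common nontrivial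
zero the two gradients are linearly independent. -/
def IsSmoothCI2 {ι : Type} [Fintype ι] (f g : MvPolynomial ι ℂ) : Prop :=
  ∀ v : ι → ℂ, v ≠ 0 → eval v f = 0 → eval v g = 0 →
    ∀ a b : ℂ, (∀ i, a * eval v (pderiv i f) + b * eval v (pderiv i g) = 0) →
      a = 0 ∧ b = 0

/-- `{f = g = h = 0}` is a smooth complete intersection: at every common
nontrivial zero the three gradients are linearly independent. -/
def IsSmoothCI3 {ι : Type} [Fintype ι] (f g h : MvPolynomial ι ℂ) : Prop :=
  ∀ v : ι → ℂ, v ≠ 0 → eval v f = 0 → eval v g = 0 → eval v h = 0 →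
    ∀ a b c : ℂ,
      (∀ i, a * eval v (pderiv i f) + b * eval v (pderiv i g)
        + c * eval v (pderiv i h) = 0) →
      a = 0 ∧ b = 0 ∧ c = 0

/-- A rational map from (a subvariety of) the projective space with coordinates
`ι` to `ℙ^n`, given by an `(n+1)`-tuple of homogeneous polynomials of a common
degree `e`. -/
structure RatMapTo (ι : Type) (n : ℕ) where
  F : Fin (n + 1) → MvPolynomial ι ℂ
  e : ℕ
  homog : ∀ j, (F j).IsHomogeneous e

namespace RatMapTo

variable {ι : Type} {n : ℕ}

def evalVec (φ : RatMapTo ι n) (v : ι → ℂ) : Fin (n + 1) → ℂ :=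
  fun j => eval v (φ.F j)

/-- `φ` is defined at `x` and sends `x` to `y`. -/
def mapsTo (φ : RatMapTo ι n) (x : PPt ι) (y : PPt (Fin (n + 1))) : Prop :=
  ∀ (v : ι → ℂ) (hv : v ≠ 0), Projectivization.mk ℂ v hv = x →
    ∃ hw : φ.evalVec v ≠ 0, Projectivization.mk ℂ (φ.evalVec v) hw = y

/-- The fiber over `y` of the restriction of `φ` to `X`. -/
def fiber (φ : RatMapTo ι n) (X : Set (PPt ι)) (y : PPt (Fin (n + 1))) :
    Set (PPt ι) :=
  {x ∈ X | φ.mapsTo x y}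

/-- The restriction of `φ` to `X` is a dominant rational map of degree `δ`:
the fiber over a general point of `ℙ^n` consists of exactly `δ` points. -/
def DominantOfDegree (φ : RatMapTo ι n) (X : Set (PPt ι)) (δ : ℕ) : Prop :=
  0 < δ ∧
  ∃ V : Set (PPt (Fin (n + 1))), ContainsDenseOpenOf Set.univ V ∧
    ∀ y ∈ V, (φ.fiber X y).Finite ∧ (φ.fiber X y).ncard = δ

end RatMapTo

/-- The degree of irrationality of `X`: the minimal degree of a dominant
rational map `X ⇢ ℙ^n`. -/
def irr {ι : Type} (n : ℕ) (X : Set (PPt ι)) : ℕ :=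
  sInf {δ : ℕ | ∃ φ : RatMapTo ι n, φ.DominantOfDegree X δ}

/-- `ψ` is the linear projection away from the linear subspace `P(W)`:
it is given by linear forms whose common kernel is exactly `W`. -/
def IsLinearProjectionFrom {ι : Type} {n : ℕ} (ψ : RatMapTo ι n)
    (W : Submodule ℂ (ι → ℂ)) : Prop :=
  ψ.e = 1 ∧ ∀ v : ι → ℂ, ψ.evalVec v = 0 ↔ v ∈ W

/-- The rational maps `φ` and `ψ` on `X` are birationally equivalent: they
differ by composition with a birational automorphism `τ` of the target `ℙ^n`. -/
def BirEquivTo {ι : Type} {n : ℕ} (X : Set (PPt ι)) (φ ψ : RatMapTo ι n) : Prop :=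
  ∃ τ : RatMapTo (Fin (n + 1)) n, τ.DominantOfDegree Set.univ 1 ∧
    ∃ U : Set (PPt ι), ContainsDenseOpenOf X U ∧
      ∀ x ∈ U, ∃ y z, φ.mapsTo x y ∧ ψ.mapsTo x z ∧ τ.mapsTo z y

/-- `A` is contained in a proper Zariski-closed subset of the (projective) space
of degree-`d` forms: it is cut out by a polynomial in the coefficients which is
not identically zero on degree-`d` forms. -/
def CoeffPolyProperClosed {ι : Type} (d : ℕ) (A : Set (MvPolynomial ι ℂ)) : Prop :=
  ∃ (κ : ℕ) (mons : Fin κ → (ι →₀ ℕ)) (Q : MvPolynomial (Fin κ) ℂ),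
    (∀ g ∈ A, eval (fun j => coeff (mons j) g) Q = 0) ∧
    (∃ g : MvPolynomial ι ℂ, g.IsHomogeneous d ∧
      eval (fun j => coeff (mons j) g) Q ≠ 0)

end

noncomputable section

/-- Points of the product of projective spaces `ℙ^{m 0} × ⋯ × ℙ^{m (k-1)}`. -/
abbrev ProdPt {k : ℕ} (m : Fin k → ℕ) : Type := (i : Fin k) → PPt (Fin (m i + 1))

/-- Assemble a tuple of coordinate vectors into a single vector indexed by the
disjoint union of the coordinate index sets. -/
def assemble {k : ℕ} {m : Fin k → ℕ} (v : ∀ i, Fin (m i + 1) → ℂ) :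
    ((i : Fin k) × Fin (m i + 1)) → ℂ := fun p => v p.1 p.2

/-- A polynomial on the product is multihomogeneous of multidegree `D`. -/
def IsMultiHomog {k : ℕ} {m : Fin k → ℕ}
    (f : MvPolynomial ((i : Fin k) × Fin (m i + 1)) ℂ) (D : Fin k → ℕ) : Prop :=
  ∀ d ∈ f.support, ∀ i : Fin k, (∑ j : Fin (m i + 1), d ⟨i, j⟩) = D i

/-- A multihomogeneous polynomial vanishes at a point of the product. -/
def PVanishP {k : ℕ} {m : Fin k → ℕ}
    (f : MvPolynomial ((i : Fin k) × Fin (m i + 1)) ℂ) (x : ProdPt m) : Prop :=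
  ∀ (v : ∀ i, Fin (m i + 1) → ℂ) (hv : ∀ i, v i ≠ 0),
    (∀ i, Projectivization.mk ℂ (v i) (hv i) = x i) → eval (assemble v) f = 0

/-- Zariski-closed subsets of the product of projective spaces. -/
def IsZClosedP {k : ℕ} {m : Fin k → ℕ} (Y : Set (ProdPt m)) : Prop :=
  ∃ fs : Set (MvPolynomial ((i : Fin k) × Fin (m i + 1)) ℂ),
    (∀ f ∈ fs, ∃ D, IsMultiHomog f D) ∧ Y = {x | ∀ f ∈ fs, PVanishP f x}

/-- `U` contains a dense Zariski-open subset of `X ⊆ ℙ^{m 0} × ⋯ × ℙ^{m(k-1)}`. -/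
def ContainsDenseOpenOfP {k : ℕ} {m : Fin k → ℕ} (X U : Set (ProdPt m)) : Prop :=
  ∃ Y : Set (ProdPt m), IsZClosedP Y ∧ ¬ X ⊆ Y ∧ X \ Y ⊆ U

/-- A rational map from (a subvariety of) the product of projective spaces to
the projective space with `t` homogeneous coordinates (i.e. `ℙ^{t-1}`), given by
a `t`-tuple of multihomogeneous polynomials of a common multidegree `e`. -/
structure PRatMap (k : ℕ) (m : Fin k → ℕ) (t : ℕ) where
  F : Fin t → MvPolynomial ((i : Fin k) × Fin (m i + 1)) ℂ
  e : Fin k → ℕ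
  homog : ∀ j, IsMultiHomog (F j) e

namespace PRatMap

variable {k : ℕ} {m : Fin k → ℕ} {t : ℕ}

def evalVec (φ : PRatMap k m t) (v : ∀ i, Fin (m i + 1) → ℂ) : Fin t → ℂ :=
  fun j => eval (assemble v) (φ.F j)

/-- `φ` is defined at `x` and sends `x` to `y`. -/
def mapsTo (φ : PRatMap k m t) (x : ProdPt m) (y : PPt (Fin t)) : Prop :=
  ∀ (v : ∀ i, Fin (m i + 1) → ℂ) (hv : ∀ i, v i ≠ 0),
    (∀ i, Projectivization.mk ℂ (v i) (hv i) = x i) →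
    ∃ hw : φ.evalVec v ≠ 0, Projectivization.mk ℂ (φ.evalVec v) hw = y

def fiber (φ : PRatMap k m t) (X : Set (ProdPt m)) (y : PPt (Fin t)) :
    Set (ProdPt m) :=
  {x ∈ X | φ.mapsTo x y}

/-- The restriction of `φ` to `X` is a dominant rational map of degree `δ`. -/
def DominantOfDegree (φ : PRatMap k m t) (X : Set (ProdPt m)) (δ : ℕ) : Prop :=
  0 < δ ∧
  ∃ V : Set (PPt (Fin t)), ContainsDenseOpenOf Set.univ V ∧
    ∀ y ∈ V, (φ.fiber X y).Finite ∧ (φ.fiber X y).ncard = δ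

end PRatMap

/-- The degree of irrationality of a subvariety `X` of a product of projective
spaces: the minimal degree of a dominant rational map from `X` to the
projective space with `t` homogeneous coordinates. -/
def irrProd {k : ℕ} {m : Fin k → ℕ} (t : ℕ) (X : Set (ProdPt m)) : ℕ :=
  sInf {δ : ℕ | ∃ φ : PRatMap k m t, φ.DominantOfDegree X δ}

/-- `A` is contained in a proper Zariski-closed subset of the space of
multidegree-`D` forms. -/
def MultiCoeffProperClosed {k : ℕ} {m : Fin k → ℕ} (D : Fin k → ℕ)
    (A : Set (MvPolynomial ((i : Fin k) × Fin (m i + 1)) ℂ)) : Prop :=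
  ∃ (κ : ℕ) (mons : Fin κ → (((i : Fin k) × Fin (m i + 1)) →₀ ℕ))
      (Q : MvPolynomial (Fin κ) ℂ),
    (∀ g ∈ A, eval (fun j => coeff (mons j) g) Q = 0) ∧
    (∃ g, IsMultiHomog (m := m) g D ∧ eval (fun j => coeff (mons j) g) Q ≠ 0)

end

/-! ### Part 1 -/

/-! ### Derivations on fields of characteristic zero -/

theorem derivation_aeval_exists {F L : Type*} [Field F] [Field L] [Algebra F L]
    (Δ : Derivation ℤ L L) (N : Subfield L) (hN : ∀ a : F, Δ (algebraMap F L a) ∈ N)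
    (x : L) (hx : x ∈ N) (p : Polynomial F) :
    ∃ r ∈ N, Δ (Polynomial.aeval x p) = r + Polynomial.aeval x (Polynomial.derivative p) * Δ x := by
  induction p using Polynomial.induction_on' with
  | add p q hp hq =>
    obtain ⟨r, hr, h1⟩ := hp
    obtain ⟨s, hs, h2⟩ := hq
    refine ⟨r + s, N.add_mem hr hs, ?_⟩
    simp only [map_add, h1, h2]; ring
  | monomial n a =>
    refine ⟨x ^ n * Δ (algebraMap F L a), N.mul_mem (N.pow_mem hx n) (hN a), ?_⟩
    simp only [Polynomial.aeval_monomial, Derivation.leibniz, Derivation.leibniz_pow,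
      Polynomial.derivative_monomial, map_mul, map_natCast, smul_eq_mul, nsmul_eq_mul]
    ring

theorem aeval_derivative_minpoly_ne_zero {F L : Type*} [Field F] [Field L] [Algebra F L] [CharZero F]
    (x : L) (hx : IsAlgebraic F x) :
    Polynomial.aeval x (Polynomial.derivative (minpoly F x)) ≠ 0 :=
  (minpoly.irreducible hx.isIntegral).separable.aeval_derivative_ne_zero (minpoly.aeval F x)

/-- A derivation stabilizing `F` stabilizes every algebraic extension of `F`. -/
theorem derivation_mem_of_algebraic {F L : Type*} [Field F] [Field L] [Algebra F L] [CharZero F]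
    (Δ : Derivation ℤ L L) (N : Subfield L) (hN : ∀ a : F, Δ (algebraMap F L a) ∈ N)
    (hF : ∀ a : F, algebraMap F L a ∈ N) (x : L) (hxN : x ∈ N) (hx : IsAlgebraic F x) :
    Δ x ∈ N := by
  obtain ⟨r, hr, h⟩ := derivation_aeval_exists Δ N hN x hxN (minpoly F x)
  rw [minpoly.aeval, map_zero] at h
  have h0 := aeval_derivative_minpoly_ne_zero x hx
  have : Δ x = - r / Polynomial.aeval x (Polynomial.derivative (minpoly F x)) := by
    rw [eq_div_iff h0]; linear_combination -h
  rw [this]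
  refine N.div_mem (N.neg_mem hr) ?_
  have : ∀ p : Polynomial F, Polynomial.aeval x p ∈ N := by
    intro p
    rw [Polynomial.aeval_eq_sum_range]
    refine N.sum_mem fun i _ => ?_
    rw [Algebra.smul_def]
    exact N.mul_mem (hF _) (N.pow_mem hxN _)
  exact this _

/-- A derivation vanishing on `F` vanishes on elements algebraic over `F`. -/
theorem derivation_eq_zero_of_algebraic {F L : Type*} [Field F] [Field L] [Algebra F L] [CharZero F]
    (Δ : Derivation ℤ L L) (hF : ∀ a : F, Δ (algebraMap F L a) = 0) (x : L)
    (hx : IsAlgebraic F x) : Δ x = 0 := by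
  have key : ∀ p : Polynomial F, Δ (Polynomial.aeval x p) =
      Polynomial.aeval x (Polynomial.derivative p) * Δ x := by
    intro p
    induction p using Polynomial.induction_on' with
    | add p q hp hq => simp only [map_add, hp, hq]; ring
    | monomial n a =>
      simp only [Polynomial.aeval_monomial, Derivation.leibniz, Derivation.leibniz_pow,
        Polynomial.derivative_monomial, map_mul, map_natCast, smul_eq_mul, nsmul_eq_mul, hF]
      ring
  have h := key (minpoly F x)
  rw [minpoly.aeval, map_zero] at h
  rcases mul_eq_zero.mp h.symm with h | h
  · exact absurd h (aeval_derivative_minpoly_ne_zero x hx)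
  · exact h

/-- Derivations are determined freely by their values on a transcendence basis. -/
theorem exists_derivation_of_basis {ι L : Type*} [Field L] [CharZero L] (v : ι → L)
    (hv : IsTranscendenceBasis ℚ v) (f : ι → L) :
    ∃ Δ : Derivation ℤ L L, ∀ j, Δ (v j) = f j := by
  classical
  let : Algebra (MvPolynomial ι ℚ) L := (MvPolynomial.aeval v).toAlgebra
  have hmap : ∀ p, algebraMap (MvPolynomial ι ℚ) L p = MvPolynomial.aeval v p := fun p => rfl
  have : IsScalarTower ℚ (MvPolynomial ι ℚ) L := IsScalarTower.of_algebraMap_eq (by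
    intro x; rw [hmap]; simp)
  have : FaithfulSMul (MvPolynomial ι ℚ) L := (faithfulSMul_iff_algebraMap_injective _ _).2 hv.1
  let Q := FractionRing (MvPolynomial ι ℚ)
  let : Algebra Q L := FractionRing.liftAlgebra (MvPolynomial ι ℚ) L
  have : IsScalarTower (MvPolynomial ι ℚ) Q L := FractionRing.isScalarTower_liftAlgebra _ _
  have hal : Algebra.IsAlgebraic (MvPolynomial ι ℚ) L := by
    have := hv.isAlgebraic
    constructor
    intro x
    obtain ⟨p, hp, hpx⟩ := this.isAlgebraic x
    let e : Algebra.adjoin ℚ (Set.range v) ≃ₐ[ℚ] MvPolynomial ι ℚ := (hv.1.aevalEquiv).symm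
    refine ⟨p.map e.toAlgHom.toRingHom, ?_, ?_⟩
    · rwa [Ne, Polynomial.map_eq_zero_iff e.injective]
    · rw [← hpx, Polynomial.aeval_def, Polynomial.aeval_def, Polynomial.eval₂_map]
      congr 1
      ext a
      change (MvPolynomial.aeval v) (e a) = _
      have := hv.1.algebraMap_aevalEquiv (e a)
      rw [← this]
      congr 1
      exact hv.1.aevalEquiv.apply_symm_apply a
  have : Algebra.IsAlgebraic Q L :=
    (IsFractionRing.comap_isAlgebraic_iff (A := MvPolynomial ι ℚ) (K := Q) (C := L)).1 hal
  have : CharZero Q := charZero_of_injective_algebraMap (algebraMap ℚ Q).injective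
  have : Algebra.IsSeparable Q L := inferInstance
  have : Algebra.FormallyEtale Q L := Algebra.FormallyEtale.of_isSeparable Q L
  have : Algebra.FormallyEtale (MvPolynomial ι ℚ) Q :=
    Algebra.FormallyEtale.of_isLocalization (nonZeroDivisors (MvPolynomial ι ℚ))
  have : Algebra.FormallyEtale (MvPolynomial ι ℚ) L := Algebra.FormallyEtale.comp _ Q _
  let E := KaehlerDifferential.tensorKaehlerEquivOfFormallyEtale ℚ (MvPolynomial ι ℚ) L
  let δ : Derivation ℚ (MvPolynomial ι ℚ) L := MvPolynomial.mkDerivation ℚ f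
  let l : TensorProduct (MvPolynomial ι ℚ) L (KaehlerDifferential ℚ (MvPolynomial ι ℚ)) →ₗ[L] L :=
    TensorProduct.AlgebraTensorModule.lift
      ((LinearMap.lsmul L (KaehlerDifferential ℚ (MvPolynomial ι ℚ) →ₗ[MvPolynomial ι ℚ] L)).flip
        δ.liftKaehlerDifferential)
  let Δ : Derivation ℚ L L := (l ∘ₗ E.symm.toLinearMap).compDer (KaehlerDifferential.D ℚ L)
  refine ⟨Δ.restrictScalars ℤ, fun j => ?_⟩
  change l (E.symm (KaehlerDifferential.D ℚ L (v j))) = f j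
  have : v j = algebraMap (MvPolynomial ι ℚ) L (X j) := by rw [hmap]; simp
  rw [this, KaehlerDifferential.tensorKaehlerEquivOfFormallyEtale_symm_D_algebraMap]
  simp [l, δ, MvPolynomial.mkDerivation_X]

/-! ### Part 2 -/

/-! ### Places of function fields of one variable and derivations -/

open scoped WithZero in
/-- `v` is a place of `M/k`, with residue field `k`, at which the logarithmic derivations
at `u` preserve the valuation filtration. -/
structure IsPlace (k M : Type) [Field k] [Field M] [Algebra k M] (v : Valuation M ℤᵐ⁰) (u : M) :
    Prop where
  triv : ∀ c : k, c ≠ 0 → v (algebraMap k M c) = 1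
  lt : v u < 1
  ne : u ≠ 0
  res : ∀ x, v x ≤ 1 → ∃ c : k, v (x - algebraMap k M c) < 1
  logBound : ∀ θ : Derivation ℤ M M, (∀ c : k, ∃ c' : k, θ (algebraMap k M c) = algebraMap k M c') →
    v (θ u) ≤ v u → ∀ x, v (θ x) ≤ v x

theorem derivation_zpow_div {M : Type*} [Field M] (θ : Derivation ℤ M M) (x : M) (hx : x ≠ 0) (n : ℤ) :
    θ (x ^ n) / x ^ n = n * (θ x / x) := by
  rw [Derivation.leibniz_zpow, zpow_sub_one₀ hx]
  have := zpow_ne_zero n hx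
  simp only [zsmul_eq_mul, smul_eq_mul]
  field_simp

theorem derivation_mul_div {M : Type*} [Field M] (θ : Derivation ℤ M M) (x y : M) (hx : x ≠ 0)
    (hy : y ≠ 0) : θ (x * y) / (x * y) = θ x / x + θ y / y := by
  rw [Derivation.leibniz]
  simp only [smul_eq_mul]
  field_simp
  ring

open scoped WithZero in
theorem log_bound_step {k M : Type} [Field k] [CharZero k] [Field M] [Algebra k M] (v : Valuation M ℤᵐ⁰) (u : M)
    (triv : ∀ c : k, c ≠ 0 → v (algebraMap k M c) = 1) (lt : v u < 1) (ne : u ≠ 0)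
    (res : ∀ x, v x ≤ 1 → ∃ c : k, v (x - algebraMap k M c) < 1)
    (θ : Derivation ℤ M M) (hk : ∀ c : k, ∃ c' : k, θ (algebraMap k M c) = algebraMap k M c')
    (hu : v (θ u) ≤ v u) (γ : ℕ) (hγ : ∀ x, v (θ x) ≤ WithZero.exp ((γ + 1 : ℕ) : ℤ) * v x) :
    ∀ x, v (θ x) ≤ WithZero.exp (γ : ℤ) * v x := by
  intro x
  rcases eq_or_ne x 0 with rfl | hx
  · simp
  have trivle : ∀ c : k, v (algebraMap k M c) ≤ 1 := by
    intro c
    rcases eq_or_ne c 0 with rfl | hc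
    · simp
    · exact (triv c hc).le
  have hvu : v u ≠ 0 := v.ne_zero_iff.2 ne
  have hvx : v x ≠ 0 := v.ne_zero_iff.2 hx
  obtain ⟨e, he⟩ : ∃ e : ℕ, WithZero.log (v u) = -((e : ℤ) + 1) := by
    have : WithZero.log (v u) < 0 := by
      rw [WithZero.log_lt_iff_lt_exp hvu]; simpa using lt
    exact ⟨(-WithZero.log (v u) - 1).toNat, by omega⟩
  set a := WithZero.log (v x) with ha
  have hE : WithZero.exp (γ : ℤ) ≥ 1 := by
    rw [← WithZero.exp_zero, ge_iff_le, WithZero.exp_le_exp]; positivity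
  let y := x ^ ((e : ℤ) + 1) * u ^ a
  have hy0 : y ≠ 0 := mul_ne_zero (zpow_ne_zero _ hx) (zpow_ne_zero _ ne)
  have hvy : v y = 1 := by
    have h0 : v y ≠ 0 := v.ne_zero_iff.2 hy0
    rw [← WithZero.exp_log h0, ← WithZero.exp_zero]
    congr 1
    simp only [y, map_mul, map_zpow₀]
    rw [WithZero.log_mul (zpow_ne_zero _ hvx) (zpow_ne_zero _ hvu), WithZero.log_zpow, WithZero.log_zpow, he, ← ha]
    simp only [smul_eq_mul]; ring
  obtain ⟨c, hc⟩ := res y hvy.le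
  have h1 : v (θ y) ≤ WithZero.exp (γ : ℤ) := by
    have : y = algebraMap k M c + (y - algebraMap k M c) := by ring
    rw [this, map_add]
    refine v.map_add_le ?_ ?_
    · obtain ⟨c', hc'⟩ := hk c
      rw [hc']
      exact (trivle c').trans hE
    · refine (hγ _).trans ?_
      have h2 : v (y - algebraMap k M c) ≤ WithZero.exp (-1 : ℤ) := by
        rcases eq_or_ne (v (y - algebraMap k M c)) 0 with h0 | h0
        · rw [h0]; exact zero_le
        · rw [← WithZero.log_le_iff_le_exp h0]
          have := (WithZero.log_lt_iff_lt_exp (a := 0) h0).2 (by simpa using hc)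
          omega
      calc _ ≤ WithZero.exp ((γ + 1 : ℕ) : ℤ) * WithZero.exp (-1 : ℤ) := by gcongr
        _ = WithZero.exp (γ : ℤ) := by rw [← WithZero.exp_add]; congr 1; push_cast; ring
  have h2 : θ y / y = ((e : ℤ) + 1 : ℤ) * (θ x / x) + a * (θ u / u) := by
    simp only [y]
    rw [derivation_mul_div _ _ _ (zpow_ne_zero _ hx) (zpow_ne_zero _ ne), derivation_zpow_div _ _ hx,
      derivation_zpow_div _ _ ne]
  have hIntg : ∀ n : ℤ, v (n : M) ≤ 1 := by
    intro n
    have := trivle (n : k)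
    simpa using this
  have h3 : v (((e : ℤ) + 1 : ℤ) : M) = 1 := by
    have := triv (((e : ℤ) + 1 : ℤ) : k) (by
      have : ((e : ℤ) + 1) ≠ 0 := by positivity
      exact_mod_cast this)
    rwa [map_intCast] at this
  have h4 : v (θ x / x) ≤ WithZero.exp (γ : ℤ) := by
    have : v (θ x / x) = v ((((e : ℤ) + 1 : ℤ) : M) * (θ x / x)) := by rw [map_mul, h3, one_mul]
    rw [this, show (((e : ℤ) + 1 : ℤ) : M) * (θ x / x) = θ y / y - a * (θ u / u) by rw [h2]; ring]
    refine v.map_sub_le ?_ ?_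
    · rw [map_div₀, hvy, div_one]; exact h1
    · rw [map_mul, map_div₀]
      refine le_trans ?_ hE
      have : v (θ u) / v u ≤ 1 := div_le_one_of_le₀ hu zero_le
      calc _ ≤ (1 : ℤᵐ⁰) * 1 := by gcongr; exact hIntg a
        _ = 1 := by simp
  rw [map_div₀] at h4
  rwa [div_le_iff₀ (zero_lt_iff.2 hvx)] at h4

open scoped WithZero in
theorem log_bound {k M : Type} [Field k] [CharZero k] [Field M] [Algebra k M] (v : Valuation M ℤᵐ⁰) (u : M)
    (triv : ∀ c : k, c ≠ 0 → v (algebraMap k M c) = 1) (lt : v u < 1) (ne : u ≠ 0)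
    (res : ∀ x, v x ≤ 1 → ∃ c : k, v (x - algebraMap k M c) < 1)
    (θ : Derivation ℤ M M) (hk : ∀ c : k, ∃ c' : k, θ (algebraMap k M c) = algebraMap k M c')
    (hu : v (θ u) ≤ v u) (γ : ℕ) (hγ : ∀ x, v (θ x) ≤ WithZero.exp (γ : ℤ) * v x) :
    ∀ x, v (θ x) ≤ v x := by
  induction γ with
  | zero => intro x; simpa using hγ x
  | succ n ih => exact ih (log_bound_step v u triv lt ne res θ hk hu n hγ)

/-! ### Part 3 -/

open scoped WithZero in
theorem exists_place (k M : Type) [Field k] [IsAlgClosed k] [CharZero k] [Field M] [Algebra k M]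
    [Algebra (RatFunc k) M] [IsScalarTower k (RatFunc k) M] [FiniteDimensional (RatFunc k) M] (α : k) :
    ∃ v : Valuation M ℤᵐ⁰, IsPlace k M v (algebraMap (RatFunc k) M RatFunc.X - algebraMap k M α) := by
  classical
  have hroot : Polynomial.eval α (Polynomial.X - Polynomial.C α : Polynomial k) = 0 := by simp
  have hroot2 : ∀ x : Polynomial k, Polynomial.eval α (Polynomial.C (Polynomial.eval α x) - x) = 0 := by simp
  let A := Polynomial k
  let K := RatFunc k
  let algAM : Algebra A M := ((algebraMap K M).comp (algebraMap A K)).toAlgebra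
  have hAKM : IsScalarTower A K M := IsScalarTower.of_algebraMap_eq (fun x => rfl)
  have hkAM : IsScalarTower k A M := IsScalarTower.of_algebraMap_eq (fun x => by
    rw [IsScalarTower.algebraMap_apply k K M, IsScalarTower.algebraMap_apply A K M,
      IsScalarTower.algebraMap_apply k A K])
  have : CharZero K := charZero_of_injective_algebraMap (algebraMap k K).injective
  have : Algebra.IsSeparable K M := inferInstance
  let B := integralClosure A M
  have hded : IsDedekindDomain B := integralClosure.isDedekindDomain A K M
  have hfrac : IsFractionRing B M := integralClosure.isFractionRing_of_finite_extension K M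
  have hfin : Module.Finite A B := IsIntegralClosure.finite A K M B
  have hinjAM : Function.Injective (algebraMap A M) := by
    rw [IsScalarTower.algebraMap_eq A K M]
    exact (algebraMap K M).injective.comp (IsFractionRing.injective A K)
  have hinjAB : Function.Injective (algebraMap A B) := by
    intro a b h
    apply hinjAM
    rw [IsScalarTower.algebraMap_apply A B M, h, ← IsScalarTower.algebraMap_apply A B M]
  let p : Ideal A := Ideal.span {Polynomial.X - Polynomial.C α}
  have hpmax : p.IsMaximal := by
    apply PrincipalIdealRing.isMaximal_of_irreducible
    exact Polynomial.irreducible_X_sub_C α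
  obtain ⟨P, hPmax, hPp⟩ := Ideal.exists_ideal_over_maximal_of_isIntegral (S := B) p (by
    rw [(RingHom.injective_iff_ker_eq_bot _).1 hinjAB]; exact bot_le)
  have hmemp : ∀ f : A, algebraMap A B f ∈ P ↔ f.eval α = 0 := by
    intro f
    rw [← Ideal.mem_comap, hPp, Ideal.mem_span_singleton, Polynomial.dvd_iff_isRoot]; rfl
  let uA : A := Polynomial.X - Polynomial.C α
  have huA : uA ≠ 0 := Polynomial.X_sub_C_ne_zero α
  have hPbot : P ≠ ⊥ := by
    intro h
    have h1 : algebraMap A B uA ∈ P := (hmemp _).2 hroot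
    rw [h, Ideal.mem_bot, ← map_zero (algebraMap A B)] at h1
    exact huA (hinjAB h1)
  let W : IsDedekindDomain.HeightOneSpectrum B := ⟨P, hPmax.isPrime, hPbot⟩
  let v := W.valuation M
  have hu : algebraMap (RatFunc k) M RatFunc.X - algebraMap k M α = algebraMap B M (algebraMap A B uA) := by
    rw [← IsScalarTower.algebraMap_apply A B M, IsScalarTower.algebraMap_apply A K M,
      IsScalarTower.algebraMap_apply k K M]
    simp [uA, K, RatFunc.algebraMap_X, RatFunc.algebraMap_C]
    rfl
  have hkB : ∀ c : k, algebraMap k M c = algebraMap B M (algebraMap A B (Polynomial.C c)) := by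
    intro c
    rw [← IsScalarTower.algebraMap_apply A B M, IsScalarTower.algebraMap_apply k A M]; rfl
  have triv : ∀ c : k, c ≠ 0 → v (algebraMap k M c) = 1 := by
    intro c hc
    rw [hkB]
    apply (IsDedekindDomain.HeightOneSpectrum.valuation_eq_one_iff_notMem W).2
    change _ ∉ P
    rw [hmemp]; simpa using hc
  have trivle : ∀ c : k, v (algebraMap k M c) ≤ 1 := by
    intro c
    rcases eq_or_ne c 0 with rfl | hc
    · simp
    · exact (triv c hc).le
  have hBle : ∀ b : B, v (algebraMap B M b) ≤ 1 := fun b => W.valuation_le_one b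
  have hmemP : ∀ b : B, v (algebraMap B M b) < 1 ↔ b ∈ P := fun b => W.valuation_lt_one_iff_mem b
  have hlt : v (algebraMap (RatFunc k) M RatFunc.X - algebraMap k M α) < 1 := by
    rw [hu, hmemP, hmemp]; exact hroot
  have hne : algebraMap (RatFunc k) M RatFunc.X - algebraMap k M α ≠ 0 := by
    rw [hu, ← IsScalarTower.algebraMap_apply A B M]
    exact fun h => huA (hinjAM (by rw [h, map_zero]))
  have resB : ∀ b : B, ∃ c : k, b - algebraMap A B (Polynomial.C c) ∈ P := by
    intro b
    obtain ⟨f, hf, hfb⟩ := Algebra.IsIntegral.isIntegral (R := A) b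
    let fb : Polynomial k := f.map (Polynomial.evalRingHom α)
    have hfbm : fb.Monic := hf.map _
    have hsplit := IsAlgClosed.splits fb
    have h1 : (Polynomial.eval₂ ((Ideal.Quotient.mk P).comp ((algebraMap A B).comp Polynomial.C))
        (Ideal.Quotient.mk P b) fb) = 0 := by
      rw [Polynomial.eval₂_map]
      have h2 := congrArg (Ideal.Quotient.mk P) hfb
      rw [map_zero, Polynomial.hom_eval₂] at h2
      rw [← h2]
      congr 1
      refine RingHom.ext fun x => ?_
      simp only [RingHom.comp_apply]
      rw [Ideal.Quotient.eq, ← map_sub, hmemp]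
      exact hroot2 x
    have h3 : Polynomial.eval₂ ((Ideal.Quotient.mk P).comp ((algebraMap A B).comp Polynomial.C))
        (Ideal.Quotient.mk P b) fb =
        (fb.roots.map fun c => Ideal.Quotient.mk P (b - algebraMap A B (Polynomial.C c))).prod := by
      conv_lhs => rw [hsplit.eq_prod_roots_of_monic hfbm]
      rw [← Polynomial.coe_eval₂RingHom, map_multiset_prod, Multiset.map_map]
      simp
    rw [h3, Multiset.prod_eq_zero_iff, Multiset.mem_map] at h1
    obtain ⟨c, -, hc⟩ := h1
    exact ⟨c, Ideal.Quotient.eq_zero_iff_mem.1 hc⟩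
  have res : ∀ x, v x ≤ 1 → ∃ c : k, v (x - algebraMap k M c) < 1 := by
    intro x hx
    obtain ⟨a, ha⟩ := W.exists_valuation_sub_lt_of_integer hx 1
    obtain ⟨c, hc⟩ := resB a
    refine ⟨c, ?_⟩
    rw [← hmemP, map_sub, ← hkB] at hc
    have : x - algebraMap k M c = (algebraMap B M a - algebraMap k M c) - (algebraMap B M a - x) := by ring
    rw [this]
    exact (v.map_sub _ _).trans_lt (max_lt hc ha)
  refine ⟨v, triv, hlt, hne, res, ?_⟩
  intro θ hk hθu
  obtain ⟨s, hs⟩ := hfin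
  set t := algebraMap (RatFunc k) M RatFunc.X with ht
  have hpoly : ∀ f : A, v (θ (algebraMap A M f)) ≤ max 1 (v (θ t)) := by
    intro f
    have htA : algebraMap A M Polynomial.X = t := by
      rw [IsScalarTower.algebraMap_apply A K M, ht]; simp [K, RatFunc.algebraMap_X]; rfl
    have htle : v t ≤ 1 := by
      rw [← htA, IsScalarTower.algebraMap_apply A B M]; exact hBle _
    induction f using Polynomial.induction_on' with
    | add p q hp hq => rw [map_add, map_add]; exact v.map_add_le hp hq
    | monomial n c =>
      rw [← Polynomial.C_mul_X_pow_eq_monomial, map_mul, map_pow, htA]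
      have : algebraMap A M (Polynomial.C c) = algebraMap k M c := by
        rw [IsScalarTower.algebraMap_apply k A M]; rfl
      rw [this, Derivation.leibniz, Derivation.leibniz_pow]
      obtain ⟨c', hc'⟩ := hk c
      rw [hc']
      simp only [smul_eq_mul, nsmul_eq_mul]
      refine v.map_add_le ?_ ?_
      · refine le_trans ?_ (le_max_right _ _)
        rw [map_mul, map_mul, map_mul, map_pow]
        have hn : v (n : M) ≤ 1 := by simpa using trivle (n : k)
        calc v (algebraMap k M c) * (v (n : M) * (v t ^ (n - 1) * v (θ t)))
            ≤ 1 * (1 * (1 * v (θ t))) := by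
              gcongr
              · exact trivle c
              · exact pow_le_one₀ zero_le htle
          _ = v (θ t) := by simp
      · refine le_trans ?_ (le_max_left _ _)
        rw [map_mul, map_pow]
        calc _ ≤ (1 : ℤᵐ⁰) * 1 := by
              gcongr
              · exact pow_le_one₀ zero_le htle
              · exact trivle c'
          _ = 1 := by simp
  obtain ⟨C, hC1, hC⟩ : ∃ C : ℤᵐ⁰, 1 ≤ C ∧ ∀ b : B, v (θ (algebraMap B M b)) ≤ C := by
    let C := max (max 1 (v (θ t))) (s.sup fun b => v (θ (algebraMap B M b)))
    refine ⟨C, (le_max_left _ _).trans (le_max_left _ _), fun b => ?_⟩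
    have hb : b ∈ Submodule.span A (s : Set B) := by rw [hs]; trivial
    induction hb using Submodule.span_induction with
    | mem x hx =>
      refine le_trans ?_ (le_max_right _ _)
      exact Finset.le_sup (f := fun b => v (θ (algebraMap B M b))) hx
    | zero => simp
    | add x y _ _ hx hy => rw [map_add, map_add]; exact v.map_add_le hx hy
    | smul a x _ hx =>
      rw [Algebra.smul_def, map_mul, Derivation.leibniz]
      simp only [smul_eq_mul]
      refine v.map_add_le ?_ ?_
      · rw [map_mul]
        calc _ ≤ 1 * C := by gcongr; exact hBle _
          _ = C := one_mul _
      · rw [map_mul, ← IsScalarTower.algebraMap_apply A B M]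
        calc _ ≤ 1 * max 1 (v (θ t)) := by gcongr; exacts [hBle _, hpoly a]
          _ ≤ C := by rw [one_mul]; exact le_max_left _ _
  have hO : ∀ x, v x ≤ 1 → v (θ x) ≤ C := by
    intro x hx
    obtain ⟨n, ⟨dd, hdd⟩, hnd⟩ := W.exists_primeCompl_mul_eq_of_integer x hx
    have hd1 : v (algebraMap B M dd) = 1 :=
      (IsDedekindDomain.HeightOneSpectrum.valuation_eq_one_iff_notMem W).2 hdd
    have h1 := congrArg θ hnd
    simp only [Derivation.leibniz, smul_eq_mul] at h1
    have h2 : v (θ x) = v (algebraMap B M dd * θ x) := by rw [map_mul, hd1, one_mul]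
    rw [h2, show algebraMap B M dd * θ x = θ (algebraMap B M n) - x * θ (algebraMap B M dd) by
      rw [← h1]; ring]
    refine v.map_sub_le (hC _) ?_
    rw [map_mul]
    calc _ ≤ 1 * C := by gcongr; exact hC _
      _ = C := one_mul _
  obtain ⟨π, hπ⟩ := W.valuation_exists_uniformizer M
  change v π = _ at hπ
  have hπ0 : π ≠ 0 := v.ne_zero_iff.1 (by rw [hπ]; simp)
  let C' := max C (v (θ π / π))
  have hC'0 : C' ≠ 0 := (zero_lt_one.trans_le (hC1.trans (le_max_left _ _))).ne'
  have hlog : ∀ x, v (θ x) ≤ C' * v x := by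
    intro x
    rcases eq_or_ne x 0 with rfl | hx
    · simp
    have hvx : v x ≠ 0 := v.ne_zero_iff.2 hx
    set a := WithZero.log (v x) with ha
    let w := x * π ^ a
    have hw0 : w ≠ 0 := mul_ne_zero hx (zpow_ne_zero _ hπ0)
    have hvw : v w = 1 := by
      simp only [w, map_mul, map_zpow₀, hπ]
      rw [← WithZero.exp_zsmul]
      nth_rewrite 1 [← WithZero.exp_log hvx]
      rw [← WithZero.exp_add, ← WithZero.exp_zero, ← ha]
      congr 1
      simp
    have h1 : θ w / w = θ x / x + a * (θ π / π) := by
      rw [derivation_mul_div _ _ _ hx (zpow_ne_zero _ hπ0), derivation_zpow_div _ _ hπ0]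
    have h2 : v (θ x / x) ≤ C' := by
      rw [show θ x / x = θ w / w - a * (θ π / π) by rw [h1]; ring]
      refine v.map_sub_le ?_ ?_
      · rw [map_div₀, hvw, div_one]; exact (hO w hvw.le).trans (le_max_left _ _)
      · rw [map_mul]
        have hn : v (a : M) ≤ 1 := by simpa using trivle (a : k)
        calc _ ≤ 1 * v (θ π / π) := by gcongr
          _ ≤ C' := by rw [one_mul]; exact le_max_right _ _
    rw [map_div₀] at h2
    rwa [div_le_iff₀ (zero_lt_iff.2 hvx)] at h2
  refine log_bound v _ triv hlt hne res θ hk hθu (WithZero.log C').toNat (fun x => (hlog x).trans ?_)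
  gcongr
  nth_rewrite 1 [← WithZero.exp_log hC'0]
  rw [WithZero.exp_le_exp]
  exact Int.self_le_toNat _

/-! ### Part 4 -/

open scoped WithZero in
theorem IsPlace.triv_le {k M : Type} [Field k] [Field M] [Algebra k M] {v : Valuation M ℤᵐ⁰} {u : M}
    (hv : IsPlace k M v u) (c : k) : v (algebraMap k M c) ≤ 1 := by
  rcases eq_or_ne c 0 with rfl | hc
  · simp
  · exact (hv.triv c hc).le

open scoped WithZero in
theorem IsPlace.eq_zero {k M : Type} [Field k] [Field M] [Algebra k M] {v : Valuation M ℤᵐ⁰} {u : M}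
    (hv : IsPlace k M v u) (c : k) (hc : v (algebraMap k M c) < 1) : c = 0 := by
  by_contra h
  exact hc.ne (hv.triv c h)

open scoped WithZero in
/-- A rational function whose product with `t - α` is in the maximal ideal is regular at `α`. -/
theorem denom_eval_ne_zero {k M : Type} [Field k] [Field M] [Algebra k M]
    [Algebra (RatFunc k) M] [IsScalarTower k (RatFunc k) M] (α : k) (v : Valuation M ℤᵐ⁰)
    (hv : IsPlace k M v (algebraMap (RatFunc k) M RatFunc.X - algebraMap k M α)) (h : RatFunc k)
    (hh : v ((algebraMap (RatFunc k) M RatFunc.X - algebraMap k M α) * algebraMap (RatFunc k) M h) < 1) :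
    h.denom.eval α ≠ 0 := by
  intro h0
  set u := algebraMap (RatFunc k) M RatFunc.X - algebraMap k M α with hu
  let ι : Polynomial k →+* M := (algebraMap (RatFunc k) M).comp (algebraMap (Polynomial k) (RatFunc k))
  have hX : ι Polynomial.X = u + algebraMap k M α := by
    simp [ι, hu, RatFunc.algebraMap_X]
  have hC : ∀ c, ι (Polynomial.C c) = algebraMap k M c := by
    intro c
    rw [IsScalarTower.algebraMap_apply k (RatFunc k) M]
    simp [ι, RatFunc.algebraMap_C]
  have hle : ∀ p, v (ι p) ≤ 1 := by
    intro p
    induction p using Polynomial.induction_on' with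
    | add p q hp hq => rw [map_add]; exact v.map_add_le hp hq
    | monomial n c =>
      rw [← Polynomial.C_mul_X_pow_eq_monomial, map_mul, map_pow, hC, hX, map_mul, map_pow]
      refine mul_le_one₀ (hv.triv_le c) zero_le (pow_le_one₀ zero_le ?_)
      exact v.map_add_le hv.lt.le (hv.triv_le α)
  have hu' : ι (Polynomial.X - Polynomial.C α) = u := by rw [map_sub, hX, hC]; ring
  have hnum : h.num.eval α ≠ 0 := by
    intro h1
    have hc := RatFunc.isCoprime_num_denom h
    obtain ⟨a, b, hab⟩ := hc
    have := congrArg (Polynomial.eval α) hab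
    simp [h0, h1] at this
  have hvnum : v (ι h.num) = 1 := by
    obtain ⟨q, hq⟩ := Polynomial.dvd_iff_isRoot.2
      (show (h.num - Polynomial.C (h.num.eval α)).IsRoot α by simp)
    have : ι h.num = ι (Polynomial.C (h.num.eval α)) + u * ι q := by
      rw [← hu', ← map_mul, ← hq, ← map_add]; congr 1; ring
    rw [this, hC]
    rw [v.map_add_eq_of_lt_left]
    · exact hv.triv _ hnum
    · rw [hv.triv _ hnum, map_mul]
      calc _ ≤ v u * 1 := by gcongr; exact hle q
        _ < 1 := by rw [mul_one]; exact hv.lt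
  obtain ⟨q, hq⟩ := Polynomial.dvd_iff_isRoot.2 (show h.denom.IsRoot α from h0)
  have h2 : (u * algebraMap (RatFunc k) M h) * ι q = ι h.num := by
    have h3 : h * algebraMap (Polynomial k) (RatFunc k) h.denom = algebraMap _ _ h.num := by
      nth_rewrite 1 [← RatFunc.num_div_denom h]
      have : algebraMap (Polynomial k) (RatFunc k) h.denom ≠ 0 := by
        simpa using RatFunc.denom_ne_zero h
      field_simp
    have h4 := congrArg (algebraMap (RatFunc k) M) h3
    rw [map_mul] at h4
    change _ * ι h.denom = ι h.num at h4
    rw [← h4, hq, map_mul, hu']; ring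
  have h5 := congrArg v h2
  rw [map_mul, hvnum] at h5
  have h6 : v (u * algebraMap (RatFunc k) M h) * v (ι q) < 1 := by
    calc _ ≤ v (u * algebraMap (RatFunc k) M h) * 1 := by gcongr; exact hle q
      _ < 1 := by rw [mul_one]; exact hh
  exact h6.ne h5

/-- A rational function without poles is a polynomial. -/
theorem ratFunc_eq_polynomial {k : Type} [Field k] [IsAlgClosed k] (h : RatFunc k)
    (hh : ∀ α, h.denom.eval α ≠ 0) : ∃ p : Polynomial k, h = algebraMap _ _ p := by
  have : h.denom = 1 := by
    have hd : h.denom.degree = 0 := by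
      by_contra hd
      obtain ⟨x, hx⟩ := IsAlgClosed.exists_root h.denom hd
      exact hh x hx
    exact Polynomial.eq_one_of_monic_natDegree_zero (RatFunc.monic_denom h)
      (Polynomial.natDegree_eq_of_degree_eq_some hd)
  refine ⟨h.num, ?_⟩
  conv_lhs => rw [← RatFunc.num_div_denom h, this]
  simp

/-- A function polynomial in `t` and such that `t² h` is polynomial in `1/t` vanishes. -/
theorem eq_zero_of_poly_inv {k L : Type} [Field k] [Field L] [Algebra k L] (t : L)
    (ht : Transcendental k t) (h : L) (p q : Polynomial k) (h1 : h = Polynomial.aeval t p)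
    (h2 : t ^ 2 * h = Polynomial.aeval t⁻¹ q) : h = 0 := by
  have ht0 : t ≠ 0 := by rintro rfl; exact ht isAlgebraic_zero
  have h3 : Polynomial.aeval t⁻¹ q * t ^ q.natDegree = Polynomial.aeval t q.reverse := by
    let _ : Invertible t⁻¹ := invertibleOfNonzero (inv_ne_zero ht0)
    have h5 := Polynomial.eval₂_reverse_mul_pow (algebraMap k L) t⁻¹ q
    rw [invOf_eq_inv, inv_inv] at h5
    rw [Polynomial.aeval_def, Polynomial.aeval_def, ← h5, mul_assoc, ← mul_pow,
      inv_mul_cancel₀ ht0, one_pow, mul_one]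
  have h4 : p * Polynomial.X ^ (2 + q.natDegree) = q.reverse := by
    apply transcendental_iff_injective.1 ht
    rw [← h3, ← h2, h1]
    simp; ring
  by_contra hne
  have hp : p ≠ 0 := by rintro rfl; apply hne; rw [h1]; simp
  have h5 := congrArg Polynomial.natDegree h4
  rw [Polynomial.natDegree_mul_X_pow _ hp] at h5
  have := Polynomial.reverse_natDegree_le q
  omega

/-! ### Part 5 -/

open scoped WithZero in
theorem det_valuation_lt {σ M : Type} [Fintype σ] [DecidableEq σ] [Field M] (v : Valuation M ℤᵐ⁰)
    (A : Matrix σ σ M) (W Λ : σ → ℤᵐ⁰) (hW : ∀ p, 0 < W p) (hΛ : ∀ s, 0 < Λ s) (p0 : σ)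
    (h : ∀ p s, v (A p s) ≤ W p * Λ s) (h0 : ∀ s, v (A p0 s) < W p0 * Λ s) :
    v A.det < (∏ p, W p) * ∏ s, Λ s := by
  rw [Matrix.det_apply]
  apply v.map_sum_lt
  · exact (mul_pos (Finset.prod_pos fun p _ => hW p) (Finset.prod_pos fun p _ => hΛ p)).ne'
  intro π _
  have h1 : v (Equiv.Perm.sign π • ∏ i, A (π i) i) = ∏ i, v (A (π i) i) := by
    rw [← map_prod]
    rcases Int.units_eq_one_or (Equiv.Perm.sign π) with h | h <;> simp [h]
  rw [h1]
  have h2 : (∏ p, W p) * ∏ s, Λ s = ∏ s, (W (π s) * Λ s) := by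
    rw [Finset.prod_mul_distrib, Equiv.prod_comp π W]
  rw [h2, ← Finset.mul_prod_erase Finset.univ _ (Finset.mem_univ (π.symm p0)),
    ← Finset.mul_prod_erase Finset.univ (fun s => W (π s) * Λ s) (Finset.mem_univ (π.symm p0))]
  apply mul_lt_mul_of_lt_of_le_of_nonneg_of_pos
  · simpa using h0 (π.symm p0)
  · exact Finset.prod_le_prod' fun i _ => h _ _
  · exact zero_le
  · exact Finset.prod_pos fun i _ => mul_pos (hW _) (hΛ _)

open scoped WithZero in
theorem local_bound {σ κ ν k M : Type} [Fintype σ] [DecidableEq σ] [Fintype κ] [DecidableEq κ] [Fintype ν]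
    [Field k] [Field M] [Algebra k M]
    (blk : σ → κ) (v : Valuation M ℤᵐ⁰) (t : M) (α : k) (hv : IsPlace k M v (t - algebraMap k M α))
    (Δ0 : Derivation ℤ M M) (Δ : ν → Derivation ℤ M M)
    (h0k : ∀ c : k, Δ0 (algebraMap k M c) = 0) (h0t : Δ0 t = 1)
    (hk : ∀ a, ∀ c : k, ∃ c' : k, Δ a (algebraMap k M c) = algebraMap k M c') (ht : ∀ a, Δ a t = 0)
    (X : σ → M) (Λ : κ → M) (hΛ : ∀ i, Λ i ≠ 0) (hX : ∀ s, v (X s) ≤ v (Λ (blk s)))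
    (p0 : σ) (ρ : σ → σ → M) (χ : σ → ν → M) (A : Matrix σ σ M)
    (hA0 : ∀ s, A p0 s = Δ0 (X s))
    (hA : ∀ p, p ≠ p0 → ∀ s, A p s = ρ p s + ∑ a, χ p a * Δ a (X s))
    (e : κ → σ) (he : Function.Injective e) (hep : ∀ i, e i ≠ p0)
    (heA : ∀ i s, A (e i) s = if blk s = i then X s else 0) (heχ : ∀ i a, χ (e i) a = 0)
    (W : σ → ℤᵐ⁰) (hW : ∀ p, 0 < W p) (hW0 : W p0 = 1)
    (hρ : ∀ p, p ≠ p0 → ∀ s, v (ρ p s) ≤ W p * v (Λ (blk s)))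
    (hχ : ∀ p, p ≠ p0 → ∀ a, v (χ p a) ≤ W p) :
    v ((t - algebraMap k M α) * A.det) < (∏ p, W p) * ∏ s, v (Λ (blk s)) := by
  classical
  set u := t - algebraMap k M α with hu
  have hvΛ : ∀ i, 0 < v (Λ i) := fun i => zero_lt_iff.2 (v.ne_zero_iff.2 (hΛ i))
  let θ : ν → Derivation ℤ M M := fun a => Δ a + (Δ a (algebraMap k M α)) • Δ0
  have hθ : ∀ a x, θ a x = Δ a x + Δ a (algebraMap k M α) * Δ0 x := fun a x => rfl
  have hθv : ∀ a x, v (θ a x) ≤ v x := by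
    intro a
    apply hv.logBound
    · intro c
      obtain ⟨c', hc'⟩ := hk a c
      exact ⟨c', by rw [hθ, h0k, hc']; ring⟩
    · rw [hθ, hu, map_sub, map_sub, ht, h0t, h0k]; simp
  let θ0 : Derivation ℤ M M := u • Δ0
  have hθ0 : ∀ x, θ0 x = u * Δ0 x := fun x => rfl
  have hθ0k : ∀ c : k, θ0 (algebraMap k M c) = 0 := fun c => by rw [hθ0, h0k, mul_zero]
  have hθ0v : ∀ x, v (θ0 x) ≤ v x := by
    apply hv.logBound
    · exact fun c => ⟨0, by rw [hθ0k]; simp⟩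
    · rw [hθ0, hu, map_sub, h0t, h0k]; simp
  have hθ0lt : ∀ x, v x ≤ 1 → v (θ0 x) < 1 := by
    intro x hx
    obtain ⟨c, hc⟩ := hv.res x hx
    have : θ0 x = θ0 (x - algebraMap k M c) := by rw [map_sub, hθ0k, sub_zero]
    rw [this]
    exact (hθ0v _).trans_lt hc
  -- first transformation
  let b : σ → M := fun p => if p = p0 then 0 else ∑ a, χ p a * Δ a (algebraMap k M α)
  let A1 : Matrix σ σ M := fun p s => A p s + b p * A p0 s
  have hdet1 : A1.det = A.det :=
    Matrix.det_eq_of_forall_row_eq_smul_add_const b p0 (by simp [b]) (fun _ _ => rfl)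
  have hA1p0 : ∀ s, A1 p0 s = A p0 s := by intro s; simp [A1, b]
  have hA1 : ∀ p, p ≠ p0 → ∀ s, A1 p s = ρ p s + ∑ a, χ p a * θ a (X s) := by
    intro p hp s
    simp only [A1, b, if_neg hp, hA p hp, hθ, hA0]
    simp only [mul_add, Finset.sum_add_distrib, Finset.sum_mul]
    rw [add_assoc]
    congr 2
    exact Finset.sum_congr rfl fun a _ => by ring
  have hA1e : ∀ i s, A1 (e i) s = if blk s = i then X s else 0 := by
    intro i s
    simp only [A1, b, if_neg (hep i), heχ, heA]
    simp
  -- second transformation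
  let cc : σ → M := fun q => if q = p0 then u else ∑ i, if q = e i then -(θ0 (Λ i) / Λ i) else 0
  let A2 : Matrix σ σ M := A1.updateRow p0 (∑ q, cc q • A1 q)
  have hdet2 : A2.det = u * A.det := by
    have := Matrix.det_updateRow_sum A1 p0 cc
    rw [hdet1] at this
    rw [show u = cc p0 by simp [cc], ← smul_eq_mul, ← this]
  have hrow : ∀ s, (∑ q, cc q • A1 q) s = θ0 (X s) - θ0 (Λ (blk s)) / Λ (blk s) * X s := by
    intro s
    rw [Finset.sum_apply, ← Finset.add_sum_erase _ _ (Finset.mem_univ p0)]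
    have h1 : ∀ q ∈ Finset.univ.erase p0, (cc q • A1 q) s =
        ∑ i, if q = e i then -(θ0 (Λ i) / Λ i) * A1 (e i) s else 0 := by
      intro q hq
      simp only [cc, if_neg (Finset.ne_of_mem_erase hq), Pi.smul_apply, smul_eq_mul, Finset.sum_mul]
      refine Finset.sum_congr rfl fun i _ => ?_
      split_ifs with h
      · rw [h]
      · simp
    rw [Finset.sum_congr rfl h1, Finset.sum_comm]
    have h2 : ∀ i, (∑ q ∈ Finset.univ.erase p0, if q = e i then -(θ0 (Λ i) / Λ i) * A1 (e i) s else 0)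
        = -(θ0 (Λ i) / Λ i) * A1 (e i) s := by
      intro i
      rw [Finset.sum_ite_eq' ]
      rw [if_pos (Finset.mem_erase.2 ⟨hep i, Finset.mem_univ _⟩)]
    rw [Finset.sum_congr rfl (fun i _ => h2 i)]
    simp only [hA1e]
    simp only [mul_ite, mul_zero, Finset.sum_ite_eq, Finset.mem_univ, if_true]
    simp only [Pi.smul_apply, smul_eq_mul, hA1p0, hA0, cc, if_true, hθ0]
    ring
  rw [← hdet2]
  apply det_valuation_lt v A2 W (fun s => v (Λ (blk s))) hW (fun s => hvΛ _) p0
  · intro p s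
    by_cases hp : p = p0
    · subst hp
      rw [hW0, one_mul]
      simp only [A2, Matrix.updateRow_self, hrow]
      refine v.map_sub_le ((hθ0v _).trans (hX s)) ?_
      rw [map_mul]
      calc _ ≤ 1 * v (Λ (blk s)) := by
            gcongr
            · rw [map_div₀]; exact div_le_one_of_le₀ (hθ0v _) zero_le
            · exact hX s
        _ = _ := one_mul _
    · simp only [A2, Matrix.updateRow_ne hp, hA1 p hp]
      refine v.map_add_le (hρ p hp s) (v.map_sum_le fun a _ => ?_)
      rw [map_mul]
      gcongr
      · exact hχ p hp a
      · exact (hθv a _).trans (hX s)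
  · intro s
    rw [hW0, one_mul]
    simp only [A2, Matrix.updateRow_self, hrow]
    have h1 : θ0 (X s) - θ0 (Λ (blk s)) / Λ (blk s) * X s = Λ (blk s) * θ0 (X s / Λ (blk s)) := by
      have h2 : X s = (X s / Λ (blk s)) * Λ (blk s) := by
        rw [div_mul_cancel₀ _ (hΛ _)]
      have h3 := congrArg θ0 h2
      rw [Derivation.leibniz] at h3
      simp only [smul_eq_mul] at h3
      rw [h3]
      have := hΛ (blk s)
      field_simp
      ring
    rw [h1, map_mul]
    have h4 : v (θ0 (X s / Λ (blk s))) < 1 := by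
      apply hθ0lt
      rw [map_div₀]
      exact div_le_one_of_le₀ (hX s) zero_le
    calc _ < v (Λ (blk s)) * 1 := by
          apply mul_lt_mul_of_pos_left h4 (hvΛ _)
      _ = _ := mul_one _

/-! ### Part 6 -/

/-- Multihomogeneity with respect to a block decomposition. -/
def MH {σ κ R : Type} [Fintype σ] [DecidableEq κ] [CommSemiring R] (blk : σ → κ)
    (f : MvPolynomial σ R) (w : κ → ℕ) : Prop :=
  ∀ d ∈ f.support, ∀ i, ∑ s with blk s = i, d s = w i

section MH
variable {σ κ : Type} [Fintype σ] [DecidableEq σ] [DecidableEq κ] [Fintype κ] {blk : σ → κ}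

theorem MH.aeval_scale {R M : Type} [CommSemiring R] [CommSemiring M] [Algebra R M]
    {f : MvPolynomial σ R} {w : κ → ℕ} (hf : MH blk f w) (c : κ → M) (x : σ → M) :
    aeval (fun s => c (blk s) * x s) f = (∏ i, c i ^ w i) * aeval x f := by
  rw [aeval_def, aeval_def, eval₂_eq', eval₂_eq', Finset.mul_sum]
  refine Finset.sum_congr rfl fun d hd => ?_
  have : ∏ s, (c (blk s) * x s) ^ d s = (∏ i, c i ^ w i) * ∏ s, x s ^ d s := by
    simp only [mul_pow, Finset.prod_mul_distrib]
    congr 1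
    rw [← Finset.prod_fiberwise_of_maps_to (s := Finset.univ) (t := Finset.univ) (g := blk)
      (fun _ _ => Finset.mem_univ _)]
    refine Finset.prod_congr rfl fun i _ => ?_
    rw [← hf d hd i, ← Finset.prod_pow_eq_pow_sum]
    refine Finset.prod_congr rfl fun s hs => ?_
    rw [(Finset.mem_filter.1 hs).2]
  rw [this]; ring

theorem MH.pderiv {R : Type} [CommRing R] {f : MvPolynomial σ R} {w w' : κ → ℕ} (hf : MH blk f w)
    (ι : σ) (hw : w' + Pi.single (blk ι) 1 = w) : MH blk (pderiv ι f) w' := by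
  intro d hd i
  have h1 : d + Finsupp.single ι 1 ∈ f.support := by
    rw [mem_support_iff] at hd ⊢
    intro h
    apply hd
    rw [coeff_pderiv, h, zero_mul]
  have h2 := hf _ h1 i
  rw [← hw] at h2
  simp only [Finsupp.add_apply, Finset.sum_add_distrib, Pi.add_apply] at h2
  have h3 : ∑ s with blk s = i, (Finsupp.single ι 1 : σ →₀ ℕ) s = (Pi.single (blk ι) 1 : κ → ℕ) i := by
    simp only [Finsupp.single_apply, Finset.sum_ite_eq, Finset.mem_filter, Finset.mem_univ, true_and,
      Pi.single_apply, eq_comm]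
  rw [h3] at h2
  exact Nat.add_right_cancel h2

theorem MH.add {R : Type} [CommSemiring R] {f g : MvPolynomial σ R} {w : κ → ℕ} (hf : MH blk f w)
    (hg : MH blk g w) : MH blk (f + g) w := by
  intro d hd i
  rcases Finset.mem_union.1 (support_add hd) with h | h
  · exact hf d h i
  · exact hg d h i

theorem MH.zero {R : Type} [CommSemiring R] {w : κ → ℕ} : MH blk (0 : MvPolynomial σ R) w := by
  intro d hd; simp at hd

theorem MH.sum {R ι : Type} [CommSemiring R] {w : κ → ℕ} (s : Finset ι) (f : ι → MvPolynomial σ R)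
    (h : ∀ i ∈ s, MH blk (f i) w) : MH blk (∑ i ∈ s, f i) w := by
  classical
  induction s using Finset.induction_on with
  | empty => simpa using MH.zero
  | insert a s ha ih =>
    rw [Finset.sum_insert ha]
    exact (h a (Finset.mem_insert_self _ _)).add (ih fun i hi => h i (Finset.mem_insert_of_mem hi))

theorem MH.mul {R : Type} [CommSemiring R] {f g : MvPolynomial σ R} {w w' : κ → ℕ} (hf : MH blk f w)
    (hg : MH blk g w') : MH blk (f * g) (w + w') := by
  intro d hd i
  obtain ⟨a, ha, b, hb, rfl⟩ := Finset.mem_add.1 (support_mul _ _ hd)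
  simp only [Finsupp.add_apply, Finset.sum_add_distrib, Pi.add_apply, hf a ha i, hg b hb i]

theorem MH.C {R : Type} [CommSemiring R] (c : R) : MH blk (C c : MvPolynomial σ R) 0 := by
  intro d hd i
  have : d = 0 := by
    by_contra h
    rw [mem_support_iff, coeff_C, if_neg (Ne.symm h)] at hd
    exact hd rfl
  simp [this]

theorem MH.X {R : Type} [CommSemiring R] (s : σ) : MH blk (X s : MvPolynomial σ R) (Pi.single (blk s) 1) := by
  intro d hd i
  have : d = Finsupp.single s 1 := by
    by_contra h
    rw [mem_support_iff, coeff_X', if_neg (Ne.symm h)] at hd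
    exact hd rfl
  subst this
  simp only [Finsupp.single_apply, Finset.sum_ite_eq, Finset.mem_filter, Finset.mem_univ, true_and,
      Pi.single_apply, eq_comm]

theorem MH.neg {R : Type} [CommRing R] {f : MvPolynomial σ R} {w : κ → ℕ} (hf : MH blk f w) :
    MH blk (-f) w := by
  intro d hd
  rw [support_neg] at hd
  exact hf d hd

theorem MH.smul {R : Type} [CommRing R] {f : MvPolynomial σ R} {w : κ → ℕ} (hf : MH blk f w) (c : R) :
    MH blk (MvPolynomial.C c * f) w := by
  have := (MH.C (blk := blk) c).mul hf
  rwa [zero_add] at this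

theorem MH.one {R : Type} [CommSemiring R] : MH blk (1 : MvPolynomial σ R) 0 := MH.C 1

theorem MH.pow {R : Type} [CommSemiring R] {f : MvPolynomial σ R} {w : κ → ℕ} (hf : MH blk f w) (n : ℕ) :
    MH blk (f ^ n) (n • w) := by
  induction n with
  | zero => simpa using MH.one
  | succ n ih => rw [pow_succ, succ_nsmul]; exact ih.mul hf

theorem MH.prod {R ι : Type} [CommSemiring R] {w : ι → κ → ℕ} (s : Finset ι) (f : ι → MvPolynomial σ R)
    (h : ∀ i ∈ s, MH blk (f i) (w i)) : MH blk (∏ i ∈ s, f i) (∑ i ∈ s, w i) := by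
  classical
  induction s using Finset.induction_on with
  | empty => simpa using MH.one
  | insert a s ha ih =>
    rw [Finset.prod_insert ha, Finset.sum_insert ha]
    exact (h a (Finset.mem_insert_self _ _)).mul (ih fun i hi => h i (Finset.mem_insert_of_mem hi))

theorem MH.map {R R' : Type} [CommSemiring R] [CommSemiring R'] (φ : R →+* R') {f : MvPolynomial σ R} {w : κ → ℕ}
    (hf : MH blk f w) : MH blk (MvPolynomial.map φ f) w :=
  fun d hd => hf d (support_map_subset _ _ hd)
end MH

open scoped WithZero in
theorem aeval_valuation {σ k M : Type} [Field k] [Field M] [Algebra k M] (v : Valuation M ℤᵐ⁰)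
    (htriv : ∀ c : k, v (algebraMap k M c) ≤ 1) (x : σ → M) (y : σ → k) (hx : ∀ s, v (x s) ≤ 1)
    (hxy : ∀ s, v (x s - algebraMap k M (y s)) < 1) (f : MvPolynomial σ k) :
    v (aeval x f) ≤ 1 ∧ v (aeval x f - algebraMap k M (aeval y f)) < 1 := by
  induction f using MvPolynomial.induction_on with
  | C c => simpa using htriv c
  | add p q hp hq =>
    simp only [map_add]
    refine ⟨v.map_add_le hp.1 hq.1, ?_⟩
    rw [add_sub_add_comm]
    exact v.map_add_lt hp.2 hq.2
  | mul_X p s hp =>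
    simp only [map_mul, aeval_X]
    refine ⟨mul_le_one' hp.1 (hx s), ?_⟩
    rw [show aeval x p * x s - algebraMap k M (aeval y p) * algebraMap k M (y s) =
      (aeval x p - algebraMap k M (aeval y p)) * x s + algebraMap k M (aeval y p) *
        (x s - algebraMap k M (y s)) by ring]
    refine v.map_add_lt ?_ ?_ <;> rw [map_mul]
    · exact mul_lt_one_of_nonneg_of_lt_one_left zero_le hp.2 (hx s)
    · exact mul_lt_one_of_nonneg_of_lt_one_right (htriv _) zero_le (hxy s)

/-- The combinatorial data of a determinant: which rows it has. -/
structure KData (σ κ ν k : Type) [Fintype σ] [DecidableEq σ] [Fintype κ] [DecidableEq κ] [Fintype ν]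
    [Field k] (blk : σ → κ) (d : κ → ℕ) where
  p0 : σ
  pu : σ
  hp : p0 ≠ pu
  w : σ → κ → ℕ
  ρ : σ → σ → MvPolynomial σ k
  χ : σ → ν → MvPolynomial σ k
  e : κ → σ
  he : Function.Injective e
  he0 : ∀ i, e i ≠ p0
  heu : ∀ i, e i ≠ pu
  hw0 : w p0 = 0
  hwu : w pu = 0
  hρ : ∀ p, p ≠ p0 → p ≠ pu → ∀ s, MH blk (ρ p s) (w p + Pi.single (blk s) 1)
  hχ : ∀ p, p ≠ p0 → p ≠ pu → ∀ a, MH blk (χ p a) (w p)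
  heρ : ∀ i s, ρ (e i) s = if blk s = i then X s else 0
  heχ : ∀ i a, χ (e i) a = 0
  ex : σ →₀ ℕ
  hdeg : ∀ i, ∑ s with blk s = i, ex s + Fintype.card {s // blk s = i} + ∑ p, w p i = d i

/-- The matrix attached to the data at a point. -/
noncomputable def KData.mat {σ κ ν k : Type} [Fintype σ] [DecidableEq σ] [Fintype κ] [DecidableEq κ] [Fintype ν]
    [Field k] {blk : σ → κ} {d : κ → ℕ} (D : KData σ κ ν k blk d) {M : Type} [Field M] [Algebra k M]
    (Δ0 : Derivation ℤ M M) (Δ : ν → Derivation ℤ M M) (x : σ → M) (ι : σ) : Matrix σ σ M :=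
  fun p s => if p = D.p0 then Δ0 (x s) else if p = D.pu then (if s = ι then 1 else 0) else
    aeval x (D.ρ p s) + ∑ a, aeval x (D.χ p a) * Δ a (x s)

open scoped WithZero in
theorem local_final {σ κ ν k M : Type} [Fintype σ] [DecidableEq σ] [Fintype κ] [DecidableEq κ] [Fintype ν]
    [Field k] [Field M] [Algebra k M] {blk : σ → κ} {d : κ → ℕ} (D : KData σ κ ν k blk d)
    (v : Valuation M ℤᵐ⁰) (t : M) (α : k) (hv : IsPlace k M v (t - algebraMap k M α))
    (Δ0 : Derivation ℤ M M) (Δ : ν → Derivation ℤ M M)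
    (h0k : ∀ c : k, Δ0 (algebraMap k M c) = 0) (h0t : Δ0 t = 1)
    (hk : ∀ a, ∀ c : k, ∃ c' : k, Δ a (algebraMap k M c) = algebraMap k M c') (ht : ∀ a, Δ a t = 0)
    (x : σ → M) (hx : ∀ i, ∃ s, blk s = i ∧ x s ≠ 0)
    (g : MvPolynomial σ k) (hg : MH blk g d) (hgx : aeval x g = 0)
    (hsm : ∀ y : σ → k, (∀ i, ∃ s, blk s = i ∧ y s ≠ 0) → aeval y g = 0 → ∃ ι, aeval y (pderiv ι g) ≠ 0) :
    ∃ ι, aeval x (pderiv ι g) ≠ 0 ∧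
      v ((t - algebraMap k M α) * ((∏ s, x s ^ D.ex s) * ((D.mat Δ0 Δ x ι).det / aeval x (pderiv ι g)))) < 1 := by
  classical
  -- choose maximal coordinates
  have hmax : ∀ i, ∃ s, blk s = i ∧ ∀ s', blk s' = i → v (x s') ≤ v (x s) := by
    intro i
    obtain ⟨s, hs⟩ := hx i
    obtain ⟨s0, h1, h2⟩ := Finset.exists_max_image (Finset.univ.filter fun s => blk s = i)
      (fun s => v (x s)) ⟨s, by simpa using hs.1⟩
    exact ⟨s0, by simpa using h1, fun s' hs' => h2 s' (by simpa using hs')⟩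
  choose q hq1 hq2 using hmax
  let Λ : κ → M := fun i => x (q i)
  have hΛ : ∀ i, Λ i ≠ 0 := by
    intro i h
    obtain ⟨s, hs, hs0⟩ := hx i
    have := hq2 i s hs
    rw [show x (q i) = 0 from h, map_zero] at this
    exact hs0 (v.zero_iff.1 (le_antisymm this zero_le))
  have hX : ∀ s, v (x s) ≤ v (Λ (blk s)) := fun s => hq2 (blk s) s rfl
  let z : σ → M := fun s => x s / Λ (blk s)
  have hz : ∀ s, v (z s) ≤ 1 := fun s => by
    simp only [z, map_div₀]; exact div_le_one_of_le₀ (hX s) zero_le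
  have hxz : x = fun s => Λ (blk s) * z s := by
    funext s; simp only [z]; rw [mul_div_cancel₀ _ (hΛ _)]
  choose y hy using fun s => hv.res (z s) (hz s)
  have hyq : ∀ i, y (q i) ≠ 0 := by
    intro i h
    have := hy (q i)
    rw [h, map_zero, sub_zero] at this
    have h1 : z (q i) = 1 := by
      simp only [z, hq1]; exact div_self (hΛ i)
    rw [h1, map_one] at this
    exact lt_irrefl _ this
  have hae := aeval_valuation v hv.triv_le z y hz hy
  have hscale : ∀ {f : MvPolynomial σ k} {w : κ → ℕ}, MH blk f w →
      aeval x f = (∏ i, Λ i ^ w i) * aeval z f := by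
    intro f w hf
    conv_lhs => rw [hxz]
    exact hf.aeval_scale Λ z
  have hprod : ∀ w : κ → ℕ, (∏ i, Λ i ^ w i) ≠ 0 := fun w =>
    Finset.prod_ne_zero_iff.2 fun i _ => pow_ne_zero _ (hΛ i)
  have hgz : aeval z g = 0 := by
    have := hscale hg
    rw [hgx] at this
    exact (mul_eq_zero.1 this.symm).resolve_left (hprod _)
  have hgy : aeval y g = 0 := by
    have := (hae g).2
    rw [hgz, zero_sub, Valuation.map_neg] at this
    exact hv.eq_zero _ this
  obtain ⟨ι, hι⟩ := hsm y (fun i => ⟨q i, hq1 i, hyq i⟩) hgy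
  have hzι : v (aeval z (pderiv ι g)) = 1 := by
    have h1 := (hae (pderiv ι g)).2
    have h2 := hv.triv _ hι
    rw [← h2] at h1
    by_contra hne
    have hlt := lt_of_le_of_ne (hae (pderiv ι g)).1 hne
    rw [← h2] at hlt
    rw [Valuation.map_sub_eq_of_lt_right v hlt] at h1
    exact lt_irrefl _ h1
  have hdι : 1 ≤ d (blk ι) := by
    rw [← D.hdeg (blk ι)]
    have : 0 < Fintype.card {s // blk s = blk ι} := Fintype.card_pos_iff.2 ⟨⟨ι, rfl⟩⟩
    omega
  let d' : κ → ℕ := d - Pi.single (blk ι) 1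
  have hd' : d' + Pi.single (blk ι) 1 = d := by
    apply tsub_add_cancel_of_le
    intro i
    by_cases h : i = blk ι
    · subst h; simpa using hdι
    · simp [h]
  have hgι := hscale (hg.pderiv ι hd')
  have hgι0 : aeval x (pderiv ι g) ≠ 0 := by
    rw [hgι]
    refine mul_ne_zero (hprod _) ?_
    intro h; rw [h, map_zero] at hzι; exact zero_ne_one hzι
  refine ⟨ι, hgι0, ?_⟩
  let Wt : (κ → ℕ) → ℤᵐ⁰ := fun w => ∏ i, v (Λ i) ^ w i
  have hWtadd : ∀ w w', Wt (w + w') = Wt w * Wt w' := by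
    intro w w'
    simp only [Wt, Pi.add_apply, pow_add, Finset.prod_mul_distrib]
  have hWtsingle : ∀ i, Wt (Pi.single i 1) = v (Λ i) := by
    intro i
    simp only [Wt]
    rw [Finset.prod_eq_single i]
    · simp
    · intro j _ hj; simp [hj]
    · simp
  have hvΛ : ∀ i, 0 < v (Λ i) := fun i => zero_lt_iff.2 (v.ne_zero_iff.2 (hΛ i))
  have hWtpos : ∀ w, 0 < Wt w := fun w => Finset.prod_pos fun i _ => pow_pos (hvΛ i) _
  have hMHle : ∀ {f : MvPolynomial σ k} {w : κ → ℕ}, MH blk f w → v (aeval x f) ≤ Wt w := by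
    intro f w hf
    rw [hscale hf, map_mul, map_prod]
    simp only [map_pow]
    exact mul_le_of_le_one_right zero_le (hae f).1
  let W : σ → ℤᵐ⁰ := fun p => if p = D.pu then (v (Λ (blk ι)))⁻¹ else Wt (D.w p)
  have key := local_bound blk v t α hv Δ0 Δ h0k h0t hk ht x Λ hΛ hX D.p0
    (fun p s => if p = D.pu then (if s = ι then 1 else 0) else aeval x (D.ρ p s))
    (fun p a => if p = D.pu then 0 else aeval x (D.χ p a)) (D.mat Δ0 Δ x ι)
    (by intro s; simp [KData.mat])
    (by intro p hp s; simp only [KData.mat, if_neg hp]; split_ifs <;> simp)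
    D.e D.he D.he0
    (by intro i s; simp only [KData.mat, if_neg (D.he0 i), if_neg (D.heu i), D.heρ, D.heχ]
        split_ifs <;> simp)
    (by intro i a; simp [D.heu, D.heχ])
    W
    (by intro p; simp only [W]; split_ifs
        · exact inv_pos.2 (hvΛ _)
        · exact hWtpos _)
    (by simp only [W, if_neg D.hp, D.hw0]; simp [Wt])
    (by
      intro p hp s
      simp only [W]
      split_ifs with h1 h2
      · rw [h2, map_one, inv_mul_cancel₀ (hvΛ _).ne']
      · simp
      · refine (hMHle (D.hρ p hp h1 s)).trans_eq ?_
        rw [hWtadd, hWtsingle])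
    (by
      intro p hp a
      simp only [W]
      split_ifs with h1
      · simp
      · exact hMHle (D.hχ p hp h1 a))
  have hWprod : (∏ p, W p) * v (Λ (blk ι)) = Wt (fun i => ∑ p, D.w p i) := by
    rw [← Finset.mul_prod_erase _ _ (Finset.mem_univ D.pu)]
    have h1 : W D.pu = (v (Λ (blk ι)))⁻¹ := by simp [W]
    have h2 : ∏ p ∈ Finset.univ.erase D.pu, W p = ∏ p, Wt (D.w p) := by
      rw [← Finset.mul_prod_erase Finset.univ (fun p => Wt (D.w p)) (Finset.mem_univ D.pu), D.hwu]
      have : Wt 0 = 1 := by simp [Wt]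
      rw [this, one_mul]
      refine Finset.prod_congr rfl fun p hp => ?_
      simp [W, Finset.ne_of_mem_erase hp]
    rw [h1, h2]
    have h3 : ∏ p, Wt (D.w p) = Wt (fun i => ∑ p, D.w p i) := by
      simp only [Wt]
      rw [Finset.prod_comm]
      exact Finset.prod_congr rfl fun i _ => Finset.prod_pow_eq_pow_sum _ _ _
    rw [h3, mul_right_comm, inv_mul_cancel₀ (hvΛ _).ne', one_mul]
  have hΛprod : ∏ s, v (Λ (blk s)) = Wt (fun i => Fintype.card {s // blk s = i}) := by
    simp only [Wt]
    rw [← Finset.prod_fiberwise_of_maps_to (s := Finset.univ) (t := Finset.univ) (g := blk)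
      (fun _ _ => Finset.mem_univ _)]
    refine Finset.prod_congr rfl fun i _ => ?_
    rw [Fintype.card_subtype, ← Finset.prod_const]
    refine Finset.prod_congr rfl fun s hs => ?_
    rw [(Finset.mem_filter.1 hs).2]
  have hex : v (∏ s, x s ^ D.ex s) ≤ Wt (fun i => ∑ s with blk s = i, D.ex s) := by
    rw [map_prod]
    simp only [Wt, map_pow]
    rw [← Finset.prod_fiberwise_of_maps_to (s := Finset.univ) (t := Finset.univ) (g := blk)
      (fun _ _ => Finset.mem_univ _)]
    refine Finset.prod_le_prod' fun i _ => ?_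
    rw [← Finset.prod_pow_eq_pow_sum]
    refine Finset.prod_le_prod' fun s hs => ?_
    rw [← (Finset.mem_filter.1 hs).2]
    exact pow_le_pow_left₀ zero_le (hX s) _
  have hgv : v (aeval x (pderiv ι g)) * v (Λ (blk ι)) = Wt d := by
    rw [hgι, map_mul, hzι, mul_one, map_prod]
    simp only [map_pow]
    rw [← hd', hWtadd, hWtsingle]
  have hgpos : 0 < v (aeval x (pderiv ι g)) := zero_lt_iff.2 (v.ne_zero_iff.2 hgι0)
  rw [show (t - algebraMap k M α) * ((∏ s, x s ^ D.ex s) * ((D.mat Δ0 Δ x ι).det / aeval x (pderiv ι g)))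
    = ((t - algebraMap k M α) * (D.mat Δ0 Δ x ι).det) * (∏ s, x s ^ D.ex s) / aeval x (pderiv ι g) by ring]
  rw [map_div₀, div_lt_one₀ hgpos, map_mul]
  refine lt_of_mul_lt_mul_right ?_ (zero_le (a := v (Λ (blk ι))))
  rw [hgv]
  calc _ ≤ v ((t - algebraMap k M α) * (D.mat Δ0 Δ x ι).det) *
          Wt (fun i => ∑ s with blk s = i, D.ex s) * v (Λ (blk ι)) := by gcongr
    _ < ((∏ p, W p) * ∏ s, v (Λ (blk s))) * Wt (fun i => ∑ s with blk s = i, D.ex s) * v (Λ (blk ι)) := by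
        apply mul_lt_mul_of_pos_right _ (hvΛ _)
        exact mul_lt_mul_of_pos_right key (hWtpos _)
    _ = ((∏ p, W p) * v (Λ (blk ι))) * (∏ s, v (Λ (blk s))) * Wt (fun i => ∑ s with blk s = i, D.ex s) := by
        simp only [mul_assoc, mul_left_comm, mul_comm]
    _ = Wt d := by
        rw [hWprod, hΛprod, ← hWtadd, ← hWtadd]
        congr 1
        funext i
        simp only [Pi.add_apply]
        rw [← D.hdeg i]
        omega

/-! ### Part 7 -/

theorem derivation_ratFunc_mem {k L : Type} [Field k] [Field L] [Algebra k L] [Algebra (RatFunc k) L]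
    [IsScalarTower k (RatFunc k) L] (Δ : Derivation ℤ L L) (N : Subfield L)
    (hN : ∀ f : RatFunc k, algebraMap (RatFunc k) L f ∈ N)
    (hk : ∀ c : k, Δ (algebraMap k L c) ∈ N) (ht : Δ (algebraMap (RatFunc k) L RatFunc.X) ∈ N)
    (f : RatFunc k) : Δ (algebraMap (RatFunc k) L f) ∈ N := by
  have hp : ∀ p : Polynomial k, Δ (algebraMap (RatFunc k) L (algebraMap (Polynomial k) (RatFunc k) p)) ∈ N := by
    intro p
    induction p using Polynomial.induction_on with
    | C a =>
      rw [RatFunc.algebraMap_C, ← RatFunc.algebraMap_eq_C, ← IsScalarTower.algebraMap_apply]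
      exact hk a
    | add p q h1 h2 => rw [map_add, map_add, map_add]; exact N.add_mem h1 h2
    | monomial n a h =>
      rw [pow_succ, ← mul_assoc, map_mul, map_mul, Derivation.leibniz, RatFunc.algebraMap_X]
      exact N.add_mem (N.mul_mem (hN _) ht) (N.mul_mem (hN _) h)
  induction f using RatFunc.induction_on with
  | f p q hq =>
    rw [map_div₀, Derivation.leibniz_div]
    exact N.mul_mem (N.pow_mem (N.inv_mem (hN _)) _) (N.sub_mem (N.mul_mem (hN _) (hp _)) (N.mul_mem (hN _) (hp _)))

theorem derivation_commutes {F L : Type} [Field F] [Field L] [Algebra F L] [CharZero F]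
    (Δ : Derivation ℤ L L) (τ : L ≃ₐ[F] L) (h : ∀ a : F, τ (Δ (algebraMap F L a)) = Δ (algebraMap F L a))
    (x : L) (hx : IsAlgebraic F x) : τ (Δ x) = Δ (τ x) := by
  let Δ' : Derivation ℤ L L := Derivation.mk'
    { toFun := fun x => τ.symm (Δ (τ x))
      map_add' := by intro x y; simp
      map_smul' := by intro n x; simp } (by
        intro a b
        change τ.symm (Δ (τ (a * b))) = a • τ.symm (Δ (τ b)) + b • τ.symm (Δ (τ a))
        simp [Derivation.leibniz])
  have h1 : ∀ x, Δ' x = τ.symm (Δ (τ x)) := fun x => rfl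
  have := derivation_eq_zero_of_algebraic (F := F) (Δ' - Δ) (by
    intro a
    rw [Derivation.sub_apply, h1, τ.commutes, sub_eq_zero]
    rw [AlgEquiv.symm_apply_eq, h]) x hx
  rw [Derivation.sub_apply, h1, sub_eq_zero, AlgEquiv.symm_apply_eq] at this
  exact this.symm

/-- Restriction of a derivation to an intermediate field. -/
noncomputable def resDer {F L : Type} [Field F] [Field L] [Algebra F L] (M : IntermediateField F L)
    (Δ : Derivation ℤ L L) (h : ∀ x ∈ M, Δ x ∈ M) : Derivation ℤ M M :=
  Derivation.mk'
    { toFun := fun x => ⟨Δ x, h x x.2⟩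
      map_add' := by intro x y; apply Subtype.ext; simp
      map_smul' := by intro n x; apply Subtype.ext; simp } (by
        intro a b
        apply Subtype.ext
        change Δ (a * b : L) = (a : L) * Δ b + (b : L) * Δ a
        rw [Derivation.leibniz]; rfl)

theorem resDer_coe {F L : Type} [Field F] [Field L] [Algebra F L] (M : IntermediateField F L)
    (Δ : Derivation ℤ L L) (h : ∀ x ∈ M, Δ x ∈ M) (x : M) : ((resDer M Δ h x : M) : L) = Δ x := rfl

theorem KData.mat_map {σ κ ν k : Type} [Fintype σ] [DecidableEq σ] [Fintype κ] [DecidableEq κ] [Fintype ν]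
    [Field k] {blk : σ → κ} {d : κ → ℕ} (D : KData σ κ ν k blk d) {M L : Type} [Field M] [Algebra k M]
    [Field L] [Algebra k L] (φ : M →ₐ[k] L)
    (Δ0 : Derivation ℤ M M) (Δ : ν → Derivation ℤ M M)
    (Δ0' : Derivation ℤ L L) (Δ' : ν → Derivation ℤ L L) (h0 : ∀ x, φ (Δ0 x) = Δ0' (φ x))
    (h1 : ∀ a x, φ (Δ a x) = Δ' a (φ x))
    (x : σ → M) (ι : σ) : φ (D.mat Δ0 Δ x ι).det = (D.mat Δ0' Δ' (fun s => φ (x s)) ι).det := by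
  have h2 : ∀ f : MvPolynomial σ k, φ (aeval x f) = aeval (fun s => φ (x s)) f := by
    intro f
    have := MvPolynomial.comp_aeval_apply x φ f
    rw [this]
  rw [AlgHom.map_det]
  congr 1
  ext p s
  simp only [AlgHom.mapMatrix_apply, Matrix.map_apply, KData.mat]
  split_ifs <;> simp [h0, h1, h2]

open scoped WithZero in
theorem tv_poly {σ κ ν k L : Type} [Fintype σ] [DecidableEq σ] [Fintype κ] [DecidableEq κ] [Fintype ν]
    [Field k] [IsAlgClosed k] [CharZero k] [Field L] [IsAlgClosed L] [Algebra k L] [Algebra (RatFunc k) L]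
    [IsScalarTower k (RatFunc k) L] [Algebra.IsAlgebraic (RatFunc k) L]
    {blk : σ → κ} {d : κ → ℕ} (D : KData σ κ ν k blk d)
    (Δ0 : Derivation ℤ L L) (Δ : ν → Derivation ℤ L L)
    (h0k : ∀ c : k, Δ0 (algebraMap k L c) = 0) (h0t : Δ0 (algebraMap (RatFunc k) L RatFunc.X) = 1)
    (hk : ∀ a, ∀ c : k, ∃ c' : k, Δ a (algebraMap k L c) = algebraMap k L c')
    (ht : ∀ a, Δ a (algebraMap (RatFunc k) L RatFunc.X) = 0)
    (g : MvPolynomial σ k) (hg : MH blk g d)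
    (hsm : ∀ y : σ → L, (∀ i, ∃ s, blk s = i ∧ y s ≠ 0) → aeval y g = 0 → ∃ ι, aeval y (pderiv ι g) ≠ 0)
    (S : Finset (σ → L)) (hS : ∀ x ∈ S, (∀ i, ∃ s, blk s = i ∧ x s ≠ 0) ∧ aeval x g = 0)
    (hst : ∀ τ : L ≃ₐ[RatFunc k] L, ∀ x ∈ S, (fun s => τ (x s)) ∈ S)
    (Φ : (σ → L) → L) (hΦ : ∀ x ∈ S, ∀ ι, (D.mat Δ0 Δ x ι).det = Φ x * aeval x (pderiv ι g)) :
    ∃ p : Polynomial k, ∑ x ∈ S, (∏ s, x s ^ D.ex s) * Φ x =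
      Polynomial.aeval (algebraMap (RatFunc k) L RatFunc.X) p := by
  classical
  have hF0 : CharZero (RatFunc k) := charZero_of_injective_algebraMap (algebraMap k (RatFunc k)).injective
  have halg : ∀ x : L, IsAlgebraic (RatFunc k) x := Algebra.IsAlgebraic.isAlgebraic
  have hgal : IsGalois (RatFunc k) L := { to_isSeparable := inferInstance, to_normal := normal_iff.2 fun x => ⟨(halg x).isIntegral, IsAlgClosed.splits _⟩ }
  -- derivations commute
  have hcomm : ∀ Θ : Derivation ℤ L L, (∀ c : k, ∃ c' : k, Θ (algebraMap k L c) = algebraMap k L c') →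
      (∃ c' : k, Θ (algebraMap (RatFunc k) L RatFunc.X) = algebraMap k L c') →
      (∀ τ : L ≃ₐ[RatFunc k] L, ∀ x, τ (Θ x) = Θ (τ x)) ∧
      ∀ M : IntermediateField (RatFunc k) L, ∀ x ∈ M, Θ x ∈ M := by
    intro Θ h1 h2
    have hkN : ∀ N : Subfield L, (∀ f : RatFunc k, algebraMap (RatFunc k) L f ∈ N) →
        ∀ f : RatFunc k, Θ (algebraMap (RatFunc k) L f) ∈ N := by
      intro N hN
      apply derivation_ratFunc_mem Θ N hN
      · intro c
        obtain ⟨c', hc'⟩ := h1 c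
        rw [hc', IsScalarTower.algebraMap_apply k (RatFunc k) L]
        exact hN _
      · obtain ⟨c', hc'⟩ := h2
        rw [hc', IsScalarTower.algebraMap_apply k (RatFunc k) L]
        exact hN _
    constructor
    · intro τ x
      apply derivation_commutes Θ τ _ x (halg x)
      intro a
      obtain ⟨b, hb⟩ := hkN (algebraMap (RatFunc k) L).fieldRange (fun f => ⟨f, rfl⟩) a
      rw [← hb, τ.commutes]
    · intro M x hx
      exact derivation_mem_of_algebraic Θ M.toSubfield (hkN M.toSubfield fun f => M.algebraMap_mem f)
        (fun f => M.algebraMap_mem f) x hx (halg x)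
  have hc0 := hcomm Δ0 (fun c => ⟨0, by rw [h0k]; simp⟩) ⟨1, by rw [h0t]; simp⟩
  have hca := fun a => hcomm (Δ a) (hk a) ⟨0, by rw [ht]; simp⟩
  have hae : ∀ (τ : L ≃ₐ[RatFunc k] L) (x : σ → L) (f : MvPolynomial σ k),
      τ (aeval x f) = aeval (fun s => τ (x s)) f := by
    intro τ x f
    have := MvPolynomial.comp_aeval_apply x ((τ : L →ₐ[RatFunc k] L).restrictScalars k) f
    exact this
  -- equivariance
  have hΦτ : ∀ τ : L ≃ₐ[RatFunc k] L, ∀ x ∈ S, τ (Φ x) = Φ (fun s => τ (x s)) := by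
    intro τ x hx
    obtain ⟨ι, hι⟩ := hsm x (hS x hx).1 (hS x hx).2
    have h1 := congrArg τ (hΦ x hx ι)
    have h2 := D.mat_map ((τ : L →ₐ[RatFunc k] L).restrictScalars k) Δ0 Δ Δ0 Δ (hc0.1 τ) (fun a => (hca a).1 τ) x ι
    change τ _ = _ at h2
    rw [h2] at h1
    change (D.mat Δ0 Δ (fun s => τ (x s)) ι).det = _ at h1
    rw [hΦ _ (hst τ x hx) ι, map_mul, hae] at h1
    have h3 : aeval (fun s => τ (x s)) (pderiv ι g) ≠ 0 := by
      rw [← hae]; simpa using hι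
    exact (mul_right_cancel₀ h3 h1).symm
  set h := ∑ x ∈ S, (∏ s, x s ^ D.ex s) * Φ x with hh
  have hfix : ∀ τ : L ≃ₐ[RatFunc k] L, τ h = h := by
    intro τ
    rw [hh, map_sum]
    refine Finset.sum_bij (fun x _ => fun s => τ (x s)) (fun x hx => hst τ x hx) ?_ ?_ ?_
    · intro x _ y _ hxy
      funext s
      exact τ.injective (congrFun hxy s)
    · intro y hy
      refine ⟨fun s => τ.symm (y s), hst τ.symm y hy, ?_⟩
      simp
    · intro x hx
      rw [map_mul, hΦτ τ x hx, map_prod]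
      simp
  obtain ⟨h', hh'⟩ := (InfiniteGalois.mem_range_algebraMap_iff_fixed h).2 hfix
  have hden : ∀ α, h'.denom.eval α ≠ 0 := by
    intro α
    let M : IntermediateField (RatFunc k) L :=
      IntermediateField.adjoin (RatFunc k) (⋃ x ∈ S, Set.range x)
    have hfinset : (⋃ x ∈ S, Set.range x).Finite :=
      S.finite_toSet.biUnion fun x _ => Set.finite_range x
    have hMfin : FiniteDimensional (RatFunc k) M := by
      have : Finite (⋃ x ∈ S, Set.range x : Set L) := hfinset
      exact IntermediateField.finiteDimensional_adjoin fun x _ => (halg x).isIntegral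
    obtain ⟨v, hv⟩ := exists_place k M α
    have htM : ((algebraMap (RatFunc k) M RatFunc.X : M) : L) = algebraMap (RatFunc k) L RatFunc.X := rfl
    have hkM : ∀ c : k, ((algebraMap k M c : M) : L) = algebraMap k L c := fun c => rfl
    have hΦM : ∀ x ∈ S, ∃ y : M, (y : L) = (∏ s, x s ^ D.ex s) * Φ x ∧
        v ((algebraMap (RatFunc k) M RatFunc.X - algebraMap k M α) * y) < 1 := by
      intro x hx
      have hxM : ∀ s, x s ∈ M := fun s => IntermediateField.subset_adjoin _ _
        (Set.mem_biUnion hx ⟨s, rfl⟩)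
      let x' : σ → M := fun s => ⟨x s, hxM s⟩
      have hval : ∀ f : MvPolynomial σ k, ((aeval x' f : M) : L) = aeval x f := by
        intro f
        have := MvPolynomial.comp_aeval_apply x' (M.val.restrictScalars k) f
        exact this
      obtain ⟨ι, hι, hlt⟩ := local_final D v _ α hv (resDer M Δ0 (hc0.2 M)) (fun a => resDer M (Δ a) ((hca a).2 M))
        (fun c => Subtype.ext (by rw [resDer_coe]; exact h0k c))
        (Subtype.ext (by rw [resDer_coe]; exact h0t))
        (fun a c => by
          obtain ⟨c', hc'⟩ := hk a c
          exact ⟨c', Subtype.ext (by rw [resDer_coe]; exact hc')⟩)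
        (fun a => Subtype.ext (by rw [resDer_coe]; exact ht a))
        x' (fun i => by
          obtain ⟨s, h1, h2⟩ := (hS x hx).1 i
          exact ⟨s, h1, fun h3 => h2 (congrArg Subtype.val h3)⟩)
        g hg (Subtype.ext (by rw [hval]; exact (hS x hx).2))
        (fun y hy hy0 => by
          have hmap : ∀ f : MvPolynomial σ k, aeval (fun s => algebraMap k L (y s)) f =
              algebraMap k L (aeval y f) := by
            intro f
            have := MvPolynomial.comp_aeval_apply y (Algebra.ofId k L) f
            exact this.symm
          obtain ⟨ι, hι⟩ := hsm (fun s => algebraMap k L (y s)) (fun i => by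
            obtain ⟨s, h1, h2⟩ := hy i
            exact ⟨s, h1, by simpa using h2⟩) (by rw [hmap, hy0, map_zero])
          refine ⟨ι, fun h3 => hι ?_⟩
          rw [hmap, h3, map_zero])
      refine ⟨_, ?_, hlt⟩
      have h2 := D.mat_map (M.val.restrictScalars k) (resDer M Δ0 (hc0.2 M)) (fun a => resDer M (Δ a) ((hca a).2 M))
        Δ0 Δ (fun x => rfl) (fun a x => rfl) x' ι
      change _ = (D.mat Δ0 Δ x ι).det at h2
      rw [hΦ x hx ι] at h2
      have hι' : aeval x (pderiv ι g) ≠ 0 := by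
        rw [← hval]
        intro h3
        exact hι (Subtype.ext h3)
      have h4 : M.val ((∏ s, x' s ^ D.ex s) * ((D.mat (resDer M Δ0 (hc0.2 M)) (fun a => resDer M (Δ a) ((hca a).2 M)) x' ι).det
          / aeval x' (pderiv ι g))) = (∏ s, x s ^ D.ex s) * Φ x := by
        rw [map_mul, map_div₀, map_prod]
        change _ * (M.val.restrictScalars k _ / ((aeval x' (pderiv ι g) : M) : L)) = _
        rw [h2, hval, mul_div_cancel_right₀ _ hι']
        simp [x']
      exact h4
    choose! Y hY1 hY2 using hΦM
    apply denom_eval_ne_zero (M := M) α v hv h'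
    have h5 : algebraMap (RatFunc k) M h' = ∑ x ∈ S, Y x := by
      apply Subtype.ext
      change algebraMap (RatFunc k) L h' = M.val _
      rw [hh', map_sum, hh]
      exact Finset.sum_congr rfl fun x hx => (hY1 x hx).symm
    rw [h5, Finset.mul_sum]
    exact v.map_sum_lt one_ne_zero fun x hx => hY2 x hx
  obtain ⟨p, hp⟩ := ratFunc_eq_polynomial h' hden
  refine ⟨p, ?_⟩
  rw [← hh', hp]
  clear hden hh' hp
  induction p using Polynomial.induction_on' with
  | add p q hp hq => rw [map_add, map_add, map_add, hp, hq]
  | monomial n a =>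
    rw [Polynomial.aeval_monomial, ← Polynomial.C_mul_X_pow_eq_monomial, map_mul, map_mul, map_pow, map_pow,
      RatFunc.algebraMap_X, RatFunc.algebraMap_C, ← RatFunc.algebraMap_eq_C, ← IsScalarTower.algebraMap_apply]

/-! ### Part 8 -/

theorem tv_poly_t {σ κ ν k L : Type} [Fintype σ] [DecidableEq σ] [Fintype κ] [DecidableEq κ] [Fintype ν]
    [Field k] [IsAlgClosed k] [CharZero k] [Field L] [IsAlgClosed L] [Algebra k L]
    (t : L) (htr : Transcendental k t)
    (halg : ∀ N : Subfield L, (∀ c : k, algebraMap k L c ∈ N) → t ∈ N → ∀ x : L, IsAlgebraic N x)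
    {blk : σ → κ} {d : κ → ℕ} (D : KData σ κ ν k blk d)
    (Δ0 : Derivation ℤ L L) (Δ : ν → Derivation ℤ L L)
    (h0k : ∀ c : k, Δ0 (algebraMap k L c) = 0) (h0t : Δ0 t = 1)
    (hk : ∀ a, ∀ c : k, ∃ c' : k, Δ a (algebraMap k L c) = algebraMap k L c')
    (ht : ∀ a, Δ a t = 0)
    (g : MvPolynomial σ k) (hg : MH blk g d)
    (hsm : ∀ y : σ → L, (∀ i, ∃ s, blk s = i ∧ y s ≠ 0) → aeval y g = 0 → ∃ ι, aeval y (pderiv ι g) ≠ 0)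
    (S : Finset (σ → L)) (hS : ∀ x ∈ S, (∀ i, ∃ s, blk s = i ∧ x s ≠ 0) ∧ aeval x g = 0)
    (hst : ∀ τ : L ≃ₐ[k] L, τ t = t → ∀ x ∈ S, (fun s => τ (x s)) ∈ S)
    (Φ : (σ → L) → L) (hΦ : ∀ x ∈ S, ∀ ι, (D.mat Δ0 Δ x ι).det = Φ x * aeval x (pderiv ι g)) :
    ∃ p : Polynomial k, ∑ x ∈ S, (∏ s, x s ^ D.ex s) * Φ x = Polynomial.aeval t p := by
  let f : RatFunc k →ₐ[k] L :=
    IsFractionRing.liftAlgHom (g := Polynomial.aeval t) (transcendental_iff_injective.1 htr)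
  have hfX : f RatFunc.X = t := by
    rw [← RatFunc.algebraMap_X]
    refine (IsFractionRing.lift_algebraMap (transcendental_iff_injective.1 htr) _).trans ?_
    exact Polynomial.aeval_X t
  let : Algebra (RatFunc k) L := f.toRingHom.toAlgebra
  have hfa : ∀ y, algebraMap (RatFunc k) L y = f y := fun y => rfl
  have : IsScalarTower k (RatFunc k) L := IsScalarTower.of_algebraMap_eq fun c => by
    rw [hfa, f.commutes]
  have : Algebra.IsAlgebraic (RatFunc k) L := ⟨fun x => by
    have h1 := halg f.toRingHom.fieldRange (fun c => ⟨algebraMap k _ c, f.commutes c⟩) ⟨RatFunc.X, hfX⟩ x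
    exact (isAlgebraic_ringHom_iff_of_comp_eq (R := RatFunc k) (S := f.toRingHom.fieldRange) (A := L) (B := L)
      (RingHom.rangeRestrictFieldEquiv f.toRingHom) (RingHom.id L) (fun _ _ h => h) rfl).1 h1⟩
  have := tv_poly (k := k) (L := L) D Δ0 Δ h0k (by rw [hfa, hfX, h0t]) hk (by intro a; rw [hfa, hfX, ht])
    g hg hsm S hS (fun τ x hx => hst (τ.restrictScalars k) (by
      have := τ.commutes RatFunc.X
      rw [hfa, hfX] at this
      exact this) x hx) Φ hΦ
  rwa [hfa, hfX] at this

theorem tv_zero {σ κ ν k L : Type} [Fintype σ] [DecidableEq σ] [Fintype κ] [DecidableEq κ] [Fintype ν]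
    [Field k] [IsAlgClosed k] [CharZero k] [Field L] [IsAlgClosed L] [Algebra k L]
    (t : L) (htr : Transcendental k t)
    (halg : ∀ N : Subfield L, (∀ c : k, algebraMap k L c ∈ N) → t ∈ N → ∀ x : L, IsAlgebraic N x)
    {blk : σ → κ} {d : κ → ℕ} (D : KData σ κ ν k blk d)
    (Δ0 : Derivation ℤ L L) (Δ : ν → Derivation ℤ L L)
    (h0k : ∀ c : k, Δ0 (algebraMap k L c) = 0) (h0t : Δ0 t = 1)
    (hk : ∀ a, ∀ c : k, ∃ c' : k, Δ a (algebraMap k L c) = algebraMap k L c')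
    (ht : ∀ a, Δ a t = 0)
    (g : MvPolynomial σ k) (hg : MH blk g d)
    (hsm : ∀ y : σ → L, (∀ i, ∃ s, blk s = i ∧ y s ≠ 0) → aeval y g = 0 → ∃ ι, aeval y (pderiv ι g) ≠ 0)
    (S : Finset (σ → L)) (hS : ∀ x ∈ S, (∀ i, ∃ s, blk s = i ∧ x s ≠ 0) ∧ aeval x g = 0)
    (hst : ∀ τ : L ≃ₐ[k] L, τ t = t → ∀ x ∈ S, (fun s => τ (x s)) ∈ S)
    (Φ : (σ → L) → L) (hΦ : ∀ x ∈ S, ∀ ι, (D.mat Δ0 Δ x ι).det = Φ x * aeval x (pderiv ι g)) :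
    ∑ x ∈ S, (∏ s, x s ^ D.ex s) * Φ x = 0 := by
  have ht0 : t ≠ 0 := by rintro rfl; exact htr isAlgebraic_zero
  obtain ⟨p, hp⟩ := tv_poly_t t htr halg D Δ0 Δ h0k h0t hk ht g hg hsm S hS hst Φ hΦ
  have hdet : ∀ x ι, (D.mat ((-t ^ 2) • Δ0) Δ x ι).det = (-t ^ 2) * (D.mat Δ0 Δ x ι).det := by
    intro x ι
    have h1 : D.mat ((-t ^ 2) • Δ0) Δ x ι =
        (D.mat Δ0 Δ x ι).updateRow D.p0 ((-t ^ 2) • (D.mat Δ0 Δ x ι) D.p0) := by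
      ext p s
      by_cases hp : p = D.p0
      · subst hp
        simp [KData.mat]
      · rw [Matrix.updateRow_ne hp]
        simp [KData.mat, hp]
    rw [h1, Matrix.det_updateRow_smul, Matrix.updateRow_eq_self]
  obtain ⟨q, hq⟩ := tv_poly_t t⁻¹ (fun h => htr (IsAlgebraic.inv_iff.1 h))
    (fun N h1 h2 => halg N h1 (by simpa using N.inv_mem h2)) D ((-t ^ 2) • Δ0) Δ
    (by intro c; rw [Derivation.smul_apply, h0k, smul_zero])
    (by rw [Derivation.smul_apply, Derivation.leibniz_inv, h0t, smul_eq_mul, smul_eq_mul]; field_simp)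
    hk (by intro a; rw [Derivation.leibniz_inv, ht, smul_zero]) g hg hsm S hS
    (fun τ hτ => hst τ (by simpa using hτ)) (fun x => (-t ^ 2) * Φ x)
    (by intro x hx ι; rw [hdet, hΦ x hx ι]; ring)
  refine eq_zero_of_poly_inv t htr _ p (-q) hp ?_
  rw [map_neg, ← hq, Finset.mul_sum, ← Finset.sum_neg_distrib]
  exact Finset.sum_congr rfl fun x _ => by ring

/-! ### Part 9 -/

theorem isAlgClosed_algebraicClosure' (F E : Type) [Field F] [Field E] [Algebra F E] [IsAlgClosed E] :
    IsAlgClosed (algebraicClosure F E) := by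
  have h : IsAlgClosure F (algebraicClosure F E) := inferInstance
  exact h.isAlgClosed

/-- Relative algebraic closure of `ℚ(b i, i ∈ A)`. -/
noncomputable def kA {ιb L : Type} [Field L] [CharZero L] (b : ιb → L) (A : Set ιb) : IntermediateField ℚ L :=
  (algebraicClosure (IntermediateField.adjoin ℚ (b '' A)) L).restrictScalars ℚ

section kA
variable {ιb L : Type} [Field L] [CharZero L] (b : ιb → L) (A : Set ιb)

theorem mem_kA {x : L} : x ∈ kA b A ↔ IsAlgebraic (IntermediateField.adjoin ℚ (b '' A)) x :=
  mem_algebraicClosure_iff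

theorem isAlgClosed_kA [IsAlgClosed L] : IsAlgClosed (kA b A) := by
  exact isAlgClosed_algebraicClosure' (IntermediateField.adjoin ℚ (b '' A)) L

theorem adjoin_le_kA : IntermediateField.adjoin ℚ (b '' A) ≤ kA b A := by
  intro x hx
  rw [mem_kA]
  exact isAlgebraic_algebraMap (⟨x, hx⟩ : IntermediateField.adjoin ℚ (b '' A))

theorem b_mem_kA {i : ιb} (hi : i ∈ A) : b i ∈ kA b A :=
  adjoin_le_kA b A (IntermediateField.subset_adjoin _ _ ⟨i, hi, rfl⟩)

theorem isAlgebraic_of_subfield_le {N N' : Subfield L} (h : N ≤ N') {x : L} (hx : IsAlgebraic N x) :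
    IsAlgebraic N' x := by
  let : Algebra N N' := (Subfield.inclusion h).toAlgebra
  have : IsScalarTower N N' L := IsScalarTower.of_algebraMap_eq fun _ => rfl
  exact hx.extendScalars (algebraMap N N').injective

theorem kA_mono {A B : Set ιb} (h : A ⊆ B) : kA b A ≤ kA b B := by
  intro x hx
  rw [mem_kA] at hx ⊢
  have h1 : IntermediateField.adjoin ℚ (b '' A) ≤ IntermediateField.adjoin ℚ (b '' B) :=
    IntermediateField.adjoin.mono _ _ _ (Set.image_mono h)
  exact isAlgebraic_of_subfield_le (N := (IntermediateField.adjoin ℚ (b '' A)).toSubfield)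
    (N' := (IntermediateField.adjoin ℚ (b '' B)).toSubfield) h1 hx

theorem isAlgebraic_of_b_mem (hb : IsTranscendenceBasis ℚ b) (N : Subfield L) (hN : ∀ i, b i ∈ N) (x : L) :
    IsAlgebraic N x := by
  have h1 := hb.isAlgebraic_field.isAlgebraic x
  refine isAlgebraic_of_subfield_le (N := (IntermediateField.adjoin ℚ (Set.range b)).toSubfield) ?_ h1
  have h2 : IntermediateField.adjoin ℚ (Set.range b) ≤ (N.toIntermediateField (fun q => by
      simp) : IntermediateField ℚ L) := by
    rw [IntermediateField.adjoin_le_iff]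
    rintro _ ⟨i, rfl⟩
    exact hN i
  exact h2

theorem derivation_rat (Δ : Derivation ℤ L L) (q : ℚ) : Δ (algebraMap ℚ L q) = 0 :=
  derivation_eq_zero_of_algebraic (F := ℚ) Δ (fun a => by
    have h : (a.den : L) * algebraMap ℚ L a = (a.num : L) := by
      rw [eq_ratCast]
      have := Rat.den_mul_eq_num a
      exact_mod_cast congrArg (fun q : ℚ => (q : L)) this
    have h2 := congrArg Δ h
    rw [Derivation.leibniz] at h2
    simp only [smul_eq_mul] at h2
    have h3 : Δ (a.den : L) = 0 := by
      have := Derivation.map_natCast Δ a.den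
      exact this
    have h4 : Δ (a.num : L) = 0 := Derivation.map_intCast Δ a.num
    rw [h3, h4, mul_zero, add_zero] at h2
    exact (mul_eq_zero.1 h2).resolve_left (by exact_mod_cast a.den_nz)) _ (isAlgebraic_algebraMap q)

theorem derivation_adjoin_mem (Δ : Derivation ℤ L L) (s : Set L) (N : Subfield L) (hs : s ⊆ N)
    (hN : ∀ x ∈ s, Δ x ∈ N) {x : L} (hx : x ∈ IntermediateField.adjoin ℚ s) : x ∈ N ∧ Δ x ∈ N := by
  induction hx using IntermediateField.adjoin_induction with
  | mem x hx => exact ⟨hs hx, hN x hx⟩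
  | algebraMap q => rw [derivation_rat]; exact ⟨by simp, N.zero_mem⟩
  | add x y _ _ h1 h2 => rw [map_add]; exact ⟨N.add_mem h1.1 h2.1, N.add_mem h1.2 h2.2⟩
  | inv x _ h1 =>
    rw [Derivation.leibniz_inv]
    refine ⟨N.inv_mem h1.1, N.mul_mem (N.neg_mem (N.pow_mem (N.inv_mem h1.1) _)) h1.2⟩
  | mul x y _ _ h1 h2 =>
    rw [Derivation.leibniz]
    exact ⟨N.mul_mem h1.1 h2.1, N.add_mem (N.mul_mem h1.1 h2.2) (N.mul_mem h2.1 h1.2)⟩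

theorem derivation_kA_mem (Δ : Derivation ℤ L L) (hΔ : ∀ j ∈ A, Δ (b j) ∈ kA b A) {x : L} (hx : x ∈ kA b A) :
    Δ x ∈ kA b A := by
  refine derivation_mem_of_algebraic (F := IntermediateField.adjoin ℚ (b '' A)) Δ (kA b A).toSubfield ?_
    (fun a => adjoin_le_kA b A a.2) x hx ((mem_kA b A).1 hx)
  intro a
  refine (derivation_adjoin_mem Δ (b '' A) (kA b A).toSubfield ?_ ?_ a.2).2
  · rintro _ ⟨i, hi, rfl⟩; exact b_mem_kA b A hi
  · rintro _ ⟨i, hi, rfl⟩; exact hΔ i hi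

theorem derivation_kA_zero (Δ : Derivation ℤ L L) (hΔ : ∀ j ∈ A, Δ (b j) = 0) {x : L} (hx : x ∈ kA b A) :
    Δ x = 0 := by
  refine derivation_eq_zero_of_algebraic (F := IntermediateField.adjoin ℚ (b '' A)) Δ ?_ x ((mem_kA b A).1 hx)
  rintro ⟨a, ha⟩
  change Δ a = 0
  induction ha using IntermediateField.adjoin_induction with
  | mem x hx => obtain ⟨i, hi, rfl⟩ := hx; exact hΔ i hi
  | algebraMap q => exact derivation_rat Δ q
  | add x y _ _ h1 h2 => rw [map_add, h1, h2, add_zero]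
  | inv x _ h1 => rw [Derivation.leibniz_inv, h1, smul_zero]
  | mul x y _ _ h1 h2 => rw [Derivation.leibniz, h1, h2, smul_zero, smul_zero, add_zero]

theorem transcendental_kA [IsAlgClosed L] (Δ : Derivation ℤ L L) (hΔ : ∀ j ∈ A, Δ (b j) = 0) (t : L)
    (ht : Δ t ≠ 0) : Transcendental (kA b A) t := by
  intro h
  exact ht (derivation_eq_zero_of_algebraic (F := kA b A) Δ (fun a => derivation_kA_zero b A Δ hΔ a.2) t h)

/-- The field `C0(y)`. -/
noncomputable def KK {J : Type} (b : ιb → L) (yi : J → ιb) : IntermediateField ℚ L :=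
  IntermediateField.adjoin ℚ ((kA b (Set.range yi)ᶜ : Set L) ∪ Set.range (fun j => b (yi j)))

variable {J : Type} (yi : J → ιb)

theorem kA_le_KK : kA b (Set.range yi)ᶜ ≤ KK b yi := fun _ hx =>
  IntermediateField.subset_adjoin _ _ (Or.inl hx)

theorem y_mem_KK (j : J) : b (yi j) ∈ KK b yi := IntermediateField.subset_adjoin _ _ (Or.inr ⟨j, rfl⟩)

theorem b_mem_KK (i : ιb) : b i ∈ KK b yi := by
  by_cases h : i ∈ Set.range yi
  · obtain ⟨j, rfl⟩ := h; exact y_mem_KK b yi j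
  · exact kA_le_KK b yi (b_mem_kA b _ h)

theorem isAlgebraic_KK (hb : IsTranscendenceBasis ℚ b) (x : L) : IsAlgebraic (KK b yi) x :=
  isAlgebraic_of_b_mem b hb (KK b yi).toSubfield (b_mem_KK b yi) x

theorem isGalois_KK [IsAlgClosed L] (hb : IsTranscendenceBasis ℚ b) : IsGalois (KK b yi) L :=
  have : Algebra.IsAlgebraic (KK b yi) L := ⟨isAlgebraic_KK b yi hb⟩
  { to_isSeparable := inferInstance
    to_normal := normal_iff.2 fun x => ⟨(isAlgebraic_KK b yi hb x).isIntegral, IsAlgClosed.splits _⟩ }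

theorem KK_le (hyi : Function.Injective yi) (j : J) (N : Subfield L) (h : ∀ x ∈ kA b {yi j}ᶜ, x ∈ N) (hj : b (yi j) ∈ N) :
    ∀ x ∈ KK b yi, x ∈ N := by
  intro x hx
  refine (derivation_adjoin_mem 0 _ N ?_ (fun _ _ => N.zero_mem) hx).1
  rintro y (hy | ⟨l, rfl⟩)
  · refine h _ (kA_mono b ?_ hy)
    intro i hi h2
    exact hi ⟨j, h2.symm⟩
  · by_cases hl : l = j
    · subst hl; exact hj
    · exact h _ (b_mem_kA b _ (fun h2 => hl (hyi h2)))

theorem derivation_KK_mem (Δ : Derivation ℤ L L) (hΔ : ∀ i, i ∉ Set.range yi → Δ (b i) = 0)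
    (hΔ2 : ∀ j, Δ (b (yi j)) ∈ KK b yi) {x : L} (hx : x ∈ KK b yi) : Δ x ∈ KK b yi := by
  refine (derivation_adjoin_mem Δ _ (KK b yi).toSubfield (IntermediateField.subset_adjoin _ _) ?_ hx).2
  rintro y (hy | ⟨l, rfl⟩)
  · rw [derivation_kA_zero b _ Δ hΔ hy]; exact (KK b yi).zero_mem
  · exact hΔ2 l
end kA

/-! ### Part 10 -/

theorem det_ratio {σ L : Type} [Fintype σ] [DecidableEq σ] [Field L] (M : Matrix σ σ L) (pu : σ) (n : σ → L)
    (hn : n ≠ 0) (hM : ∀ p, p ≠ pu → ∑ s, M p s * n s = 0) :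
    ∃ Φ : L, (∀ ι, (M.updateRow pu (Pi.single ι 1)).det = Φ * n ι) ∧
      (LinearIndepOn L (fun p => M p) {p | p ≠ pu} → Φ ≠ 0) := by
  obtain ⟨ι0, h0⟩ := Function.ne_iff.1 hn
  rw [Pi.zero_apply] at h0
  have key : ∀ ι, (M.updateRow pu (Pi.single ι 1)).det * n ι0 = (M.updateRow pu (Pi.single ι0 1)).det * n ι := by
    intro ι
    have h1 : (M.updateRow pu (n ι0 • Pi.single ι 1 + (- n ι) • Pi.single ι0 1)).det = 0 := by
      rw [← Matrix.exists_mulVec_eq_zero_iff]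
      refine ⟨n, hn, ?_⟩
      ext p
      rw [Pi.zero_apply, Matrix.mulVec, dotProduct]
      by_cases hp : p = pu
      · subst hp
        simp only [Matrix.updateRow_self, Pi.add_apply, Pi.smul_apply, smul_eq_mul, add_mul, Finset.sum_add_distrib,
          Pi.single_apply]
        simp
        ring
      · simp only [Matrix.updateRow_ne hp]
        exact hM p hp
    rw [Matrix.det_updateRow_add, Matrix.det_updateRow_smul, Matrix.det_updateRow_smul] at h1
    linear_combination h1
  refine ⟨(M.updateRow pu (Pi.single ι0 1)).det / n ι0, fun ι => ?_, ?_⟩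
  · field_simp; rw [key]
  · intro hli
    refine div_ne_zero ?_ h0
    intro hdet
    rw [← Matrix.exists_vecMul_eq_zero_iff] at hdet
    obtain ⟨v, hv, hv2⟩ := hdet
    have h2 : ∀ s, ∑ p, v p * (M.updateRow pu (Pi.single ι0 1)) p s = 0 := fun s => by
      have := congrFun hv2 s
      simpa [Matrix.vecMul, dotProduct] using this
    have h3 : v pu = 0 := by
      have : ∑ s, (∑ p, v p * (M.updateRow pu (Pi.single ι0 1)) p s) * n s = 0 := by simp [h2]
      simp only [Finset.sum_mul] at this
      rw [Finset.sum_comm, Finset.sum_eq_single pu] at this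
      · simp [Pi.single_apply] at this
        tauto
      · intro p _ hp
        simp only [Matrix.updateRow_ne hp, mul_assoc, ← Finset.mul_sum, hM p hp, mul_zero]
      · simp
    apply hv
    have h4 := linearIndepOn_iff'.1 hli (Finset.univ.filter fun p => p ≠ pu) v (by intro p; simp) (by
      ext s
      have h5 := h2 s
      rw [← Finset.sum_filter_add_sum_filter_not _ (fun p => p ≠ pu)] at h5
      have h6 : ∑ p with ¬ p ≠ pu, v p * (M.updateRow pu (Pi.single ι0 1)) p s = 0 := by
        refine Finset.sum_eq_zero fun p hp => ?_
        simp at hp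
        rw [hp, h3, zero_mul]
      rw [h6, add_zero] at h5
      rw [Finset.sum_apply, Pi.zero_apply, ← h5]
      refine Finset.sum_congr rfl fun p hp => ?_
      simp at hp
      rw [Matrix.updateRow_ne hp]; rfl)
    ext p
    by_cases hp : p = pu
    · rw [hp, h3]; rfl
    · exact h4 p (by simpa using hp)

theorem cb_abstract {σ κ ν k L : Type} [Fintype σ] [DecidableEq σ] [Fintype κ] [DecidableEq κ] [Fintype ν]
    [Field k] [IsAlgClosed k] [CharZero k] [Field L] [IsAlgClosed L] [Algebra k L]
    (t : L) (htr : Transcendental k t)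
    (halg : ∀ N : Subfield L, (∀ c : k, algebraMap k L c ∈ N) → t ∈ N → ∀ x : L, IsAlgebraic N x)
    {blk : σ → κ} {d : κ → ℕ} (D : KData σ κ ν k blk d)
    (Δ0 : Derivation ℤ L L) (Δ : ν → Derivation ℤ L L)
    (h0k : ∀ c : k, Δ0 (algebraMap k L c) = 0) (h0t : Δ0 t = 1)
    (hk : ∀ a, ∀ c : k, ∃ c' : k, Δ a (algebraMap k L c) = algebraMap k L c')
    (ht : ∀ a, Δ a t = 0)
    (g : MvPolynomial σ k) (hg : MH blk g d)
    (hsm : ∀ y : σ → L, (∀ i, ∃ s, blk s = i ∧ y s ≠ 0) → aeval y g = 0 → ∃ ι, aeval y (pderiv ι g) ≠ 0)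
    (S : Finset (σ → L)) (hS : ∀ x ∈ S, (∀ i, ∃ s, blk s = i ∧ x s ≠ 0) ∧ aeval x g = 0)
    (hst : ∀ τ : L ≃ₐ[k] L, τ t = t → ∀ x ∈ S, (fun s => τ (x s)) ∈ S)
    (htan : ∀ x ∈ S, ∀ ι p, p ≠ D.pu → ∑ s, D.mat Δ0 Δ x ι p s * aeval x (pderiv s g) = 0)
    (X : σ → L) (hX : X ∈ S)
    (hli : ∀ ι, LinearIndepOn L (fun p => D.mat Δ0 Δ X ι p) {p | p ≠ D.pu})
    (P : MvPolynomial σ L) (hP : MH blk P (fun i => ∑ s with blk s = i, D.ex s))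
    (hPS : ∀ x ∈ S, x ≠ X → eval x P = 0) : eval X P = 0 := by
  have hx : ∀ x : σ → L, ∃ Φ : L, x ∈ S → (∀ ι, (D.mat Δ0 Δ x ι).det = Φ * aeval x (pderiv ι g)) ∧
      (x = X → Φ ≠ 0) := by
    intro x
    by_cases hxS : x ∈ S
    · obtain ⟨ι0, hι0⟩ := hsm x (hS x hxS).1 (hS x hxS).2
      have hup : ∀ ι, (D.mat Δ0 Δ x ι0).updateRow D.pu (Pi.single ι 1) = D.mat Δ0 Δ x ι := by
        intro ι
        ext p s
        by_cases hp : p = D.pu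
        · subst hp
          simp [KData.mat, D.hp.symm, Pi.single_apply]
        · rw [Matrix.updateRow_ne hp]
          simp [KData.mat, hp]
      obtain ⟨Φ, h1, h2⟩ := det_ratio (D.mat Δ0 Δ x ι0) D.pu (fun s => aeval x (pderiv s g))
        (fun h => hι0 (congrFun h ι0)) (fun p hp => htan x hxS ι0 p hp)
      refine ⟨Φ, fun _ => ⟨fun ι => ?_, ?_⟩⟩
      · rw [← hup, h1]
      · rintro rfl
        exact h2 (hli ι0)
    · exact ⟨0, fun h => absurd h hxS⟩
  choose Φ hΦ using hx
  have hsum : ∑ x ∈ S, eval x P * Φ x = 0 := by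
    have : ∀ x ∈ S, eval x P * Φ x = ∑ m ∈ P.support, coeff m P * ((∏ s, x s ^ m s) * Φ x) := by
      intro x _
      rw [eval_eq', Finset.sum_mul]
      exact Finset.sum_congr rfl fun _ _ => by ring
    rw [Finset.sum_congr rfl this, Finset.sum_comm]
    refine Finset.sum_eq_zero fun m hm => ?_
    rw [← Finset.mul_sum]
    have hdeg' : ∀ i, ∑ s with blk s = i, m s + Fintype.card {s // blk s = i} + ∑ p, D.w p i = d i := fun i => by
      have := hP m hm i
      rw [this]; exact D.hdeg i
    have h := tv_zero t htr halg { D with ex := m, hdeg := hdeg' } Δ0 Δ h0k h0t hk ht g hg hsm S hS hst Φ (fun x hx ι => (hΦ x hx).1 ι)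
    rw [h, mul_zero]
  rw [Finset.sum_eq_single_of_mem X hX (fun x hx hne => by rw [hPS x hx hne, zero_mul])] at hsum
  exact (mul_eq_zero.1 hsum).resolve_right ((hΦ X hX).2 rfl)

/-! ### Part 11 -/

/-- General setting: a transcendence basis `b` with dual derivations, and a form with independent coefficients. -/
structure GS (L : Type) [Field L] [CharZero L] {σ κ : Type} [Fintype σ] [DecidableEq σ] [Fintype κ] [DecidableEq κ]
    (blk : σ → κ) (d : κ → ℕ) where
  ιb : Type
  A : Type
  fA : Fintype A
  b : ιb → L
  hb : IsTranscendenceBasis ℚ b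
  Δ : ιb → Derivation ℤ L L
  hΔ1 : ∀ i, Δ i (b i) = 1
  hΔ0 : ∀ i j, i ≠ j → Δ i (b j) = 0
  α : A → (σ →₀ ℕ)
  hα : Function.Injective α
  hαd : ∀ a i, ∑ s with blk s = i, α a s = d i
  hαs : ∀ m : σ →₀ ℕ, (∀ i, ∑ s with blk s = i, m s = d i) → ∃ a, α a = m
  ca : A → ιb
  hca : Function.Injective ca

attribute [instance] GS.fA

theorem derivation_aeval_int {L σ : Type} [Field L] [Fintype σ] [DecidableEq σ] (Δ : Derivation ℤ L L) (x : σ → L)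
    (f : MvPolynomial σ ℤ) : Δ (aeval x f) = ∑ s, aeval x (pderiv s f) * Δ (x s) := by
  induction f using MvPolynomial.induction_on with
  | C a =>
    have h1 : aeval x (C a : MvPolynomial σ ℤ) = (a : L) := by rw [algHom_C]; simp
    rw [h1]
    have h2 : Δ (a : L) = 0 := Derivation.map_intCast Δ a
    rw [h2, Finset.sum_eq_zero]
    intro s _
    rw [pderiv_C, map_zero, zero_mul]
  | add p q hp hq => simp only [map_add, hp, hq, add_mul, Finset.sum_add_distrib]
  | mul_X p i hp =>
    simp only [map_mul, aeval_X, Derivation.leibniz, hp, smul_eq_mul, pderiv_X, map_add, add_mul,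
      Finset.sum_add_distrib, Finset.mul_sum]
    rw [add_comm, Finset.sum_eq_single i (f := fun x_1 => _ * _ * Δ (x x_1))]
    · simp [mul_comm, mul_left_comm, mul_assoc]
      ring
    · intro j _ hj
      simp [Pi.single_apply, hj.symm]
    · simp

theorem derivation_monomial {L σ : Type} [Field L] [Fintype σ] [DecidableEq σ] (Δ : Derivation ℤ L L) (x : σ → L)
    (m : σ →₀ ℕ) (c : L) : Δ (eval x (monomial m c)) =
      ∑ s, eval x (pderiv s (monomial m c)) * Δ (x s) + Δ c * ∏ s, x s ^ m s := by
  have h1 : ∀ (m : σ →₀ ℕ) (c : L), eval x (monomial m c) = c * ∏ s, x s ^ m s := by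
    intro m c
    rw [eval_monomial, Finsupp.prod_fintype _ _ (by simp)]
  have h2 : ∏ s, x s ^ m s = aeval x (monomial m (1 : ℤ)) := by
    rw [aeval_monomial, Finsupp.prod_fintype _ _ (by simp)]; simp
  have h3 := derivation_aeval_int Δ x (monomial m 1)
  rw [← h2] at h3
  rw [h1, Derivation.leibniz, h3]
  simp only [smul_eq_mul, Finset.mul_sum]
  rw [mul_comm (Δ c)]
  congr 1
  refine Finset.sum_congr rfl fun s _ => ?_
  rw [pderiv_monomial, pderiv_monomial, h1, aeval_monomial, Finsupp.prod_fintype _ _ (by simp)]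
  simp
  ring

namespace GS
variable {L : Type} [Field L] [CharZero L] {σ κ : Type} [Fintype σ] [DecidableEq σ] [Fintype κ] [DecidableEq κ]
    {blk : σ → κ} {d : κ → ℕ} (G : GS L blk d)

/-- The form. -/
noncomputable def g : MvPolynomial σ L := ∑ a, monomial (G.α a) (G.b (G.ca a))

/-- The gradient. -/
noncomputable def gr (x : σ → L) (s : σ) : L := eval x (pderiv s G.g)

theorem derivation_g (Δ : Derivation ℤ L L) (x : σ → L) : Δ (eval x G.g) =
    ∑ s, G.gr x s * Δ (x s) + ∑ a, Δ (G.b (G.ca a)) * ∏ s, x s ^ G.α a s := by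
  simp only [g, gr, map_sum, derivation_monomial, Finset.sum_add_distrib, Finset.sum_mul]
  rw [Finset.sum_comm]

theorem hg : MH blk G.g d := by
  refine MH.sum _ _ fun a _ => ?_
  intro m hm i
  have := support_monomial_subset hm
  rw [Finset.mem_singleton] at this
  rw [this]; exact G.hαd a i

theorem gr_der (x : σ → L) (hx : eval x G.g = 0) (Δ : Derivation ℤ L L) (hΔ : ∀ a, Δ (G.b (G.ca a)) = 0) :
    ∑ s, G.gr x s * Δ (x s) = 0 := by
  have h := G.derivation_g Δ x
  rw [hx, map_zero] at h
  simpa [hΔ] using h.symm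

theorem gr_ca (x : σ → L) (hx : eval x G.g = 0) (a : G.A) :
    ∑ s, G.gr x s * G.Δ (G.ca a) (x s) = - ∏ s, x s ^ G.α a s := by
  have h := G.derivation_g (G.Δ (G.ca a)) x
  rw [hx, map_zero, Finset.sum_eq_single a (f := fun a' => G.Δ (G.ca a) _ * _)] at h
  · rw [G.hΔ1, one_mul] at h
    linear_combination -h
  · intro a' _ ha'
    rw [G.hΔ0 _ _ (fun h => ha' (G.hca h).symm), zero_mul]
  · simp

theorem euler_mono (x : σ → L) (i : κ) (m : σ →₀ ℕ) (c : L) :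
    ∑ s, eval x (pderiv s (monomial m c)) * (if blk s = i then x s else 0) =
      ((∑ s with blk s = i, m s : ℕ) : L) * eval x (monomial m c) := by
  rw [Finset.sum_filter, Nat.cast_sum, Finset.sum_mul]
  refine Finset.sum_congr rfl fun s _ => ?_
  split_ifs with h
  · rw [pderiv_monomial]
    have h1 : eval x (X s * monomial (m - Finsupp.single s 1) (c * (m s : L))) =
      (m s : L) * eval x (monomial m c) := by
      have h2 : (m s : L) * eval x (monomial m c) = eval x (C (m s : L) * monomial m c) := by simp
      rw [h2]
      congr 1
      by_cases hs : m s = 0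
      · simp [hs]
      · rw [show (X s : MvPolynomial σ L) = monomial (Finsupp.single s 1) 1 from rfl, monomial_mul, C_mul_monomial,
          one_mul, mul_comm c]
        congr 2
        ext s'
        by_cases h : s' = s
        · subst h; simp; omega
        · simp [Finsupp.single_apply, Ne.symm h]
    rw [← h1]; simp; ring
  · simp

theorem gr_euler (x : σ → L) (hx : eval x G.g = 0) (i : κ) :
    ∑ s, G.gr x s * (if blk s = i then x s else 0) = 0 := by
  simp only [gr, g, map_sum, Finset.sum_mul]
  rw [Finset.sum_comm]
  simp only [euler_mono, G.hαd]
  rw [← Finset.mul_sum, ← map_sum]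
  change _ * eval x G.g = 0
  rw [hx, mul_zero]

theorem exists_m0 (y : σ → L) (hy : ∀ i, ∃ s, blk s = i ∧ y s ≠ 0) : ∃ a, ∏ s, y s ^ G.α a s ≠ 0 := by
  choose q hq hq2 using hy
  obtain ⟨a, ha⟩ := G.hαs (∑ i, Finsupp.single (q i) (d i)) (fun i => by
    simp only [Finsupp.finsetSum_apply]
    rw [Finset.sum_comm, Finset.sum_eq_single i]
    · rw [Finset.sum_eq_single (q i)]
      · simp
      · intro s _ hs; simp [Ne.symm hs]
      · simp [hq]
    · intro j _ hj
      refine Finset.sum_eq_zero fun s hs => ?_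
      rw [Finsupp.single_eq_of_ne]
      rintro rfl
      simp [hq] at hs
      exact hj hs
    · simp)
  refine ⟨a, Finset.prod_ne_zero_iff.2 fun s _ => ?_⟩
  by_cases hs : ∃ i, q i = s
  · obtain ⟨i, rfl⟩ := hs
    exact pow_ne_zero _ (hq2 i)
  · rw [ha]
    have : (∑ i, Finsupp.single (q i) (d i)) s = 0 := by
      simp only [Finsupp.finsetSum_apply]
      refine Finset.sum_eq_zero fun i _ => ?_
      rw [Finsupp.single_eq_of_ne]
      exact fun h => hs ⟨i, h.symm⟩
    rw [this, pow_zero]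
    exact one_ne_zero

theorem smooth (y : σ → L) (hy : ∀ i, ∃ s, blk s = i ∧ y s ≠ 0) (hgy : eval y G.g = 0) : G.gr y ≠ 0 := by
  intro h
  obtain ⟨a, ha⟩ := G.exists_m0 y hy
  have := G.gr_ca y hgy a
  simp [h] at this
  exact ha this

/-- The operator `T`. -/
noncomputable def T (q : MvPolynomial σ L) (x : σ → L) (s : σ) : L := ∑ a, coeff (G.α a) q * G.Δ (G.ca a) (x s)

theorem eval_eq_sum_A (q : MvPolynomial σ L) (hq : MH blk q d) (x : σ → L) :
    eval x q = ∑ a, coeff (G.α a) q * ∏ s, x s ^ G.α a s := by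
  rw [eval_eq']
  have h1 : q.support ⊆ Finset.univ.map ⟨G.α, G.hα⟩ := by
    intro m hm
    obtain ⟨a, rfl⟩ := G.hαs m (hq m hm)
    simp
  rw [Finset.sum_subset h1 (fun m _ hm => by rw [notMem_support_iff.1 hm, zero_mul]), Finset.sum_map]
  rfl

theorem gr_T (q : MvPolynomial σ L) (hq : MH blk q d) (x : σ → L) (hx : eval x G.g = 0) :
    ∑ s, G.gr x s * G.T q x s = - eval x q := by
  rw [G.eval_eq_sum_A q hq x]
  simp only [T, Finset.mul_sum]
  rw [Finset.sum_comm, ← Finset.sum_neg_distrib]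
  refine Finset.sum_congr rfl fun a _ => ?_
  rw [← mul_neg, ← G.gr_ca x hx a, Finset.mul_sum]
  exact Finset.sum_congr rfl fun _ _ => by ring

end GS

/-- Row types. -/
inductive RowIx {σ κ : Type} (blk : σ → κ) (J : Type) : Type
  | euler (i : κ) : RowIx blk J
  | der (j : J) : RowIx blk J
  | syz (a b : σ) (h : blk a = blk b) (β : σ →₀ ℕ) (i : κ) (hi : blk a = i) : RowIx blk J
  | gl (a b : σ) (h : blk a = blk b) : RowIx blk J

namespace GS
variable {L : Type} [Field L] [CharZero L] {σ κ : Type} [Fintype σ] [DecidableEq σ] [Fintype κ] [DecidableEq κ]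
    {blk : σ → κ} {d : κ → ℕ} (G : GS L blk d) {J : Type} (yi : J → G.ιb)

/-- Row vectors at a point. -/
noncomputable def V (x : σ → L) : RowIx blk J → σ → L
  | .euler i => fun s => if blk s = i then x s else 0
  | .der j => fun s => G.Δ (yi j) (x s)
  | .syz a b _ β _ _ => fun s => x a * G.T (monomial (β + Finsupp.single b 1) 1) x s -
      x b * G.T (monomial (β + Finsupp.single a 1) 1) x s
  | .gl a b _ => fun s => (if s = a then x b else 0) + G.T (X b * pderiv a G.g) x s

theorem span_rows (x : σ → L) (hx : ∀ i, ∃ s, blk s = i ∧ x s ≠ 0) (l : σ → L)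
    (hl : ∀ r : RowIx blk J, ∑ s, l s * G.V yi x r s = 0) (hd : ∀ i, 0 < d i) : ∃ c : L, ∀ s, l s = c * G.gr x s := by
  choose q hq hq2 using hx
  set τ : MvPolynomial σ L → L := fun p => ∑ s, l s * G.T p x s with hτ
  have hsyz : ∀ a b, blk a = blk b → ∀ β, x a * τ (monomial (β + Finsupp.single b 1) 1) =
      x b * τ (monomial (β + Finsupp.single a 1) 1) := by
    intro a b h β
    have := hl (.syz a b h β _ rfl)
    simp only [V, mul_sub, Finset.sum_sub_distrib] at this
    simp only [hτ, Finset.mul_sum]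
    rw [sub_eq_zero] at this
    convert this using 2 <;> ring
  set m0 : σ →₀ ℕ := ∑ i, Finsupp.single (q i) (d i) with hm0
  have hm0v : ∀ s, m0 s = if s = q (blk s) then d (blk s) else 0 := by
    intro s
    rw [hm0, Finsupp.finsetSum_apply]
    split_ifs with h
    · rw [Finset.sum_eq_single (blk s)]
      · rw [← h]; simp
      · intro j _ hj
        rw [Finsupp.single_eq_of_ne]
        intro h2
        rw [h2, hq] at hj; exact hj rfl
      · simp
    · refine Finset.sum_eq_zero fun i _ => ?_
      rw [Finsupp.single_eq_of_ne]
      intro h2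
      rw [h2, hq] at h; exact h rfl
  have hm0x : ∏ s, x s ^ m0 s ≠ 0 := by
    refine Finset.prod_ne_zero_iff.2 fun s _ => ?_
    rw [hm0v]
    split_ifs with h
    · rw [h]; exact pow_ne_zero _ (hq2 _)
    · simp
  have hind : ∀ n : ℕ, ∀ m : σ →₀ ℕ, (∀ i, ∑ s with blk s = i, m s = d i) → ∑ s with s ≠ q (blk s), m s = n →
      τ (monomial m 1) = (τ (monomial m0 1) / ∏ s, x s ^ m0 s) * ∏ s, x s ^ m s := by
    intro n
    induction n with
    | zero =>
      intro m hm hn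
      have : m = m0 := by
        ext s
        rw [Finset.sum_eq_zero_iff] at hn
        rw [hm0v]
        split_ifs with h
        · rw [← hm (blk s), Finset.sum_eq_single s]
          · intro s' hs' hne
            refine hn s' ?_
            simp at hs' ⊢
            rw [hs', ← h]; exact hne
          · simp
        · exact hn s (by simpa using h)
      rw [this]
      field_simp
    | succ n ih =>
      intro m hm hn
      obtain ⟨s, hs, hs0⟩ := Finset.exists_ne_zero_of_sum_ne_zero (by rw [hn]; omega)
      simp at hs
      set β := m - Finsupp.single s 1 with hβ
      have hmβ : m = β + Finsupp.single s 1 := by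
        ext s'
        by_cases h : s' = s
        · subst h; simp [hβ]; omega
        · simp [hβ, Finsupp.single_apply, Ne.symm h]
      set qq := q (blk s)
      have hbq : blk qq = blk s := hq _
      have h1 := ih (β + Finsupp.single qq 1) (fun i => by
        rw [← hm i, hmβ]
        simp only [Finsupp.add_apply, Finset.sum_add_distrib]
        congr 1
        simp only [Finset.sum_filter, Finsupp.single_apply]
        by_cases hi : blk s = i
        · rw [Finset.sum_eq_single qq, Finset.sum_eq_single s]
          · simp [hbq, hi]
          · intro c _ hc; simp [Ne.symm hc]
          · simp
          · intro c _ hc; simp [Ne.symm hc]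
          · simp
        · rw [Finset.sum_eq_zero, Finset.sum_eq_zero]
          · intro c _
            split_ifs with h3 h4
            · rw [← h4] at h3; exact absurd h3 hi
            · rfl
            · rfl
          · intro c _
            split_ifs with h3 h4
            · rw [← h4, hbq] at h3; exact absurd h3 hi
            · rfl
            · rfl) (by
        rw [hmβ] at hn
        simp only [Finsupp.add_apply, Finset.sum_add_distrib] at hn ⊢
        have h5 : ∑ c with c ≠ q (blk c), Finsupp.single s 1 c = 1 := by
          rw [Finset.sum_eq_single s]
          · simp
          · intro c _ hc; simp [Finsupp.single_apply, Ne.symm hc]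
          · intro h; exact absurd (by simpa using hs) h
        have h6 : ∑ c with c ≠ q (blk c), Finsupp.single qq 1 c = 0 := by
          refine Finset.sum_eq_zero fun c hc => ?_
          rw [Finsupp.single_eq_of_ne]
          simp at hc
          rintro rfl
          rw [hbq] at hc
          exact hc rfl
        rw [h5] at hn
        rw [h6]
        omega)
      have h2 := hsyz qq s hbq β
      rw [h1] at h2
      rw [hmβ]
      have h3 : ∀ c, ∏ s', x s' ^ ((β + Finsupp.single c 1 : σ →₀ ℕ) s') = (∏ s', x s' ^ β s') * x c := by
        intro c
        simp only [Finsupp.add_apply, pow_add, Finset.prod_mul_distrib]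
        congr 1
        rw [Finset.prod_eq_single c]
        · simp
        · intro c' _ hc; simp [Finsupp.single_apply, Ne.symm hc]
        · simp
      rw [h3] at h2 ⊢
      have hqq : x qq ≠ 0 := hq2 _
      apply mul_left_cancel₀ hqq
      rw [h2]; ring
  set c := τ (monomial m0 1) / ∏ s, x s ^ m0 s
  have hmain : ∀ p : MvPolynomial σ L, MH blk p d → τ p = c * eval x p := by
    intro p hp
    have hmon : ∀ a, ∑ s, l s * G.Δ (G.ca a) (x s) = c * ∏ s, x s ^ G.α a s := by
      intro a
      rw [← hind _ (G.α a) (G.hαd a) rfl]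
      simp only [hτ, T]
      refine Finset.sum_congr rfl fun s _ => ?_
      rw [Finset.sum_eq_single a]
      · simp
      · intro a' _ ha
        rw [coeff_monomial, if_neg (fun h => ha (G.hα h).symm), zero_mul]
      · simp
    rw [G.eval_eq_sum_A p hp]
    simp only [hτ, T, Finset.mul_sum]
    rw [Finset.sum_comm]
    refine Finset.sum_congr rfl fun a _ => ?_
    rw [mul_left_comm, ← hmon a, Finset.mul_sum]
    exact Finset.sum_congr rfl fun _ _ => by ring
  refine ⟨-c, fun a => ?_⟩
  have h1 := hl (.gl a (q (blk a)) (hq _).symm)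
  simp only [V, mul_add, Finset.sum_add_distrib] at h1
  rw [Finset.sum_eq_single a] at h1
  · have hmh : MH blk (X (q (blk a)) * pderiv a G.g) d := by
      have hw : (fun i => d i - (Pi.single (blk a) 1 : κ → ℕ) i) + Pi.single (blk a) 1 = d := by
        ext i
        have := hd i
        by_cases h : i = blk a
        · subst h; simp; omega
        · simp [h]
      have := (MH.X (R := L) (blk := blk) (q (blk a))).mul (G.hg.pderiv a hw)
      rw [hq, add_comm, hw] at this
      exact this
    have h2 := hmain _ hmh
    simp only [hτ] at h2
    rw [h2, if_pos rfl] at h1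
    simp only [map_mul, eval_X] at h1
    have : x (q (blk a)) * (l a + c * G.gr x a) = 0 := by
      rw [← h1, gr]; ring
    have := (mul_eq_zero.1 this).resolve_left (hq2 _)
    linear_combination this
  · intro s _ hs
    rw [if_neg hs, mul_zero]
  · simp
end GS

/-! ### Part 12 -/

/-- Dot product functional. -/
noncomputable def dotF {σ L : Type} [Fintype σ] [Field L] (l : σ → L) : (σ → L) →ₗ[L] L where
  toFun v := ∑ s, l s * v s
  map_add' u v := by simp [mul_add, Finset.sum_add_distrib]
  map_smul' c v := by simp only [Pi.smul_apply, smul_eq_mul, RingHom.id_apply, Finset.mul_sum]; exact Finset.sum_congr rfl fun _ _ => by ring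

theorem dotF_apply {σ L : Type} [Fintype σ] [Field L] (l v : σ → L) : dotF l v = ∑ s, l s * v s := rfl

theorem exists_dotF {σ L : Type} [Fintype σ] [DecidableEq σ] [Field L] (f : (σ → L) →ₗ[L] L) : ∃ l, f = dotF l := by
  refine ⟨fun s => f (Pi.single s 1), ?_⟩
  refine LinearMap.pi_ext fun s c => ?_
  rw [dotF_apply, Finset.sum_eq_single s]
  · rw [Pi.single_eq_same]
    have : (Pi.single s c : σ → L) = c • Pi.single s 1 := by rw [← Pi.single_smul]; simp
    rw [this, map_smul, smul_eq_mul, mul_comm]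
  · intro s' _ h; rw [Pi.single_eq_of_ne h, mul_zero]
  · simp

theorem LinearIndepOn.fin' {R L E : Type} [Field L] [AddCommGroup E] [Module L E] [FiniteDimensional L E] {V : R → E} {B : Set R}
    (h : LinearIndepOn L V B) : B.Finite := by
  have : LinearIndependent L (fun x : B => V x) := h
  have := this.finite
  exact Set.toFinite B

namespace GS
variable {L : Type} [Field L] [CharZero L] {σ κ : Type} [Fintype σ] [DecidableEq σ] [Fintype κ] [DecidableEq κ]
    {blk : σ → κ} {d : κ → ℕ} (G : GS L blk d) {J : Type} (yi : J → G.ιb)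

theorem T_zero (q : MvPolynomial σ L) (hq : ∀ a, coeff (G.α a) q = 0) (x : σ → L) (s : σ) : G.T q x s = 0 := by
  simp [T, hq]

theorem tangent (hdis : ∀ j a, yi j ≠ G.ca a) (hd : ∀ i, 0 < d i) (x : σ → L) (hx : eval x G.g = 0) (r : RowIx blk J) :
    ∑ s, G.gr x s * G.V yi x r s = 0 := by
  match r with
  | .euler i => exact G.gr_euler x hx i
  | .der j => exact G.gr_der x hx _ (fun a => G.hΔ0 _ _ (hdis j a))
  | .syz a b h β _ _ =>
    simp only [V]
    have hcount : ∀ c, blk c = blk a → ∀ i, ∑ s with blk s = i, (β + Finsupp.single c 1 : σ →₀ ℕ) s =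
        ∑ s with blk s = i, β s + if blk a = i then 1 else 0 := by
      intro c hc i
      simp only [Finsupp.add_apply, Finset.sum_add_distrib]
      congr 1
      rw [Finset.sum_filter, Finset.sum_eq_single c]
      · simp [hc]
      · intro c' _ hc'; simp [Ne.symm hc']
      · simp
    have hMH : ∀ c, blk c = blk a → (∀ i, ∑ s with blk s = i, β s + (if blk a = i then 1 else 0) = d i) →
        MH blk (monomial (β + Finsupp.single c 1) (1 : L)) d := by
      intro c hc h2 m hm i
      have := support_monomial_subset hm
      rw [Finset.mem_singleton] at this
      rw [this, hcount c hc, h2]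
    by_cases hdeg : ∀ i, ∑ s with blk s = i, β s + (if blk a = i then 1 else 0) = d i
    · have h1 := G.gr_T _ (hMH b h.symm hdeg) x hx
      have h2 := G.gr_T _ (hMH a rfl hdeg) x hx
      have h3 : ∀ c, eval x (monomial (β + Finsupp.single c 1) (1 : L)) = eval x (monomial β 1) * x c := by
        intro c
        rw [← mul_one (1 : L), ← monomial_mul, mul_one, map_mul]
        congr 1
        exact eval_X c
      rw [h3] at h1 h2
      have : ∑ s, G.gr x s * (x a * G.T (monomial (β + Finsupp.single b 1) 1) x s -
          x b * G.T (monomial (β + Finsupp.single a 1) 1) x s) =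
          x a * ∑ s, G.gr x s * G.T (monomial (β + Finsupp.single b 1) 1) x s -
          x b * ∑ s, G.gr x s * G.T (monomial (β + Finsupp.single a 1) 1) x s := by
        rw [Finset.mul_sum, Finset.mul_sum, ← Finset.sum_sub_distrib]
        exact Finset.sum_congr rfl fun _ _ => by ring
      rw [this, h1, h2]; ring
    · have h0 : ∀ c, blk c = blk a → ∀ s, G.T (monomial (β + Finsupp.single c 1) 1) x s = 0 := by
        intro c hc s
        refine G.T_zero _ (fun a' => ?_) x s
        rw [coeff_monomial, if_neg]
        intro h2
        apply hdeg
        intro i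
        rw [← hcount c hc, h2, G.hαd]
      refine Finset.sum_eq_zero fun s _ => ?_
      rw [h0 b h.symm, h0 a rfl]; ring
  | .gl a b h =>
    simp only [V, mul_add, Finset.sum_add_distrib]
    have hmh : MH blk (X b * pderiv a G.g) d := by
      have hw : (fun i => d i - (Pi.single (blk a) 1 : κ → ℕ) i) + Pi.single (blk a) 1 = d := by
        ext i
        have := hd i
        by_cases h : i = blk a
        · subst h; simp; omega
        · simp [h]
      have := (MH.X (R := L) (blk := blk) b).mul (G.hg.pderiv a hw)
      rw [← h, add_comm, hw] at this
      exact this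
    rw [G.gr_T _ hmh x hx, Finset.sum_eq_single a]
    · simp [gr]; ring
    · intro s _ hs; rw [if_neg hs, mul_zero]
    · simp

theorem span_V (hdis : ∀ j a, yi j ≠ G.ca a) (hd : ∀ i, 0 < d i) (x : σ → L)
    (hx : ∀ i, ∃ s, blk s = i ∧ x s ≠ 0) (hgx : eval x G.g = 0) :
    Module.finrank L (Submodule.span L (G.V yi x '' Set.univ)) + 1 = Fintype.card σ := by
  have hn := G.smooth x hx hgx
  have hf : dotF (G.gr x) ≠ 0 := by
    intro h
    apply hn
    ext s
    have := congrArg (fun f => f (Pi.single s 1)) h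
    simpa [dotF_apply, Pi.single_apply] using this
  have h1 := Module.Dual.finrank_ker_add_one_of_ne_zero (f := dotF (G.gr x)) hf
  rw [Module.finrank_fintype_fun_eq_card] at h1
  have hle : Submodule.span L (G.V yi x '' Set.univ) ≤ LinearMap.ker (dotF (G.gr x)) := by
    rw [Submodule.span_le]
    rintro _ ⟨r, _, rfl⟩
    exact G.tangent yi hdis hd x hgx r
  have : Submodule.span L (G.V yi x '' Set.univ) = LinearMap.ker (dotF (G.gr x)) := by
    refine le_antisymm hle ?_
    intro v hv
    by_contra hv2
    obtain ⟨f, hf1, hf2⟩ := Submodule.exists_le_ker_of_notMem hv2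
    obtain ⟨l, rfl⟩ := exists_dotF f
    obtain ⟨c, hc⟩ := G.span_rows yi x hx l (fun r => hf2 (Submodule.subset_span ⟨r, trivial, rfl⟩)) hd
    apply hf1
    have h3 : dotF (G.gr x) v = 0 := hv
    rw [dotF_apply] at h3 ⊢
    simp only [hc, mul_assoc, ← Finset.mul_sum, h3, mul_zero]
  rw [this, h1]

/-- Span of Euler and derivative rows. -/
noncomputable def U (x : σ → L) : Submodule L (σ → L) :=
  Submodule.span L (G.V yi x '' (Set.range RowIx.euler ∪ Set.range RowIx.der))

theorem euler_indep (x : σ → L) (hx : ∀ i, ∃ s, blk s = i ∧ x s ≠ 0) :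
    LinearIndepOn L (G.V yi x) (Set.range RowIx.euler) := by
  have h : LinearIndependent L (fun i => G.V yi x (.euler i)) := by
    rw [Fintype.linearIndependent_iff]
    intro c hc i
    obtain ⟨s, hs, hs2⟩ := hx i
    have := congrFun hc s
    rw [Finset.sum_apply, Finset.sum_eq_single i] at this
    · simp [V, hs] at this
      tauto
    · intro j _ hj
      simp [V, hs, Ne.symm hj]
    · simp
  have := (linearIndepOn_range_iff (f := RowIx.euler (blk := blk) (J := J)) (fun i j h => by cases h; rfl) (G.V yi x)).2 h
  exact this

theorem exists_basis_rows (hdis : ∀ j a, yi j ≠ G.ca a) (hd : ∀ i, 0 < d i) (x : σ → L)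
    (hx : ∀ i, ∃ s, blk s = i ∧ x s ≠ 0) (hgx : eval x G.g = 0) :
    ∃ B1 B2 : Set (RowIx blk J), Set.range RowIx.euler ⊆ B1 ∧ B1 ⊆ Set.range RowIx.euler ∪ Set.range RowIx.der ∧
      B1 ⊆ B2 ∧ B2.Finite ∧ LinearIndepOn L (G.V yi x) B2 ∧
      B1.ncard = Module.finrank L (G.U yi x) ∧ B2.ncard + 1 = Fintype.card σ := by
  have hE := G.euler_indep yi x hx
  have hsub : Set.range (RowIx.euler (blk := blk) (J := J)) ⊆ Set.range RowIx.euler ∪ Set.range RowIx.der :=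
    Set.subset_union_left
  have hB1 := hE.linearIndepOn_extend hsub
  have hB2 := hB1.linearIndepOn_extend (Set.subset_univ _)
  have hcard : ∀ B : Set (RowIx blk J), LinearIndepOn L (G.V yi x) B →
      Module.finrank L (Submodule.span L (G.V yi x '' B)) = B.ncard := by
    intro B hB
    have hfin := LinearIndepOn.fin' hB
    have := hfin.fintype
    have h1 := finrank_span_eq_card (R := L) (b := fun r : B => G.V yi x r) hB
    rw [← Nat.card_eq_fintype_card, Nat.card_coe_set_eq] at h1
    rw [← Set.image_eq_range] at h1
    exact h1
  refine ⟨_, _, hE.subset_extend hsub, hE.extend_subset hsub, hB1.subset_extend (Set.subset_univ _), LinearIndepOn.fin' hB2, hB2, ?_, ?_⟩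
  · rw [← hcard _ hB1, hE.span_image_extend_eq_span_image]; rfl
  · rw [← hcard _ hB2, hB1.span_image_extend_eq_span_image, G.span_V yi hdis hd x hx hgx]
end GS

/-! ### Part 13 -/

namespace GS
variable {L : Type} [Field L] [CharZero L] {σ κ : Type} [Fintype σ] [DecidableEq σ] [Fintype κ] [DecidableEq κ]
    {blk : σ → κ} {d : κ → ℕ} (G : GS L blk d) {J : Type} [Fintype J] [DecidableEq J] (yi : J → G.ιb)

/-- weight -/
def rw' : RowIx blk J → κ → ℕ
  | .syz _ _ _ _ i _ => Pi.single i 1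
  | _ => 0

/-- rho over a field -/
noncomputable def rρ (k : Type) [Field k] : RowIx blk J → σ → MvPolynomial σ k
  | .euler i, s => if blk s = i then X s else 0
  | .gl a b _, s => if s = a then X b else 0
  | _, _ => 0

/-- chi over a field -/
noncomputable def rχ {k : Type} [Field k] (gk : MvPolynomial σ k) : RowIx blk J → (J ⊕ G.A) → MvPolynomial σ k
  | .der j, .inl j' => if j' = j then 1 else 0
  | .syz a b _ β _ _, .inr a' => X a * C (coeff (G.α a') (monomial (β + Finsupp.single b 1) 1)) -
      X b * C (coeff (G.α a') (monomial (β + Finsupp.single a 1) 1))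
  | .gl a b _, .inr a' => C (coeff (G.α a') (X b * pderiv a gk))
  | _, _ => 0

theorem rρ_MH (k : Type) [Field k] (r : RowIx blk J) (s : σ) :
    MH blk (rρ k r s) (rw' r + Pi.single (blk s) 1) := by
  match r with
  | .euler i =>
    simp only [rρ, rw', zero_add]
    split_ifs
    · exact MH.X s
    · exact MH.zero
  | .der j => exact MH.zero
  | .syz _ _ _ _ _ _ => exact MH.zero
  | .gl a b h =>
    simp only [rρ, rw', zero_add]
    split_ifs with hs
    · rw [hs, h]; exact MH.X b
    · exact MH.zero

theorem rχ_MH {k : Type} [Field k] (gk : MvPolynomial σ k) (r : RowIx blk J) (a : J ⊕ G.A) :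
    MH blk (G.rχ gk r a) (rw' r) := by
  match r, a with
  | .der j, .inl j' =>
    simp only [rχ, rw']
    split_ifs
    · exact MH.one
    · exact MH.zero
  | .der j, .inr a' => exact MH.zero
  | .euler i, .inr a' => exact MH.zero
  | .euler i, .inl a' => exact MH.zero
  | .syz _ _ _ _ _ _, .inl _ => exact MH.zero
  | .gl _ _ _, .inl _ => exact MH.zero
  | .gl _ _ _, .inr _ => exact MH.C _
  | .syz a b h β i hi, .inr a' =>
    simp only [rχ, rw']
    subst hi
    rw [sub_eq_add_neg]
    refine MH.add ?_ (MH.neg ?_)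
    · have := (MH.X (R := k) (blk := blk) a).mul (MH.C (coeff (G.α a') (monomial (β + Finsupp.single b 1) 1)))
      rwa [add_zero] at this
    · rw [h]
      have := (MH.X (R := k) (blk := blk) b).mul (MH.C (coeff (G.α a') (monomial (β + Finsupp.single a 1) 1)))
      rwa [add_zero] at this

theorem row_eq {k : Type} [Field k] [Algebra k L] (gk : MvPolynomial σ k) (hgk : map (algebraMap k L) gk = G.g)
    (x : σ → L) (Δν : J ⊕ G.A → Derivation ℤ L L) (hinr : ∀ a, Δν (.inr a) = G.Δ (G.ca a))
    (r : RowIx blk J) (hr : ∀ j, r = .der j → Δν (.inl j) = G.Δ (yi j)) (s : σ) :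
    aeval x (rρ k r s) + ∑ a, aeval x (G.rχ gk r a) * Δν a (x s) = G.V yi x r s := by
  rw [Fintype.sum_sum_type]
  match r with
  | .euler i =>
    simp only [rρ, rχ, V, map_zero, zero_mul, Finset.sum_const_zero, add_zero]
    split_ifs <;> simp
  | .der j =>
    simp only [rρ, rχ, V, map_zero, zero_mul, Finset.sum_const_zero, add_zero, zero_add]
    rw [Finset.sum_eq_single j]
    · simp [hr j rfl]
    · intro j' _ h; simp [h]
    · simp
  | .syz a b h β _ _ =>
    simp only [rρ, rχ, V, T, map_zero, zero_mul, Finset.sum_const_zero, zero_add, Finset.mul_sum,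
      ← Finset.sum_sub_distrib, hinr]
    refine Finset.sum_congr rfl fun a' _ => ?_
    simp only [map_sub, map_mul, aeval_X, aeval_C, coeff_monomial]
    split_ifs <;> simp <;> ring
  | .gl a b h =>
    simp only [rρ, rχ, V, T, map_zero, zero_mul, Finset.sum_const_zero, zero_add, hinr]
    congr 1
    · split_ifs <;> simp
    · refine Finset.sum_congr rfl fun a' _ => ?_
      rw [aeval_C, ← hgk, pderiv_map, ← map_X (algebraMap k L), ← map_mul, coeff_map]

theorem orbit_finite' {F L σ : Type} [Field F] [Field L] [Algebra F L] [Finite σ] (hK : ∀ x : L, IsAlgebraic F x) (x : σ → L) :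
    (Set.range fun τ : L ≃ₐ[F] L => (fun s => τ (x s))).Finite := by
  refine (Set.Finite.pi (t := fun s => ((minpoly F (x s)).rootSet L : Set L)) fun s => Set.toFinite _).subset ?_
  rintro _ ⟨τ, rfl⟩ s _
  rw [Polynomial.mem_rootSet]
  refine ⟨minpoly.ne_zero (hK _).isIntegral, ?_⟩
  rw [show Polynomial.aeval (τ (x s)) (minpoly F (x s)) = τ (Polynomial.aeval (x s) (minpoly F (x s))) from
    Polynomial.aeval_algHom_apply τ.toAlgHom _ _]
  rw [minpoly.aeval, map_zero]

theorem orbit_finite (K : IntermediateField ℚ L) (hK : ∀ x : L, IsAlgebraic K x) (x : σ → L) :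
    (Set.range fun τ : L ≃ₐ[K] L => (fun s => τ (x s))).Finite :=
  orbit_finite' hK x

theorem eval_g_fixed (τ : L →+* L) (h : ∀ a, τ (G.b (G.ca a)) = G.b (G.ca a)) (x : σ → L) :
    eval (fun s => τ (x s)) G.g = τ (eval x G.g) := by
  have h1 : map τ G.g = G.g := by
    simp only [g, map_sum, map_monomial, h]
  conv_lhs => rw [← h1]
  rw [eval_map, ← coe_eval₂Hom, ← RingHom.comp_apply]
  congr 1
  ext <;> simp

theorem CBmain [IsAlgClosed L] (hyi : Function.Injective yi) (hdis : ∀ j a, yi j ≠ G.ca a) (hd : ∀ i, 0 < d i)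
    (x : σ → L) (hx : ∀ i, ∃ s, blk s = i ∧ x s ≠ 0) (hgx : eval x G.g = 0) (s c : ℕ) (hs : 1 ≤ s)
    (hU : Module.finrank L (G.U yi x) = Fintype.card κ + s) (hc : Fintype.card κ + s + c + 1 = Fintype.card σ) :
    ∃ w : κ → ℕ, ∑ i, w i ≤ c ∧ ∀ e : κ → ℕ, (∀ i, e i + Fintype.card {s // blk s = i} + w i = d i) →
      ∀ P : MvPolynomial σ L, MH blk P e →
        (∀ τ : L ≃ₐ[KK G.b yi] L, (fun s => τ (x s)) ≠ x → eval (fun s => τ (x s)) P = 0) → eval x P = 0 := by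
  classical
  obtain ⟨B1, B2, hE1, h1ED, h12, hfin, hli, hcard1, hcard2⟩ := G.exists_basis_rows yi hdis hd x hx hgx
  obtain ⟨j0, hj0⟩ : ∃ j0, RowIx.der j0 ∈ B1 := by
    by_contra hcon
    push Not at hcon
    have h3 : B1 ⊆ Set.range RowIx.euler := by
      intro r hr
      rcases h1ED hr with h | ⟨j, rfl⟩
      · exact h
      · exact absurd hr (hcon j)
    have h4 := Set.ncard_le_ncard h3 (Set.finite_range _)
    have h5 : (Set.range (RowIx.euler (blk := blk) (J := J))).ncard ≤ Fintype.card κ := by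
      rw [← Set.image_univ]
      refine (Set.ncard_image_le (Set.finite_univ)).trans ?_
      rw [Set.ncard_univ, Nat.card_eq_fintype_card]
    omega
  have := hfin.fintype
  have hcB : Fintype.card (Option B2) = Fintype.card σ := by
    rw [Fintype.card_option, ← hcard2, ← Nat.card_eq_fintype_card, Nat.card_coe_set_eq]
  let q : Option B2 ≃ σ := Fintype.equivOfCardEq hcB
  -- field k
  set k := kA G.b {yi j0}ᶜ with hk
  have : IsAlgClosed k := isAlgClosed_kA _ _
  let ck : G.A → k := fun a => ⟨G.b (G.ca a), b_mem_kA _ _ (fun h => hdis j0 a h.symm)⟩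
  let gk : MvPolynomial σ k := ∑ a, monomial (G.α a) (ck a)
  have hgk : map (algebraMap k L) gk = G.g := by
    simp only [gk, map_sum, map_monomial]
    rfl
  have hgkMH : MH blk gk d := by
    refine MH.sum _ _ fun a _ => ?_
    intro m hm i
    have := support_monomial_subset hm
    rw [Finset.mem_singleton] at this
    rw [this]; exact G.hαd a i
  have hae : ∀ y : σ → L, aeval y gk = eval y G.g := fun y => by rw [← hgk, eval_map, aeval_def]
  have hae2 : ∀ (y : σ → L) s, aeval y (pderiv s gk) = G.gr y s := fun y s => by
    rw [gr, ← hgk, pderiv_map, eval_map, aeval_def]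
  let Δν : J ⊕ G.A → Derivation ℤ L L := Sum.elim (fun j => if j = j0 then 0 else G.Δ (yi j)) (fun a => G.Δ (G.ca a))
  let w : σ → κ → ℕ := fun p => match q.symm p with
    | none => 0
    | some r => rw' r.1
  let p0 : σ := q (some ⟨.der j0, h12 hj0⟩)
  let pu : σ := q none
  let ee : κ → σ := fun i => q (some ⟨.euler i, h12 (hE1 ⟨i, rfl⟩)⟩)
  refine ⟨fun i => ∑ p, w p i, ?_, ?_⟩
  · rw [Finset.sum_comm, ← q.sum_comp]
    simp only [w, Equiv.symm_apply_apply, Fintype.sum_option]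
    simp only [Pi.zero_apply, Finset.sum_const_zero, zero_add]
    have hle : ∀ r : RowIx blk J, ∑ i, rw' r i ≤ if r ∈ B1 then 0 else 1 := by
      intro r
      split_ifs with h
      · rcases h1ED h with ⟨i, rfl⟩ | ⟨j, rfl⟩ <;> simp [rw']
      · match r with
        | .euler i => simp [rw']
        | .der j => simp [rw']
        | .gl _ _ _ => simp [rw']
        | .syz _ _ _ _ i _ => simp [rw']
    refine (Finset.sum_le_sum fun r _ => hle r.1).trans ?_
    have h6 : ∑ r : B2, (if r.1 ∈ B1 then 0 else 1) = (B2 \ B1).ncard := by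
      have e1 : ∀ r : B2, (if r.1 ∈ B1 then 0 else 1) = if r.1 ∉ B1 then 1 else 0 := fun r => by
        by_cases h : r.1 ∈ B1 <;> simp [h]
      rw [Finset.sum_congr rfl fun r _ => e1 r, ← Finset.card_filter, ← Set.ncard_coe_finset,
        ← Set.ncard_image_of_injective _ (Subtype.val_injective (p := fun r => r ∈ B2))]
      congr 1
      ext r
      simp only [Finset.coe_filter, Finset.mem_univ, true_and, Set.mem_image, Set.mem_setOf_eq, Subtype.exists,
        Set.mem_diff]
      constructor
      · rintro ⟨a, ha, h, rfl⟩; exact ⟨ha, h⟩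
      · rintro ⟨ha, h⟩; exact ⟨r, ha, h, rfl⟩
    rw [h6]
    have := Set.ncard_sdiff_add_ncard_of_subset h12 hfin
    omega
  · intro e he P hP hτ
    by_cases hP0 : P = 0
    · simp [hP0]
    obtain ⟨m, hm⟩ := Finset.nonempty_iff_ne_empty.2 (fun h => hP0 (support_eq_empty.1 h))
    have hme := hP m hm
    let D : KData σ κ (J ⊕ G.A) k blk d :=
      { p0 := p0
        pu := pu
        hp := fun h => by have := q.injective h; simp at this
        w := w
        ρ := fun p => match q.symm p with
          | none => 0
          | some r => rρ k r.1
        χ := fun p => match q.symm p with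
          | none => 0
          | some r => G.rχ gk r.1
        e := ee
        he := fun i j h => by
          have := q.injective h
          simpa using this
        he0 := fun i h => by
          have := q.injective h
          simp at this
        heu := fun i h => by
          have := q.injective h
          simp at this
        hw0 := by simp only [w, p0, Equiv.symm_apply_apply]; rfl
        hwu := by simp only [w, pu, Equiv.symm_apply_apply]
        hρ := fun p hp0 hpu s => by
          obtain ⟨o, rfl⟩ := q.surjective p
          match o with
          | none => exact absurd rfl hpu
          | some r =>
            simp only [w, Equiv.symm_apply_apply]
            exact rρ_MH k r.1 s
        hχ := fun p hp0 hpu a => by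
          obtain ⟨o, rfl⟩ := q.surjective p
          match o with
          | none => exact absurd rfl hpu
          | some r =>
            simp only [w, Equiv.symm_apply_apply]
            exact G.rχ_MH gk r.1 a
        heρ := fun i s => by
          simp only [ee, Equiv.symm_apply_apply]; rfl
        heχ := fun i a => by
          simp only [ee, Equiv.symm_apply_apply]
          cases a <;> rfl
        ex := m
        hdeg := fun i => by rw [hme]; exact he i }
    have hmat : ∀ (y : σ → L) ι (r : B2), D.mat (G.Δ (yi j0)) Δν y ι (q (some r)) = G.V yi y r.1 := by
      intro y ι r
      ext s
      by_cases hr : r.1 = .der j0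
      · have : q (some r) = D.p0 := by
          change _ = p0
          simp only [p0]
          congr 2
          exact Subtype.ext hr
        rw [this]
        simp only [KData.mat, if_pos]
        rw [hr]; rfl
      · have h1 : q (some r) ≠ D.p0 := by
          intro h
          have := q.injective h
          simp at this
          exact hr (congrArg Subtype.val this)
        have h2 : q (some r) ≠ D.pu := by
          intro h
          have := q.injective h
          simp at this
        simp only [KData.mat, if_neg h1, if_neg h2]
        simp only [D, Equiv.symm_apply_apply]
        refine G.row_eq yi gk hgk y Δν (fun _ => rfl) r.1 (fun j hj => ?_) s
        simp only [Δν, Sum.elim_inl]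
        rw [if_neg]
        rintro rfl
        exact hr hj
    have hfinO := orbit_finite (KK G.b yi) (isAlgebraic_KK _ _ G.hb) x
    have hb1 : ∀ i, G.Δ (yi j0) (G.b i) = if i = yi j0 then 1 else 0 := by
      intro i
      split_ifs with h
      · rw [h, G.hΔ1]
      · exact G.hΔ0 _ _ (Ne.symm h)
    have hkill : ∀ z ∈ k, G.Δ (yi j0) z = 0 := fun z hz =>
      derivation_kA_zero _ _ _ (fun j hj => by rw [hb1, if_neg (show ¬ j = yi j0 from hj)]) hz
    have hS : ∀ y ∈ hfinO.toFinset, (∀ i, ∃ s, blk s = i ∧ y s ≠ 0) ∧ aeval y gk = 0 := by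
      intro y hy
      rw [Set.Finite.mem_toFinset] at hy
      obtain ⟨τ, rfl⟩ := hy
      refine ⟨fun i => ?_, ?_⟩
      · obtain ⟨s, h1, h2⟩ := hx i
        exact ⟨s, h1, by simpa using h2⟩
      · rw [hae]
        have := G.eval_g_fixed (τ : L →+* L) (fun a => τ.commutes ⟨_, b_mem_KK G.b yi (G.ca a)⟩) x
        rw [hgx, map_zero] at this
        exact this
    refine cb_abstract (G.b (yi j0)) ?_ ?_ D (G.Δ (yi j0)) Δν (fun c => hkill c c.2) (G.hΔ1 _) ?_ ?_ gk hgkMH ?_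
      hfinO.toFinset hS ?_ ?_ x ?_ ?_ P ?_ ?_
    · refine transcendental_kA _ _ (G.Δ (yi j0)) (fun j hj => by rw [hb1, if_neg (show ¬ j = yi j0 from hj)]) _ ?_
      rw [G.hΔ1]; exact one_ne_zero
    · intro N hN ht z
      refine isAlgebraic_of_b_mem G.b G.hb N (fun i => ?_) z
      by_cases h : i = yi j0
      · rw [h]; exact ht
      · exact hN ⟨_, b_mem_kA _ _ h⟩
    · intro a z
      have hgen : ∀ i, G.Δ i z ∈ k := fun i => by
        refine derivation_kA_mem _ _ _ (fun j _ => ?_) z.2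
        by_cases h : i = j
        · rw [h, G.hΔ1]; exact one_mem _
        · rw [G.hΔ0 _ _ h]; exact zero_mem _
      have : Δν a z ∈ k := by
        match a with
        | .inl j =>
          simp only [Δν, Sum.elim_inl]
          split_ifs
          · exact zero_mem _
          · exact hgen _
        | .inr a => exact hgen _
      exact ⟨⟨_, this⟩, rfl⟩
    · intro a
      match a with
      | .inl j =>
        simp only [Δν, Sum.elim_inl]
        split_ifs with h
        · rfl
        · exact G.hΔ0 _ _ (fun h2 => h (hyi h2))
      | .inr a => exact G.hΔ0 _ _ (fun h => hdis _ _ h.symm)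
    · intro y hy hgy
      rw [hae] at hgy
      obtain ⟨ι, hι⟩ := Function.ne_iff.1 (G.smooth y hy hgy)
      exact ⟨ι, by rw [hae2]; exact hι⟩
    · intro τ ht y hy
      rw [Set.Finite.mem_toFinset] at hy ⊢
      obtain ⟨τ', rfl⟩ := hy
      have hfix : ∀ z : L, z ∈ KK G.b yi → τ z = z := by
        intro z hz
        have := KK_le G.b yi hyi j0 (RingHom.eqLocusField (τ : L →+* L) (RingHom.id L)) (fun z hz => ?_) ?_ z hz
        · exact this
        · exact τ.commutes ⟨z, hz⟩
        · exact ht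
      let τ2 : L ≃ₐ[KK G.b yi] L := AlgEquiv.ofRingEquiv (f := τ.toRingEquiv) (fun z => hfix z z.2)
      exact ⟨τ'.trans τ2, rfl⟩
    · intro y hy ι p hp
      obtain ⟨o, rfl⟩ := q.surjective p
      match o with
      | none => exact absurd rfl hp
      | some r =>
        rw [hmat]
        have h1 := (hS y hy).2
        rw [hae] at h1
        have := G.tangent yi hdis hd y h1 r.1
        rw [← this]
        exact Finset.sum_congr rfl fun s _ => by rw [hae2, mul_comm]
    · rw [Set.Finite.mem_toFinset]; exact ⟨AlgEquiv.refl, rfl⟩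
    · intro ι
      have hli' : LinearIndependent L (fun r : B2 => G.V yi x r.1) := hli
      have hsome : ∀ p : {p : σ | p ≠ D.pu}, ∃ r : B2, q (some r) = p.1 := by
        rintro ⟨p, hp⟩
        obtain ⟨o, rfl⟩ := q.surjective p
        match o with
        | none => exact absurd rfl hp
        | some r => exact ⟨r, rfl⟩
      choose f hf using hsome
      have hfi : Function.Injective f := fun p p' h => Subtype.ext (by rw [← hf p, ← hf p', h])
      have := hli'.comp f hfi
      have e2 : (fun r : B2 => G.V yi x r.1) ∘ f = fun p : {p : σ | p ≠ D.pu} => D.mat (G.Δ (yi j0)) Δν x ι p.1 := by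
        ext1 p
        rw [← hf p, hmat]; rfl
      rw [e2] at this
      exact this
    · convert hP using 1
      ext i; exact hme i
    · intro y hy hne
      rw [Set.Finite.mem_toFinset] at hy
      obtain ⟨τ, rfl⟩ := hy
      exact hτ τ hne
end GS

/-! ### Part 14 -/

section Comb
variable {E L : Type} [Field L]

/-- Cayley-Bacharach for products of `p` functions in `V` -/
def CBf (V : Submodule L (E → L)) (p : ℕ) (S : Finset E) : Prop :=
  ∀ l : List (E → L), (∀ f ∈ l, f ∈ V) → l.length = p → ∀ a ∈ S,
    (∀ b ∈ S, b ≠ a → l.prod b = 0) → l.prod a = 0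

theorem CBf.sub [DecidableEq L] {V : Submodule L (E → L)} {p : ℕ} {S : Finset E} (h : CBf V (p + 1) S)
    (f : E → L) (hf : f ∈ V) : CBf V p (S.filter fun x => f x ≠ 0) := by
  intro l hl hlen a ha hb
  rw [Finset.mem_filter] at ha
  have := h (f :: l) (by simpa using ⟨hf, hl⟩) (by simp [hlen]) a ha.1 (fun b hb1 hba => by
    rw [List.prod_cons, Pi.mul_apply]
    by_cases hfb : f b = 0
    · rw [hfb, zero_mul]
    · rw [hb b (Finset.mem_filter.2 ⟨hb1, hfb⟩) hba, mul_zero])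
  rw [List.prod_cons, Pi.mul_apply] at this
  exact (mul_eq_zero.1 this).resolve_left ha.2

theorem list_prod_apply (l : List (E → L)) (a : E) : l.prod a = (l.map fun f => f a).prod := by
  induction l with
  | nil => rfl
  | cons f l ih => simp [ih]

theorem CBf.card {V : Submodule L (E → L)} {p : ℕ} {S : Finset E} (h : CBf V p S) (h1 : 1 ∈ V)
    (hsep : ∀ a b : E, a ≠ b → ∃ f ∈ V, f a = 0 ∧ f b ≠ 0) (hS : S.Nonempty) : p + 2 ≤ S.card := by
  classical
  by_contra hcon
  obtain ⟨a, ha⟩ := hS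
  have hcard : (S.erase a).card ≤ p := by rw [Finset.card_erase_of_mem ha]; omega
  choose! f hfV hf0 hf1 using fun b (h : b ≠ a) => hsep b a h
  let l := (S.erase a).toList.map f ++ List.replicate (p - (S.erase a).card) 1
  have hne : l.prod a ≠ 0 := by
    rw [list_prod_apply]
    simp only [l, List.map_append, List.prod_append, List.map_map]
    refine mul_ne_zero ?_ (by simp)
    rw [Finset.prod_map_toList, Finset.prod_ne_zero_iff]
    intro b hb
    exact hf1 b (Finset.ne_of_mem_erase hb)
  refine hne (h l ?_ ?_ a ha ?_)
  · intro g hg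
    simp only [l, List.mem_append, List.mem_map, Finset.mem_toList] at hg
    rcases hg with ⟨b, hb, rfl⟩ | hg
    · exact hfV b (Finset.ne_of_mem_erase hb)
    · rw [(List.mem_replicate.1 hg).2]; exact h1
  · simp only [l, List.length_append, List.length_map, Finset.length_toList, List.length_replicate]
    omega
  · intro b hb hba
    rw [list_prod_apply]
    simp only [l, List.map_append, List.prod_append, List.map_map]
    rw [Finset.prod_map_toList, Finset.prod_eq_zero (i := b) (Finset.mem_erase.2 ⟨hba, hb⟩) (by exact hf0 b hba),
      zero_mul]

theorem CBf.line {V : Submodule L (E → L)} (h1 : 1 ∈ V)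
    (hsep : ∀ a b : E, a ≠ b → ∃ f ∈ V, f a = 0 ∧ f b ≠ 0) (p : ℕ) :
    ∀ (S : Finset E) (_ : CBf V p S) (_ : S.card ≤ 2 * p + 1) (f : E → L) (_ : f ∈ V)
      (a b : E), a ∈ S → b ∈ S → a ≠ b → f a = 0 → f b = 0 → ∀ x ∈ S, f x = 0 := by
  classical
  induction p with
  | zero =>
    intro S _ hc f _ a b ha hb hab
    exact absurd (Finset.card_le_one.1 hc a ha b hb) hab
  | succ p ih =>
    intro S hS hc f hf a b ha hb hab hfa hfb
    by_contra hcon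
    push Not at hcon
    obtain ⟨x0, hx0, hfx0⟩ := hcon
    set S' := S.filter fun x => f x ≠ 0 with hS'
    have hCB' := hS.sub f hf
    have hge := hCB'.card h1 hsep ⟨x0, Finset.mem_filter.2 ⟨hx0, hfx0⟩⟩
    have hsplit := Finset.card_filter_add_card_filter_not (s := S) (fun x => f x ≠ 0)
    have hrest : 2 ≤ (S.filter fun x => ¬ f x ≠ 0).card :=
      Finset.one_lt_card.2 ⟨a, by simp [ha, hfa], b, by simp [hb, hfb], hab⟩
    rw [← hS'] at hsplit hCB' hge
    obtain ⟨a', ha', b', hb', hab'⟩ := Finset.one_lt_card.1 (show 1 < S'.card by omega)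
    have key : ∀ h ∈ V, h a' = 0 → h b' = 0 → ∀ x ∈ S, h x = 0 := by
      intro h hh hha hhb
      have hz := ih S' hCB' (by omega) h hh a' b' ha' hb' hab' hha hhb
      have hCB2 := hS.sub h hh
      by_contra hcon
      push Not at hcon
      obtain ⟨x1, hx1, hx1'⟩ := hcon
      have h2 := hCB2.card h1 hsep ⟨x1, Finset.mem_filter.2 ⟨hx1, hx1'⟩⟩
      have h3 : (S.filter fun x => h x ≠ 0) ⊆ S.filter fun x => ¬ f x ≠ 0 := by
        intro x hx
        rw [Finset.mem_filter] at hx ⊢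
        exact ⟨hx.1, fun hfx => hx.2 (hz x (Finset.mem_filter.2 ⟨hx.1, hfx⟩))⟩
      have := Finset.card_le_card h3
      omega
    obtain ⟨u, hu, hua, hub⟩ := hsep a b hab
    have hfa' : f a' ≠ 0 := (Finset.mem_filter.1 ha').2
    let h1' : E → L := u - (u a' / f a') • f
    let h2' : E → L := 1 - (1 / f a') • f
    have hh1 : h1' ∈ V := V.sub_mem hu (V.smul_mem _ hf)
    have hh2 : h2' ∈ V := V.sub_mem h1 (V.smul_mem _ hf)
    have e1 : h1' a' = 0 := by simp [h1', hfa']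
    have e2 : h2' a' = 0 := by simp [h2', hfa']
    have e3 : h1' a = 0 := by simp [h1', hfa, hua]
    have e4 : h2' a = 1 := by simp [h2', hfa]
    have e5 : h1' b = u b := by simp [h1', hfb]
    have n2 : h2' b' ≠ 0 := fun h => by
      have := key h2' hh2 e2 h a ha
      rw [e4] at this; exact one_ne_zero this
    have k3 := key (h1' - (h1' b' / h2' b') • h2') (V.sub_mem hh1 (V.smul_mem _ hh2)) (by simp [e1, e2])
      (by simp [n2])
    have k4 := k3 a ha
    simp only [Pi.sub_apply, Pi.smul_apply, smul_eq_mul, e3, e4, mul_one, zero_sub, neg_eq_zero] at k4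
    have k5 := k3 b hb
    rw [k4] at k5
    simp only [Pi.sub_apply, Pi.smul_apply, smul_eq_mul, zero_mul, sub_zero, e5] at k5
    exact hub k5
end Comb

section LineStruct
variable {F L σ κ : Type} [Field F] [Field L] [Algebra F L] [Fintype σ] [DecidableEq σ] [Fintype κ] [DecidableEq κ]
  {blk : σ → κ}

theorem eval_ringHom_map (τ : L →+* L) (x : σ → L) (P : MvPolynomial σ L) :
    eval (fun s => τ (x s)) (map τ P) = τ (eval x P) := by
  rw [eval_map, ← coe_eval₂Hom, ← RingHom.comp_apply]
  congr 1
  ext <;> simp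

/-- multilinear functions on normalized points -/
def segreV (blk : σ → κ) (c : κ → σ) : Submodule L ({X : σ → L // ∀ i, X (c i) = 1} → L) where
  carrier := {f | ∃ P : MvPolynomial σ L, MH blk P 1 ∧ ∀ X, f X = eval X.1 P}
  add_mem' := by
    rintro f g ⟨P, hP, h1⟩ ⟨Q, hQ, h2⟩
    exact ⟨P + Q, hP.add hQ, fun X => by simp [h1, h2]⟩
  zero_mem' := ⟨0, MH.zero, by simp⟩
  smul_mem' := by
    rintro a f ⟨P, hP, h1⟩
    exact ⟨C a * P, hP.smul a, fun X => by simp [h1]⟩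

theorem MH.congr' {R : Type} [CommSemiring R] {f : MvPolynomial σ R} {w w' : κ → ℕ} (hf : MH blk f w) (h : w = w') :
    MH blk f w' := h ▸ hf

theorem segre_one (c : κ → σ) (hc : ∀ i, blk (c i) = i) : (1 : {X : σ → L // ∀ i, X (c i) = 1} → L) ∈ segreV blk c := by
  refine ⟨∏ i, X (c i), (MH.prod _ _ fun i _ => MH.X (c i)).congr' ?_, fun X => ?_⟩
  · ext j
    simp [hc, Finset.sum_apply, Pi.single_apply]
  · simp [X.2]

theorem segre_coord (c : κ → σ) (hc : ∀ i, blk (c i) = i) (s : σ) :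
    (fun X => X.1 s : {X : σ → L // ∀ i, X (c i) = 1} → L) ∈ segreV blk c := by
  refine ⟨X s * ∏ i ∈ Finset.univ.erase (blk s), X (c i),
    ((MH.X s).mul (MH.prod _ _ fun i _ => MH.X (c i))).congr' ?_, fun X => ?_⟩
  · have := Finset.add_sum_erase Finset.univ (fun i => (Pi.single (blk (c i)) 1 : κ → ℕ)) (Finset.mem_univ (blk s))
    simp only [hc] at this ⊢
    rw [this]
    ext j
    simp [Finset.sum_apply, Pi.single_apply]
  · simp [X.2]

theorem segre_coord2 (c : κ → σ) (hc : ∀ i, blk (c i) = i) (s t : σ) (hst : blk t ≠ blk s) :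
    (fun X => X.1 s * X.1 t : {X : σ → L // ∀ i, X (c i) = 1} → L) ∈ segreV blk c := by
  refine ⟨X s * (X t * ∏ i ∈ (Finset.univ.erase (blk s)).erase (blk t), X (c i)),
    ((MH.X s).mul ((MH.X t).mul (MH.prod _ _ fun i _ => MH.X (c i)))).congr' ?_, fun X => ?_⟩
  · have := Finset.add_sum_erase Finset.univ (fun i => (Pi.single (blk (c i)) 1 : κ → ℕ)) (Finset.mem_univ (blk s))
    have h2 := Finset.add_sum_erase (Finset.univ.erase (blk s)) (fun i => (Pi.single (blk (c i)) 1 : κ → ℕ))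
      (Finset.mem_erase.2 ⟨hst, Finset.mem_univ (blk t)⟩)
    simp only [hc] at this h2 ⊢
    rw [h2, this]
    ext j
    simp [Finset.sum_apply, Pi.single_apply]
  · simp [X.2]

theorem segre_list (c : κ → σ) (l : List ({X : σ → L // ∀ i, X (c i) = 1} → L)) (hl : ∀ f ∈ l, f ∈ segreV blk c) :
    ∃ P : MvPolynomial σ L, MH blk P (fun _ => l.length) ∧ ∀ X, l.prod X = eval X.1 P := by
  induction l with
  | nil => exact ⟨1, MH.one.congr' rfl, by simp⟩
  | cons f l ih =>
    obtain ⟨P, hP, h1⟩ := ih fun g hg => hl g (List.mem_cons_of_mem _ hg)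
    obtain ⟨Q, hQ, h2⟩ := hl f (List.mem_cons_self)
    refine ⟨Q * P, (hQ.mul hP).congr' ?_, fun X => by simp [h1, h2]⟩
    ext i; simp [add_comm]

theorem line_structure [IsGalois F L] (c : κ → σ) (hc : ∀ i, blk (c i) = i) (x : σ → L) (hx : ∀ i, x (c i) = 1)
    (p : ℕ) (hp : 1 ≤ p) (e : κ → ℕ) (he : ∀ i, p ≤ e i)
    (hCB : ∀ P : MvPolynomial σ L, MH blk P e →
        (∀ τ : L ≃ₐ[F] L, (fun s => τ (x s)) ≠ x → eval (fun s => τ (x s)) P = 0) → eval x P = 0)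
    (hfin : (Set.range fun τ : L ≃ₐ[F] L => (fun s => τ (x s))).Finite)
    (hcard : (Set.range fun τ : L ≃ₐ[F] L => (fun s => τ (x s))).ncard ≤ 2 * p + 1) :
    ∃ (a : σ) (C D : σ → F), D a = 1 ∧ C a = 0 ∧
      (∀ s, x s = algebraMap F L (C s) + x a * algebraMap F L (D s)) ∧ (∀ s, blk s ≠ blk a → D s = 0) ∧
      x a ∉ Set.range (algebraMap F L) := by
  classical
  let orb : (L ≃ₐ[F] L) → {X : σ → L // ∀ i, X (c i) = 1} := fun τ => ⟨fun s => τ (x s), fun i => by simp [hx]⟩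
  have himg : Subtype.val '' Set.range orb = Set.range fun τ : L ≃ₐ[F] L => (fun s => τ (x s)) := by
    rw [← Set.range_comp]; rfl
  have hfin' : (Set.range orb).Finite := Set.Finite.of_finite_image (by rw [himg]; exact hfin)
    Subtype.val_injective.injOn
  let S := hfin'.toFinset
  have hmS : ∀ τ, orb τ ∈ S := fun τ => by simp [S]
  have hSm : ∀ y ∈ S, ∃ τ, orb τ = y := fun y hy => by simpa [S] using hy
  have hScard : S.card ≤ 2 * p + 1 := by
    rw [← Set.ncard_eq_toFinset_card _ hfin', ← Set.ncard_image_of_injective _ Subtype.val_injective, himg]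
    exact hcard
  have hsep : ∀ a b : {X : σ → L // ∀ i, X (c i) = 1}, a ≠ b → ∃ f ∈ segreV blk c, f a = 0 ∧ f b ≠ 0 := by
    intro a b hab
    obtain ⟨s, hs⟩ := Function.ne_iff.1 (fun h => hab (Subtype.ext h))
    refine ⟨(fun X => X.1 s) - (a.1 s) • 1, Submodule.sub_mem _ (segre_coord c hc s)
      (Submodule.smul_mem _ _ (segre_one c hc)), by simp, ?_⟩
    simp only [Pi.sub_apply, Pi.smul_apply, Pi.one_apply, smul_eq_mul, mul_one]
    exact sub_ne_zero.2 (Ne.symm hs)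
  have hCBS : CBf (segreV blk c) p S := by
    intro l hl hlen a ha hb
    obtain ⟨P, hP, hPe⟩ := segre_list c l hl
    obtain ⟨τ0, rfl⟩ := hSm a ha
    let Q : MvPolynomial σ L := P * ∏ i, X (c i) ^ (e i - p)
    have hQ : MH blk Q e := by
      refine (hP.mul (MH.prod _ _ fun i _ => (MH.X (c i)).pow _)).congr' ?_
      ext j
      simp only [hc, hlen, Pi.add_apply, Finset.sum_apply, Pi.smul_apply, Pi.single_apply, smul_eq_mul]
      simp
      have := he j
      omega
    have hQe : ∀ X : {X : σ → L // ∀ i, X (c i) = 1}, eval X.1 Q = l.prod X := by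
      intro X
      simp [Q, X.2, hPe]
    have h3 := hCB (map (τ0.symm : L →+* L) Q) (hQ.map _) (fun τ hτ => by
      have h4 := eval_ringHom_map (τ0.symm : L →+* L) (orb (τ.trans τ0)).1 Q
      have h5 : (fun s => (τ0.symm : L →+* L) ((orb (τ.trans τ0)).1 s)) = fun s => τ (x s) := by
        ext s; simp [orb]
      rw [h5] at h4
      rw [h4, hQe, hb _ (hmS _), map_zero]
      intro h
      apply hτ
      ext s
      have := congrFun (congrArg Subtype.val h) s
      simp only [orb, AlgEquiv.trans_apply] at this
      exact τ0.injective this)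
    have h4 := eval_ringHom_map (τ0.symm : L →+* L) (orb τ0).1 Q
    have h5 : (fun s => (τ0.symm : L →+* L) ((orb τ0).1 s)) = x := by
      ext s; simp [orb]
    rw [h5, h3, hQe] at h4
    exact (map_eq_zero _).1 h4.symm
  have h1V := segre_one (L := L) c hc
  have hne : S.Nonempty := ⟨_, hmS AlgEquiv.refl⟩
  have hge := hCBS.card h1V hsep hne
  have hline := CBf.line h1V hsep p S hCBS hScard
  have hinj : ∀ s, (∃ y ∈ S, ∃ z ∈ S, y.1 s ≠ z.1 s) → ∀ y ∈ S, ∀ z ∈ S, y.1 s = z.1 s → y = z := by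
    rintro s ⟨y0, hy0, z0, hz0, hne0⟩ y hy z hz h
    by_contra hyz
    have := hline ((fun X => X.1 s) - (y.1 s) • 1) (Submodule.sub_mem _ (segre_coord c hc s)
      (Submodule.smul_mem _ _ h1V)) y z hy hz hyz (by simp) (by simp [h])
    have h1 := this y0 hy0
    have h2 := this z0 hz0
    simp only [Pi.sub_apply, Pi.smul_apply, Pi.one_apply, smul_eq_mul, mul_one, sub_eq_zero] at h1 h2
    exact hne0 (h1.trans h2.symm)
  obtain ⟨P0, hP0, Q0, hQ0, hPQ⟩ := Finset.one_lt_card.1 (show 1 < S.card by omega)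
  obtain ⟨a, ha⟩ := Function.ne_iff.1 (fun h => hPQ (Subtype.ext h))
  have hinja := hinj a ⟨P0, hP0, Q0, hQ0, ha⟩
  have hlin : ∀ s, ∀ y ∈ S, y.1 s = (P0.1 s - (P0.1 s - Q0.1 s) / (P0.1 a - Q0.1 a) * P0.1 a) +
      y.1 a * ((P0.1 s - Q0.1 s) / (P0.1 a - Q0.1 a)) := by
    intro s y hy
    have hd : P0.1 a - Q0.1 a ≠ 0 := sub_ne_zero.2 ha
    have := hline ((fun X => X.1 s) - ((P0.1 s - (P0.1 s - Q0.1 s) / (P0.1 a - Q0.1 a) * P0.1 a) • 1 +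
      ((P0.1 s - Q0.1 s) / (P0.1 a - Q0.1 a)) • (fun X => X.1 a)))
      (Submodule.sub_mem _ (segre_coord c hc s) (Submodule.add_mem _ (Submodule.smul_mem _ _ h1V)
        (Submodule.smul_mem _ _ (segre_coord c hc a)))) P0 Q0 hP0 hQ0 hPQ (by
          simp) (by
          simp only [Pi.sub_apply, Pi.smul_apply, Pi.one_apply, smul_eq_mul, mul_one, Pi.add_apply]
          field_simp
          ring) y hy
    simp only [Pi.sub_apply, Pi.smul_apply, Pi.one_apply, smul_eq_mul, mul_one, Pi.add_apply, sub_eq_zero] at this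
    rw [this]; ring
  have hcoef : ∀ s, ∃ C D : F, ∀ y ∈ S, y.1 s = algebraMap F L C + y.1 a * algebraMap F L D := by
    intro s
    obtain ⟨C, D, hCD⟩ : ∃ C D : L, ∀ y ∈ S, y.1 s = C + y.1 a * D := ⟨_, _, hlin s⟩
    have huniq : ∀ C' D' : L, (∀ y ∈ S, y.1 s = C' + y.1 a * D') → C' = C ∧ D' = D := by
      intro C' D' h
      have h1 := (h P0 hP0).symm.trans (hCD P0 hP0)
      have h2 := (h Q0 hQ0).symm.trans (hCD Q0 hQ0)
      have h3 : (P0.1 a - Q0.1 a) * (D' - D) = 0 := by linear_combination h1 - h2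
      have h4 : D' = D := sub_eq_zero.1 ((mul_eq_zero.1 h3).resolve_left (sub_ne_zero.2 ha))
      refine ⟨?_, h4⟩
      rw [h4] at h1
      exact add_right_cancel h1
    have hfix : ∀ τ : L ≃ₐ[F] L, τ C = C ∧ τ D = D := by
      intro τ
      refine huniq _ _ fun y hy => ?_
      obtain ⟨τ', rfl⟩ := hSm y hy
      have := hCD (orb (τ'.trans τ.symm)) (hmS _)
      have := congrArg τ this
      simpa [orb] using this
    obtain ⟨C', rfl⟩ := (InfiniteGalois.mem_range_algebraMap_iff_fixed C).2 fun τ => (hfix τ).1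
    obtain ⟨D', rfl⟩ := (InfiniteGalois.mem_range_algebraMap_iff_fixed D).2 fun τ => (hfix τ).2
    exact ⟨C', D', hCD⟩
  choose C D hCD using hcoef
  have hxS : orb AlgEquiv.refl ∈ S := hmS _
  have hinjF : Function.Injective (algebraMap F L) := (algebraMap F L).injective
  have hcan : ∀ s, ∀ C' D' : F, (∀ y ∈ S, y.1 s = algebraMap F L C' + y.1 a * algebraMap F L D') → C s = C' ∧ D s = D' := by
    intro s C' D' h
    have h1 := (h P0 hP0).symm.trans (hCD s P0 hP0)
    have h2 := (h Q0 hQ0).symm.trans (hCD s Q0 hQ0)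
    have h3 : (P0.1 a - Q0.1 a) * (algebraMap F L D' - algebraMap F L (D s)) = 0 := by linear_combination h1 - h2
    have h4 := sub_eq_zero.1 ((mul_eq_zero.1 h3).resolve_left (sub_ne_zero.2 ha))
    refine ⟨?_, (hinjF h4).symm⟩
    rw [h4] at h1
    exact (hinjF (add_right_cancel h1)).symm
  have hca := hcan a 0 1 (fun y hy => by simp)
  refine ⟨a, C, D, hca.2, hca.1, fun s => ?_, fun s hs => ?_, ?_⟩
  · simpa [orb] using hCD s _ hxS
  · by_contra hDs
    have hns : P0.1 s ≠ Q0.1 s := by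
      intro h
      have h1 := (hCD s P0 hP0)
      have h2 := (hCD s Q0 hQ0)
      have h3 : (P0.1 a - Q0.1 a) * (algebraMap F L (D s)) = 0 := by linear_combination h2 - h1 + h
      rcases mul_eq_zero.1 h3 with h4 | h4
      · exact ha (sub_eq_zero.1 h4)
      · exact hDs ((map_eq_zero _).1 h4)
    have hinjs := hinj s ⟨P0, hP0, Q0, hQ0, hns⟩
    obtain ⟨R0, hR0, hRP, hRQ⟩ : ∃ R0 ∈ S, R0 ≠ P0 ∧ R0 ≠ Q0 := by
      have : ((S.erase P0).erase Q0).Nonempty := by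
        rw [← Finset.card_pos, Finset.card_erase_of_mem (Finset.mem_erase.2 ⟨Ne.symm hPQ, hQ0⟩),
          Finset.card_erase_of_mem hP0]
        omega
      obtain ⟨R0, hR⟩ := this
      simp only [Finset.mem_erase] at hR
      exact ⟨R0, hR.2.2, hR.2.1, hR.1⟩
    have hfun : (fun X : {X : σ → L // ∀ i, X (c i) = 1} => (X.1 a - P0.1 a) * (X.1 s - Q0.1 s)) ∈ segreV blk c := by
      have := Submodule.add_mem _ (Submodule.sub_mem _ (Submodule.sub_mem _ (segre_coord2 (L := L) c hc a s hs)
        (Submodule.smul_mem _ (P0.1 a) (segre_coord c hc s))) (Submodule.smul_mem _ (Q0.1 s) (segre_coord c hc a)))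
        (Submodule.smul_mem _ (P0.1 a * Q0.1 s) h1V)
      convert this using 1
      ext X
      simp
      ring
    have := hline _ hfun P0 Q0 hP0 hQ0 hPQ (by simp) (by simp) R0 hR0
    rcases mul_eq_zero.1 this with h | h
    · exact hRP (hinja R0 hR0 P0 hP0 (sub_eq_zero.1 h))
    · exact hRQ (hinjs R0 hR0 Q0 hQ0 (sub_eq_zero.1 h))
  · rintro ⟨z, hz⟩
    apply ha
    obtain ⟨τ, rfl⟩ := hSm P0 hP0
    obtain ⟨τ', rfl⟩ := hSm Q0 hQ0
    simp only [orb]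
    rw [← hz, τ.commutes, τ'.commutes]
end LineStruct

/-! ### Part 15 -/

section Gen
variable {F L : Type} [Field F] [Field L] [Algebra F L] [CharZero F]

theorem pow_minpoly_dvd (r : L) (hr : IsIntegral F r) (c : ℕ) :
    ∀ J : Polynomial F, (Polynomial.X - Polynomial.C r) ^ c ∣ J.map (algebraMap F L) → minpoly F r ^ c ∣ J := by
  induction c with
  | zero => intro J _; simp
  | succ c ih =>
    intro J hJ
    have h0 : Polynomial.aeval r J = 0 := by
      have h1 : (Polynomial.X - Polynomial.C r) ∣ J.map (algebraMap F L) :=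
        (Dvd.intro_left _ (pow_succ _ c).symm).trans hJ
      rw [Polynomial.dvd_iff_isRoot, Polynomial.IsRoot, Polynomial.eval_map] at h1
      exact h1
    obtain ⟨J1, rfl⟩ := minpoly.dvd F r h0
    have hq : (Polynomial.X - Polynomial.C r) ∣ (minpoly F r).map (algebraMap F L) := by
      rw [Polynomial.dvd_iff_isRoot, Polynomial.IsRoot, Polynomial.eval_map]
      exact minpoly.aeval F r
    obtain ⟨q', hq'⟩ := hq
    have hsep : (minpoly F r).Separable := (minpoly.irreducible hr).separable
    have hq'r : q'.eval r ≠ 0 := by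
      intro h
      have h2 : Polynomial.aeval r (minpoly F r).derivative ≠ 0 := hsep.aeval_derivative_ne_zero (minpoly.aeval F r)
      apply h2
      have h3 : ((minpoly F r).map (algebraMap F L)).derivative.eval r = 0 := by
        rw [hq']
        simp [h]
      rw [Polynomial.derivative_map, Polynomial.eval_map] at h3
      exact h3
    have hcop : IsCoprime ((Polynomial.X - Polynomial.C r) ^ c) q' := by
      refine IsCoprime.pow_left ?_
      refine (Polynomial.irreducible_X_sub_C r).coprime_iff_not_dvd.2 ?_
      rw [Polynomial.dvd_iff_isRoot]
      exact hq'r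
    rw [Polynomial.map_mul, hq', pow_succ', mul_assoc] at hJ
    have h4 := (mul_dvd_mul_iff_left (Polynomial.X_sub_C_ne_zero r)).1 hJ
    have h5 := hcop.dvd_of_dvd_mul_left h4
    rw [pow_succ']
    exact mul_dvd_mul_left _ (ih J1 h5)

theorem sumExtend_inl' {ι V : Type} [AddCommGroup V] [Module L V] {v : ι → V} (hs : LinearIndependent L v) (i : ι) :
    Module.Basis.sumExtend hs (Sum.inl i) = v i := by
  rw [Module.Basis.sumExtend, Module.Basis.reindex_apply, Module.Basis.extend_apply_self]
  rfl

theorem det_dvd {σ : Type} [Fintype σ] [DecidableEq σ] (M : Matrix σ σ (Polynomial L)) (r : L) (c : ℕ)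
    (h : Module.finrank L (Submodule.span L (Set.range fun p s => (M p s).eval r)) + c ≤ Fintype.card σ) :
    (Polynomial.X - Polynomial.C r) ^ c ∣ M.det := by
  classical
  let N : Matrix σ σ L := Matrix.of fun p s => (M p s).eval r
  have hrank : N.rank = Module.finrank L (Submodule.span L (Set.range fun p s => (M p s).eval r)) := by
    rw [Matrix.rank_eq_finrank_span_row]; rfl
  have hker : c ≤ Module.finrank L (LinearMap.ker N.vecMulLinear) := by
    have h1 := LinearMap.finrank_range_add_finrank_ker N.vecMulLinear
    rw [Module.finrank_fintype_fun_eq_card] at h1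
    have h2 : Module.finrank L (LinearMap.range N.vecMulLinear) = N.rank := by
      rw [← Matrix.rank_transpose, Matrix.rank, Matrix.mulVecLin_transpose]
    omega
  -- independent vectors in the left kernel
  let bk := Module.finBasis L (LinearMap.ker N.vecMulLinear)
  have hli : LinearIndependent L (fun i => (bk i : σ → L)) :=
    bk.linearIndependent.map' (LinearMap.ker N.vecMulLinear).subtype (Submodule.ker_subtype _)
  let bb := Module.Basis.sumExtend hli
  have hfinI : Finite (Fin (Module.finrank L (LinearMap.ker N.vecMulLinear)) ⊕ Module.Basis.sumExtendIndex hli) :=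
    Module.Finite.finite_basis bb
  have := Fintype.ofFinite (Fin (Module.finrank L (LinearMap.ker N.vecMulLinear)) ⊕ Module.Basis.sumExtendIndex hli)
  have hcard := Module.finrank_eq_card_basis bb
  rw [Module.finrank_fintype_fun_eq_card] at hcard
  let q := Fintype.equivOfCardEq hcard
  let b2 := bb.reindex q.symm
  let Q : Matrix σ σ L := Matrix.of fun p => b2 p
  have hQ : Q.det ≠ 0 := by
    have h1 : LinearIndependent L (fun p => Q p) := b2.linearIndependent
    have := (Matrix.linearIndependent_rows_iff_isUnit).1 h1
    exact ((Matrix.isUnit_iff_isUnit_det _).1 this).ne_zero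
  let S : Finset σ := Finset.univ.map ⟨fun i : Fin (Module.finrank L (LinearMap.ker N.vecMulLinear)) => q.symm (Sum.inl i),
    fun i j h => by simpa using h⟩
  have hS : S.card = Module.finrank L (LinearMap.ker N.vecMulLinear) := by simp [S]
  have hrow : ∀ p ∈ S, ∀ s, (Polynomial.X - Polynomial.C r) ∣ ((Q.map Polynomial.C) * M) p s := by
    intro p hp s
    simp only [S, Finset.mem_map, Finset.mem_univ, true_and] at hp
    obtain ⟨i, rfl⟩ := hp
    rw [Polynomial.dvd_iff_isRoot, Polynomial.IsRoot, Matrix.mul_apply, Polynomial.eval_finsetSum]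
    have h1 : N.vecMulLinear (bk i) = 0 := (bk i).2
    have h2 := congrFun h1 s
    have h3 : ∀ t, Q (q.symm (Sum.inl i)) t = (bk i : σ → L) t := by
      intro t
      simp [Q, b2, bb, Matrix.of_apply, sumExtend_inl']
    simp only [Matrix.vecMulLinear_apply, Matrix.vecMul, dotProduct, Pi.zero_apply, N, Matrix.of_apply] at h2
    rw [← h2]
    refine Finset.sum_congr rfl fun t _ => ?_
    rw [Polynomial.eval_mul, Matrix.map_apply, Polynomial.eval_C]
    erw [h3]
  have hdet : (Polynomial.X - Polynomial.C r) ^ S.card ∣ ((Q.map Polynomial.C) * M).det := by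
    rw [← Matrix.det_transpose, Matrix.det_apply]
    refine Finset.dvd_sum fun π _ => ?_
    rw [Units.smul_def, zsmul_eq_mul]
    refine Dvd.dvd.mul_left ?_ _
    simp only [Matrix.transpose_apply]
    rw [← Finset.prod_sdiff (Finset.subset_univ S)]
    refine Dvd.dvd.mul_left ?_ _
    rw [← Finset.prod_const]
    exact Finset.prod_dvd_prod_of_dvd _ _ fun p hp => hrow p hp _
  have h6 : ((Q.map Polynomial.C) * M).det = Polynomial.C Q.det * M.det := by
    rw [Matrix.det_mul, RingHom.map_det]; rfl
  rw [h6] at hdet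
  have hu : IsUnit (Polynomial.C Q.det) := Polynomial.isUnit_C.2 hQ.isUnit
  rw [hu.dvd_mul_left] at hdet
  exact (pow_dvd_pow _ (by omega)).trans hdet

theorem det_degree {σ : Type} [Fintype σ] [DecidableEq σ] (M : Matrix σ σ (Polynomial F)) (B : Finset σ)
    (p1 p2 : σ) (hne : p1 ≠ p2) (h1 : ∀ s, s ∉ B → M p1 s = 0) (h2 : ∀ s, s ∉ B → M p2 s = 0)
    (hdeg : ∀ p s, (M p s).natDegree ≤ if s ∈ B then 1 else 0) (hd1 : ∀ s, (M p1 s).natDegree = 0)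
    (hd2 : ∀ s, (M p2 s).natDegree = 0) : M.det.natDegree ≤ B.card - 2 := by
  rw [Matrix.det_apply]
  refine Polynomial.natDegree_sum_le_of_forall_le _ _ fun π _ => ?_
  rw [Units.smul_def, zsmul_eq_mul]
  refine (Polynomial.natDegree_mul_le).trans ?_
  rw [Polynomial.natDegree_intCast, zero_add]
  by_cases hz : ∏ s, M (π s) s = 0
  · rw [hz]; simp
  have hz := Finset.prod_ne_zero_iff.1 hz
  have hs1 : π.symm p1 ∈ B := by
    by_contra h
    have := hz (π.symm p1) (Finset.mem_univ _)
    rw [Equiv.apply_symm_apply] at this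
    exact this (h1 _ h)
  have hs2 : π.symm p2 ∈ B := by
    by_contra h
    have := hz (π.symm p2) (Finset.mem_univ _)
    rw [Equiv.apply_symm_apply] at this
    exact this (h2 _ h)
  have hs12 : π.symm p1 ≠ π.symm p2 := fun h => hne (π.symm.injective h)
  refine (Polynomial.natDegree_prod_le _ _).trans ?_
  have hle : ∀ s ∈ Finset.univ, (M (π s) s).natDegree ≤ if s ∈ (B.erase (π.symm p1)).erase (π.symm p2) then 1 else 0 := by
    intro s _
    by_cases e1 : s = π.symm p1
    · rw [e1, Equiv.apply_symm_apply, hd1]; exact Nat.zero_le _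
    by_cases e2 : s = π.symm p2
    · rw [e2, Equiv.apply_symm_apply, hd2]; exact Nat.zero_le _
    have := hdeg (π s) s
    simpa [e1, e2] using this
  refine (Finset.sum_le_sum hle).trans ?_
  rw [Finset.sum_ite_mem, Finset.univ_inter, Finset.sum_const, smul_eq_mul, mul_one,
    Finset.card_erase_of_mem (Finset.mem_erase.2 ⟨Ne.symm hs12, hs2⟩), Finset.card_erase_of_mem hs1]
  omega

/-- restriction of a polynomial to a line -/
noncomputable def lineP {σ : Type} (P : MvPolynomial σ F) (C D : σ → F) : Polynomial F :=
  aeval (fun s => Polynomial.C (C s) + Polynomial.X * Polynomial.C (D s)) P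

theorem lineP_aeval {σ : Type} (P : MvPolynomial σ F) (C D : σ → F) (r : L) :
    Polynomial.aeval r (lineP P C D) =
      eval (fun s => algebraMap F L (C s) + r * algebraMap F L (D s)) (map (algebraMap F L) P) := by
  rw [lineP, eval_map, ← aeval_def]
  induction P using MvPolynomial.induction_on with
  | C a => simp
  | add p q hp hq => rw [map_add, map_add, map_add, hp, hq]
  | mul_X p s hp =>
    rw [map_mul, map_mul, map_mul, hp, aeval_X, aeval_X, map_add, map_mul, Polynomial.aeval_C, Polynomial.aeval_X,
      Polynomial.aeval_C]

theorem lineP_deriv {σ : Type} [Fintype σ] [DecidableEq σ] (P : MvPolynomial σ F) (C D : σ → F) :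
    Polynomial.derivative (lineP P C D) = ∑ s, lineP (pderiv s P) C D * Polynomial.C (D s) := by
  induction P using MvPolynomial.induction_on with
  | C a => simp [lineP]
  | add p q hp hq =>
    simp only [lineP, map_add] at hp hq ⊢
    rw [hp, hq, ← Finset.sum_add_distrib]
    exact Finset.sum_congr rfl fun s _ => by ring
  | mul_X p t hp =>
    simp only [lineP, map_mul, Derivation.leibniz, aeval_X, smul_eq_mul, map_add, Polynomial.derivative_mul] at hp ⊢
    rw [hp]
    simp only [add_mul, Finset.sum_add_distrib]
    rw [Finset.sum_eq_single (f := fun s => aeval (fun s => Polynomial.C (C s) + Polynomial.X * Polynomial.C (D s)) p *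
      aeval (fun s => Polynomial.C (C s) + Polynomial.X * Polynomial.C (D s)) (pderiv s (X t)) * Polynomial.C (D s)) t]
    · simp only [pderiv_X_self, map_one, mul_one, Polynomial.derivative_add, Polynomial.derivative_mul,
        Polynomial.derivative_C, Polynomial.derivative_X, zero_add, one_mul, mul_zero, add_zero]
      rw [add_comm]
      congr 1
      rw [Finset.sum_mul, ← Finset.sum_add_distrib]
      exact Finset.sum_congr rfl fun s _ => by ring
    · intro s _ hs
      rw [pderiv_X_of_ne hs.symm]
      simp
    · simp

theorem coeff_prod_top {ι : Type} (S : Finset ι) (f : ι → Polynomial F) (n : ι → ℕ)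
    (h : ∀ s ∈ S, (f s).natDegree ≤ n s) :
    (∏ s ∈ S, f s).natDegree ≤ ∑ s ∈ S, n s ∧ (∏ s ∈ S, f s).coeff (∑ s ∈ S, n s) = ∏ s ∈ S, (f s).coeff (n s) := by
  classical
  induction S using Finset.induction_on with
  | empty => simp
  | insert a S ha ih =>
    obtain ⟨ih1, ih2⟩ := ih fun s hs => h s (Finset.mem_insert_of_mem hs)
    have h1 := h a (Finset.mem_insert_self _ _)
    rw [Finset.prod_insert ha, Finset.sum_insert ha, Finset.prod_insert ha]
    exact ⟨Polynomial.natDegree_mul_le_of_le h1 ih1, by rw [Polynomial.coeff_mul_add_eq_of_natDegree_le h1 ih1, ih2]⟩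

theorem lineP_top {σ κ : Type} [Fintype σ] [DecidableEq κ] {blk : σ → κ} (P : MvPolynomial σ F) (d : κ → ℕ)
    (hP : MH blk P d) (C D : σ → F) (i : κ) (hD : ∀ s, blk s ≠ i → D s = 0) :
    (lineP P C D).natDegree ≤ d i ∧
      (lineP P C D).coeff (d i) = eval (fun s => if blk s = i then D s else C s) P := by
  classical
  have hmon : ∀ m ∈ P.support, (∏ s, (Polynomial.C (C s) + Polynomial.X * Polynomial.C (D s)) ^ m s).natDegree ≤ d i ∧
      (∏ s, (Polynomial.C (C s) + Polynomial.X * Polynomial.C (D s)) ^ m s).coeff (d i) =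
        ∏ s, (if blk s = i then D s else C s) ^ m s := by
    intro m hm
    have hlin : ∀ s, (Polynomial.C (C s) + Polynomial.X * Polynomial.C (D s)).natDegree ≤ 1 := fun s => by compute_degree
    have := coeff_prod_top Finset.univ (fun s => (Polynomial.C (C s) + Polynomial.X * Polynomial.C (D s)) ^ m s)
      (fun s => if blk s = i then m s else 0) (fun s _ => by
        split_ifs with h
        · refine (Polynomial.natDegree_pow_le).trans ?_
          have := Nat.mul_le_mul_left (m s) (hlin s)
          omega
        · rw [hD s h, Polynomial.C_0, mul_zero, add_zero, ← Polynomial.C_pow, Polynomial.natDegree_C])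
    rw [← Finset.sum_filter, hP m hm i] at this
    refine ⟨this.1, this.2.trans (Finset.prod_congr rfl fun s _ => ?_)⟩
    split_ifs with h
    · have h2 := Polynomial.coeff_pow_of_natDegree_le (m := m s) (hlin s)
      rw [mul_one] at h2
      rw [h2]; simp [Polynomial.coeff_C]
    · rw [hD s h, Polynomial.C_0, mul_zero, add_zero, ← Polynomial.C_pow, Polynomial.coeff_C_zero]
  have hexp : lineP P C D = ∑ m ∈ P.support, Polynomial.C (coeff m P) *
      ∏ s, (Polynomial.C (C s) + Polynomial.X * Polynomial.C (D s)) ^ m s := by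
    rw [lineP, aeval_def, eval₂_eq']; rfl
  rw [hexp]
  constructor
  · refine Polynomial.natDegree_sum_le_of_forall_le _ _ fun m hm => ?_
    exact (Polynomial.natDegree_C_mul_le _ _).trans (hmon m hm).1
  · rw [Polynomial.finset_sum_coeff, eval_eq']
    refine Finset.sum_congr rfl fun m hm => ?_
    rw [Polynomial.coeff_C_mul, (hmon m hm).2]

theorem natDegree_minpoly_le [IsGalois F L] {σ : Type} (x : σ → L) (a : σ)
    (hfin : (Set.range fun τ : L ≃ₐ[F] L => (fun s => τ (x s))).Finite) :
    (minpoly F (x a)).natDegree ≤ (Set.range fun τ : L ≃ₐ[F] L => (fun s => τ (x s))).ncard := by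
  have hIntg : IsIntegral F (x a) := Algebra.IsIntegral.isIntegral _
  have hsep : (minpoly F (x a)).Separable := (minpoly.irreducible hIntg).separable
  have hspl : ((minpoly F (x a)).map (algebraMap F L)).Splits := Normal.splits inferInstance (x a)
  have h1 := Polynomial.card_rootSet_eq_natDegree hsep hspl
  rw [← h1, ← Nat.card_eq_fintype_card, Nat.card_coe_set_eq]
  refine (Set.ncard_le_ncard (t := (fun y : σ → L => y a) '' (Set.range fun τ : L ≃ₐ[F] L => (fun s => τ (x s)))) ?_
    (hfin.image _)).trans (Set.ncard_image_le hfin)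
  intro z hz
  rw [Polynomial.mem_rootSet] at hz
  have hc : IsConjRoot F (x a) z := isConjRoot_of_aeval_eq_zero hIntg hz.2
  obtain ⟨τ, hτ⟩ := isConjRoot_iff_exists_algEquiv.1 hc.symm
  exact ⟨_, ⟨τ, rfl⟩, hτ⟩

end Gen

/-! ### Part 16 -/

section LA
variable {L E E' : Type} [Field L] [AddCommGroup E] [Module L E] [FiniteDimensional L E] [AddCommGroup E'] [Module L E']
  [FiniteDimensional L E']

theorem finrank_map_add_one_le (π : E →ₗ[L] E') (U : Submodule L E) (v : E) (hv : v ∈ U) (h0 : v ≠ 0) (hπ : π v = 0) :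
    Module.finrank L (U.map π) + 1 ≤ Module.finrank L U := by
  have h := LinearMap.finrank_range_add_finrank_ker (π.domRestrict U)
  rw [LinearMap.range_domRestrict] at h
  have : 0 < Module.finrank L (LinearMap.ker (π.domRestrict U)) := by
    rw [Module.finrank_pos_iff_exists_ne_zero]
    exact ⟨⟨⟨v, hv⟩, by simpa using hπ⟩, fun h => h0 (by simpa using h)⟩
  omega

theorem finrank_le_map_add (π : E →ₗ[L] E') (U W : Submodule L E) (h : ∀ v ∈ U, π v = 0 → v ∈ W) :
    Module.finrank L U ≤ Module.finrank L (U.map π) + Module.finrank L W := by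
  have h1 := LinearMap.finrank_range_add_finrank_ker (π.domRestrict U)
  rw [LinearMap.range_domRestrict] at h1
  have h2 : Module.finrank L (LinearMap.ker (π.domRestrict U)) ≤ Module.finrank L W := by
    have h3 : (LinearMap.ker (π.domRestrict U)).map U.subtype ≤ W := by
      rintro _ ⟨⟨v, hv⟩, hv2, rfl⟩
      exact h v hv (by simpa using hv2)
    have h4 := Submodule.finrank_mono h3
    rwa [Submodule.finrank_map_subtype_eq] at h4
  omega
end LA

namespace GS
variable {L : Type} [Field L] [CharZero L] {σ κ : Type} [Fintype σ] [DecidableEq σ] [Fintype κ] [DecidableEq κ]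
    {blk : σ → κ} {d : κ → ℕ} (G : GS L blk d) {J : Type} (yi : J → G.ιb)

theorem euler_mem (x : σ → L) (i : κ) : (fun s => if blk s = i then x s else 0) ∈ G.U yi x :=
  Submodule.subset_span ⟨.euler i, Or.inl ⟨i, rfl⟩, rfl⟩

theorem der_mem (x : σ → L) (j : J) : (fun s => G.Δ (yi j) (x s)) ∈ G.U yi x :=
  Submodule.subset_span ⟨.der j, Or.inr ⟨j, rfl⟩, rfl⟩

theorem U_le (x : σ → L) (W : Submodule L (σ → L)) (h1 : ∀ i, (fun s => if blk s = i then x s else 0) ∈ W)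
    (h2 : ∀ j, (fun s => G.Δ (yi j) (x s)) ∈ W) : G.U yi x ≤ W := by
  rw [U, Submodule.span_le]
  rintro _ ⟨r, (⟨i, rfl⟩ | ⟨j, rfl⟩), rfl⟩
  · exact h1 i
  · exact h2 j

theorem U_tangent (hdis : ∀ j a, yi j ≠ G.ca a) (hd : ∀ i, 0 < d i) (x : σ → L) (hgx : eval x G.g = 0) :
    G.U yi x ≤ LinearMap.ker (dotF (G.gr x)) :=
  G.U_le yi x _ (fun i => G.tangent yi hdis hd x hgx (.euler i)) (fun j => G.tangent yi hdis hd x hgx (.der j))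

theorem finrank_ker_dotF (l : σ → L) (hl : l ≠ 0) : Module.finrank L (LinearMap.ker (dotF l)) + 1 = Fintype.card σ := by
  have h := LinearMap.finrank_range_add_finrank_ker (dotF l)
  have h1 : Module.finrank L (LinearMap.range (dotF l)) = 1 := by
    rw [LinearMap.range_eq_top.2, finrank_top, Module.finrank_self]
    apply LinearMap.surjective
    intro h
    apply hl
    ext s
    have := LinearMap.congr_fun h (Pi.single s 1)
    rw [dotF_apply, Finset.sum_eq_single s] at this
    · simpa using this
    · intro s' _ h; rw [Pi.single_eq_of_ne h, mul_zero]
    · simp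
  rw [h1, Module.finrank_fintype_fun_eq_card] at h
  omega

theorem finrank_U_le (hdis : ∀ j a, yi j ≠ G.ca a) (hd : ∀ i, 0 < d i) (x : σ → L)
    (hx : ∀ i, ∃ s, blk s = i ∧ x s ≠ 0) (hgx : eval x G.g = 0) :
    Module.finrank L (G.U yi x) + 1 ≤ Fintype.card σ := by
  have h1 := Submodule.finrank_mono (G.U_tangent yi hdis hd x hgx)
  have h2 := finrank_ker_dotF (G.gr x) (G.smooth x hx hgx)
  omega

theorem finrank_U_ge (x : σ → L) (hx : ∀ i, ∃ s, blk s = i ∧ x s ≠ 0) (v : σ → L) (hv : v ∈ G.U yi x)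
    (q a : σ) (hqa : blk q = blk a) (hq : x q ≠ 0) (hvq : v q = 0) (hva : v a ≠ 0) :
    Fintype.card κ + 1 ≤ Module.finrank L (G.U yi x) := by
  have h : LinearIndependent L (fun i : Option κ => i.elim v (fun i s => if blk s = i then x s else 0)) := by
    rw [Fintype.linearIndependent_iff]
    intro c hc
    have hev : ∀ s, c none * v s + c (some (blk s)) * x s = 0 := by
      intro s
      have := congrFun hc s
      simpa [Fintype.sum_option] using this
    have h1 : c (some (blk q)) = 0 := by
      have := hev q
      rw [hvq, mul_zero, zero_add] at this
      exact (mul_eq_zero.1 this).resolve_right hq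
    have h2 : c none = 0 := by
      have := hev a
      rw [← hqa, h1, zero_mul, add_zero] at this
      exact (mul_eq_zero.1 this).resolve_right hva
    intro i
    cases i with
    | none => exact h2
    | some i =>
      obtain ⟨s, rfl, hs⟩ := hx i
      have := hev s
      rw [h2, zero_mul, zero_add] at this
      exact (mul_eq_zero.1 this).resolve_right hs
  have h3 := finrank_span_eq_card h
  rw [Fintype.card_option] at h3
  rw [← h3]
  apply Submodule.finrank_mono
  rw [Submodule.span_le]
  rintro _ ⟨i, rfl⟩
  cases i with
  | none => exact hv
  | some i => exact G.euler_mem yi x i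

/-- restriction to the other blocks -/
def pr (L : Type) [Field L] (blk : σ → κ) (i : κ) : (σ → L) →ₗ[L] ({s // blk s ≠ i} → L) := LinearMap.funLeft L L Subtype.val

theorem pr_apply (i : κ) (v : σ → L) (s) : pr L blk i v s = v s.1 := rfl

theorem U_map_eq (i : κ) (x x' : σ → L) (h : ∀ s, blk s ≠ i → x s = x' s) :
    (G.U yi x).map (pr L blk i) = (G.U yi x').map (pr L blk i) := by
  rw [U, U, Submodule.map_span, Submodule.map_span, ← Set.image_comp, ← Set.image_comp]
  congr 1
  refine Set.image_congr fun r hr => ?_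
  rcases hr with ⟨j, rfl⟩ | ⟨j, rfl⟩
  · ext s; simp only [Function.comp, pr_apply, V, h s.1 s.2]
  · ext s; simp only [Function.comp, pr_apply, V, h s.1 s.2]

theorem finrank_ker_pr (i : κ) : Module.finrank L (LinearMap.ker (pr L blk i)) = Fintype.card {s // blk s = i} := by
  have h := LinearMap.finrank_range_add_finrank_ker (pr L blk i)
  have hs : Function.Surjective (pr L blk i) := LinearMap.funLeft_surjective_of_injective _ _ _ Subtype.val_injective
  rw [LinearMap.range_eq_top.2 hs, finrank_top,
    Module.finrank_fintype_fun_eq_card, Module.finrank_fintype_fun_eq_card] at h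
  have := Fintype.card_subtype_compl (fun s => blk s = i)
  have h2 := Fintype.card_subtype_le (fun s => blk s = i)
  simp only [ne_eq] at h
  omega

theorem finrank_U_pr (i : κ) (x : σ → L) (hx : ∃ s, blk s = i ∧ x s ≠ 0) :
    Module.finrank L ((G.U yi x).map (pr L blk i)) + 1 ≤ Module.finrank L (G.U yi x) := by
  obtain ⟨s, rfl, hs⟩ := hx
  refine finrank_map_add_one_le _ _ _ (G.euler_mem yi x (blk s)) (fun h => hs ?_) ?_
  · simpa using congrFun h s
  · ext t; rw [pr_apply]; simp [t.2]

theorem finrank_U_pr_le (i : κ) (x : σ → L) :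
    Module.finrank L (G.U yi x) ≤ Module.finrank L ((G.U yi x).map (pr L blk i)) + Fintype.card {s // blk s = i} := by
  rw [← finrank_ker_pr (L := L)]
  exact finrank_le_map_add _ _ _ fun v _ h => h

theorem finrank_U_pr_lt (hdis : ∀ j a, yi j ≠ G.ca a) (hd : ∀ i, 0 < d i) (i : κ) (x : σ → L) (hgx : eval x G.g = 0)
    (D : σ → L) (hD : ∀ s, blk s ≠ i → D s = 0) (hgD : ∑ s, G.gr x s * D s ≠ 0) :
    Module.finrank L (G.U yi x) + 1 ≤ Module.finrank L ((G.U yi x).map (pr L blk i)) + Fintype.card {s // blk s = i} := by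
  have h1 := finrank_le_map_add (pr L blk i) (G.U yi x) (LinearMap.ker (pr L blk i) ⊓ LinearMap.ker (dotF (G.gr x)))
    fun v hv h => ⟨h, G.U_tangent yi hdis hd x hgx hv⟩
  have h2 : LinearMap.ker (pr L blk i) ⊓ LinearMap.ker (dotF (G.gr x)) < LinearMap.ker (pr L blk i) := by
    refine lt_of_le_of_ne inf_le_left fun h => ?_
    have hDm : D ∈ LinearMap.ker (pr L blk i) := by
      rw [LinearMap.mem_ker]; ext s; exact hD s.1 s.2
    rw [← h] at hDm
    exact hgD hDm.2
  have h3 := Submodule.finrank_lt_finrank_of_lt h2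
  rw [finrank_ker_pr] at h3
  omega
end GS

/-! ### Part 17 -/

namespace GS
variable {L : Type} [Field L] [CharZero L] {σ κ : Type} [Fintype σ] [DecidableEq σ] [Fintype κ] [DecidableEq κ]
    {blk : σ → κ} {d : κ → ℕ} (G : GS L blk d) {J : Type} (yi : J → G.ιb)

theorem sep_bound [IsAlgClosed L] [Fintype J] [DecidableEq J] (hyi : Function.Injective yi) (hdis : ∀ j a, yi j ≠ G.ca a) (hd : ∀ i, 0 < d i)
    (mm : κ → ℕ) (hmm : ∀ i, Fintype.card {s // blk s = i} = mm i + 1)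
    (x : σ → L) (q : κ → σ) (hq : ∀ i, blk (q i) = i) (hqK : ∀ i, x (q i) ∈ KK G.b yi) (hq0 : ∀ i, x (q i) ≠ 0)
    (a : σ) (r : L) (hr : x a = r * x (q (blk a)))
    (hdet : ∀ τ : L ≃ₐ[KK G.b yi] L, τ r = r → ∀ s, τ (x s) = x s)
    (hgx : eval x G.g = 0) (c : ℕ) (h1 : Fintype.card κ + 1 ≤ Module.finrank L (G.U yi x))
    (h2 : Fintype.card σ ≤ Module.finrank L (G.U yi x) + c + 1) (hc : ∀ j, mm j + 1 + c ≤ d j) :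
    d (blk a) + 1 ≤ (minpoly (KK G.b yi) r).natDegree + mm (blk a) + c := by
  classical
  by_contra hcon
  push Not at hcon
  have hx : ∀ i, ∃ s, blk s = i ∧ x s ≠ 0 := fun i => ⟨q i, hq i, hq0 i⟩
  have h3 := G.finrank_U_le yi hdis hd x hx hgx
  obtain ⟨s, hs⟩ : ∃ s, Module.finrank L (G.U yi x) = Fintype.card κ + s := ⟨_, (Nat.add_sub_cancel' (by omega)).symm⟩
  obtain ⟨c0, hc0⟩ : ∃ c0, Fintype.card κ + s + c0 + 1 = Fintype.card σ := ⟨Fintype.card σ - (Fintype.card κ + s + 1), by omega⟩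
  obtain ⟨w, hw, hCB⟩ := G.CBmain yi hyi hdis hd x hx hgx s c0 (by omega) hs hc0
  have hwj : ∀ j, w j ≤ c := fun j => by
    have := Finset.single_le_sum (f := w) (fun _ _ => Nat.zero_le _) (Finset.mem_univ j)
    omega
  set K := KK G.b yi
  have hgal : IsGalois K L := isGalois_KK G.b yi G.hb
  have hIntg : IsIntegral K r := Algebra.IsIntegral.isIntegral _
  have hsep : (minpoly K r).Separable := (minpoly.irreducible hIntg).separable
  have hspl : ((minpoly K r).map (algebraMap K L)).Splits := Normal.splits inferInstance r
  have hcardroot := Polynomial.card_rootSet_eq_natDegree hsep hspl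
  set R : Finset L := ((minpoly K r).rootSet L).toFinset with hR
  have hRcard : R.card = (minpoly K r).natDegree := by rw [hR, Set.toFinset_card, ← hcardroot]
  have hmemR : ∀ z, z ∈ R ↔ Polynomial.aeval z (minpoly K r) = 0 := by
    intro z
    rw [hR, Set.mem_toFinset, Polynomial.mem_rootSet]
    exact ⟨fun h => h.2, fun h => ⟨minpoly.ne_zero hIntg, h⟩⟩
  have hrR : r ∈ R := (hmemR r).2 (minpoly.aeval _ _)
  set i := blk a
  set N := (minpoly K r).natDegree
  have hN1 : (R.erase r).card = N - 1 := by rw [Finset.card_erase_of_mem hrR, hRcard]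
  have hNpos : 0 < N := minpoly.natDegree_pos hIntg
  have hfix : ∀ (τ : L ≃ₐ[K] L) j, τ (x (q j)) = x (q j) := fun τ j =>
    τ.commutes (⟨x (q j), hqK j⟩ : K)
  set e : κ → ℕ := fun j => d j - (mm j + 1) - w j
  set e' : κ → ℕ := fun j => e j - if j = i then N - 1 else 0
  have he : ∀ j, e j + (mm j + 1) + w j = d j := fun j => by
    have := hc j; have := hwj j; simp only [e]; omega
  have hee : ∀ j, e' j + (if j = i then N - 1 else 0) = e j := fun j => by
    have := he j; have := hwj j; simp only [e']
    split_ifs with h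
    · subst h; omega
    · omega
  set P : MvPolynomial σ L := (∏ z ∈ R.erase r, (X a - C z * X (q i))) * ∏ j, X (q j) ^ e' j
  have hP : MH blk P e := by
    have hA : MH blk (∏ z ∈ R.erase r, (X a - C z * X (q i) : MvPolynomial σ L)) (∑ z ∈ R.erase r, Pi.single i 1) := by
      refine MH.prod _ _ fun z _ => ?_
      rw [sub_eq_add_neg]
      refine (MH.X a).add (MH.neg (MH.smul ?_ z))
      have := MH.X (R := L) (blk := blk) (q i)
      rwa [hq] at this
    have hB : MH blk (∏ j, (X (q j) : MvPolynomial σ L) ^ e' j) (∑ j, e' j • Pi.single (blk (q j)) 1) :=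
      MH.prod _ _ fun j _ => (MH.X (q j)).pow _
    have := hA.mul hB
    convert this using 1
    ext j
    rw [← hee j, Pi.add_apply, Finset.sum_const, hN1, Finset.sum_apply, Finset.sum_eq_single j]
    · simp [hq, Pi.single_apply]; split_ifs <;> omega
    · intro l _ hl; simp [hq, Pi.single_apply, Ne.symm hl]
    · simp
  have hev : ∀ z : σ → L, eval z P = (∏ t ∈ R.erase r, (z a - t * z (q i))) * ∏ j, z (q j) ^ e' j := by
    intro z; simp [P, map_prod]
  have := hCB e (fun j => by rw [hmm]; exact he j) P hP ?_
  · rw [hev] at this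
    rcases mul_eq_zero.1 this with h | h
    · obtain ⟨t, ht, ht2⟩ := Finset.prod_eq_zero_iff.1 h
      rw [hr, ← sub_mul] at ht2
      rcases mul_eq_zero.1 ht2 with h | h
      · exact (Finset.mem_erase.1 ht).1 (sub_eq_zero.1 h).symm
      · exact hq0 _ h
    · obtain ⟨j, _, hj⟩ := Finset.prod_eq_zero_iff.1 h
      exact pow_ne_zero _ (hq0 j) hj
  · intro τ hτ
    rw [hev, Finset.prod_eq_zero (i := τ r), zero_mul]
    · refine Finset.mem_erase.2 ⟨fun h => hτ (funext (hdet τ h)), (hmemR _).2 ?_⟩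
      rw [show Polynomial.aeval (τ r) (minpoly K r) = τ (Polynomial.aeval r (minpoly K r)) from
        (Polynomial.aeval_algHom_apply τ.toAlgHom r _), minpoly.aeval, map_zero]
    · rw [hr, map_mul, sub_self]

/-- the form over K -/
noncomputable def gK : MvPolynomial σ (KK G.b yi) := ∑ a, monomial (G.α a) ⟨G.b (G.ca a), b_mem_KK G.b yi _⟩

theorem map_gK : map (algebraMap (KK G.b yi) L) (G.gK yi) = G.g := by
  simp only [gK, g, map_sum, map_monomial]; rfl

theorem MH_gK : MH blk (G.gK yi) d := by
  refine MH.sum _ _ fun a _ => ?_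
  intro m hm i
  have := support_monomial_subset hm
  rw [Finset.mem_singleton] at this
  rw [this]; exact G.hαd a i

/-- points on a line -/
noncomputable def lpt (C D : σ → KK G.b yi) (r : L) (s : σ) : L := (C s : L) + r * (D s : L)

theorem eval_lpt (C D : σ → KK G.b yi) (r : L) :
    eval (G.lpt yi C D r) G.g = Polynomial.aeval r (lineP (G.gK yi) C D) := by
  rw [lineP_aeval, map_gK]; rfl

theorem gr_lpt (C D : σ → KK G.b yi) (r : L) : ∑ s, G.gr (G.lpt yi C D r) s * (D s : L) =
    Polynomial.aeval r (Polynomial.derivative (lineP (G.gK yi) C D)) := by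
  rw [lineP_deriv, map_sum]
  refine Finset.sum_congr rfl fun s _ => ?_
  rw [map_mul, lineP_aeval, Polynomial.aeval_C, ← pderiv_map, map_gK]; rfl

theorem lpt_det (C D : σ → KK G.b yi) (r : L) (τ : L ≃ₐ[KK G.b yi] L) (h : τ r = r) (s : σ) :
    τ (G.lpt yi C D r s) = G.lpt yi C D r s := by
  simp only [lpt, map_add, map_mul, h]
  rw [show τ (C s : L) = C s from τ.commutes (C s), show τ (D s : L) = D s from τ.commutes (D s)]

theorem natDegree_minpoly_le_of_root (K : IntermediateField ℚ L) (r : L) (H : Polynomial K) (hH : H ≠ 0) (hr : Polynomial.aeval r H = 0) :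
    (minpoly K r).natDegree ≤ H.natDegree :=
  Polynomial.natDegree_le_of_dvd (minpoly.dvd _ _ hr) hH
end GS

/-! ### Part 18 -/

namespace GS
variable {L : Type} [Field L] [CharZero L] {σ κ : Type} [Fintype σ] [DecidableEq σ] [Fintype κ] [DecidableEq κ]
    {blk : σ → κ} {d : κ → ℕ} (G : GS L blk d) {J : Type} [Fintype J] [DecidableEq J] (yi : J → G.ιb)

theorem Δ_KK (hyi : Function.Injective yi) (j : J) (x : KK G.b yi) : G.Δ (yi j) (x : L) ∈ KK G.b yi := by
  refine derivation_KK_mem G.b yi (G.Δ (yi j)) ?_ ?_ x.2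
  · intro l hl
    exact G.hΔ0 _ _ fun h => hl ⟨j, h⟩
  · intro l
    by_cases h : l = j
    · subst h; rw [G.hΔ1]; exact (KK G.b yi).one_mem
    · rw [G.hΔ0 _ _ (fun h2 => h (hyi h2).symm)]; exact (KK G.b yi).zero_mem

/-- derivative on K -/
noncomputable def ΔK (hyi : Function.Injective yi) (j : J) (x : KK G.b yi) : KK G.b yi := ⟨_, G.Δ_KK yi hyi j x⟩

theorem ΔK_zero (hyi : Function.Injective yi) (j : J) : G.ΔK yi hyi j 0 = 0 := by
  apply Subtype.ext; change G.Δ (yi j) 0 = 0; simp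

open Polynomial in
/-- The rows along a line. -/
noncomputable def rowsP (hyi : Function.Injective yi) (C D : σ → KK G.b yi) : Option κ ⊕ J → σ → Polynomial (KK G.b yi)
  | .inl (some j) => fun s => if blk s = j then Polynomial.C (C s) else 0
  | .inl none => fun s => Polynomial.C (D s)
  | .inr j => fun s => Polynomial.C (G.ΔK yi hyi j (C s)) + Polynomial.X * Polynomial.C (G.ΔK yi hyi j (D s))

/-- The rows evaluated. -/
noncomputable def rowsV (hyi : Function.Injective yi) (C D : σ → KK G.b yi) (r : L) (p : Option κ ⊕ J) (s : σ) : L :=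
  Polynomial.aeval r (G.rowsP yi hyi C D p s)

theorem rowsV_some (hyi : Function.Injective yi) (C D : σ → KK G.b yi) (r : L) (j : κ) :
    G.rowsV yi hyi C D r (.inl (some j)) = fun s => if blk s = j then (C s : L) else 0 := by
  ext s
  simp only [rowsV, rowsP]
  split_ifs
  · rw [Polynomial.aeval_C]; rfl
  · simp

theorem rowsV_none (hyi : Function.Injective yi) (C D : σ → KK G.b yi) (r : L) :
    G.rowsV yi hyi C D r (.inl none) = fun s => (D s : L) := by
  ext s
  simp only [rowsV, rowsP]
  rw [Polynomial.aeval_C]; rfl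

theorem rowsV_inr (hyi : Function.Injective yi) (C D : σ → KK G.b yi) (r : L) (j : J) :
    G.rowsV yi hyi C D r (.inr j) = fun s => G.Δ (yi j) (C s : L) + r * G.Δ (yi j) (D s : L) := by
  ext s
  simp only [rowsV, rowsP]
  rw [map_add, map_mul, Polynomial.aeval_C, Polynomial.aeval_C, Polynomial.aeval_X]; rfl

theorem euler_lpt (hyi : Function.Injective yi) (C D : σ → KK G.b yi) (r : L) (i j : κ) (hD : ∀ s, blk s ≠ i → D s = 0) :
    (fun s => if blk s = j then G.lpt yi C D r s else 0) =
      G.rowsV yi hyi C D r (.inl (some j)) + (if j = i then r else 0) • G.rowsV yi hyi C D r (.inl none) := by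
  rw [rowsV_some, rowsV_none]
  ext s
  simp only [lpt, Pi.add_apply, Pi.smul_apply, smul_eq_mul]
  by_cases h : blk s = j
  · rw [if_pos h, if_pos h]
    by_cases h2 : j = i
    · rw [if_pos h2]
    · rw [if_neg h2, hD s (fun h3 => h2 (h ▸ h3))]; simp
  · rw [if_neg h, if_neg h]
    by_cases h2 : j = i
    · rw [hD s (fun h3 => h (h3.trans h2.symm))]; simp
    · rw [if_neg h2]; simp

theorem der_lpt (hyi : Function.Injective yi) (C D : σ → KK G.b yi) (r : L) (j : J) :
    (fun s => G.Δ (yi j) (G.lpt yi C D r s)) =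
      G.rowsV yi hyi C D r (.inr j) + G.Δ (yi j) r • G.rowsV yi hyi C D r (.inl none) := by
  rw [rowsV_inr, rowsV_none]
  ext s
  simp only [lpt, Pi.add_apply, Pi.smul_apply, smul_eq_mul, map_add, Derivation.leibniz]
  ring

theorem rows_span_top (hyi : Function.Injective yi) (hdis : ∀ j a, yi j ≠ G.ca a) (hd : ∀ i, 0 < d i)
    (C D : σ → KK G.b yi) (u : L) (i : κ) (hD : ∀ s, blk s ≠ i → D s = 0)
    (hg : eval (G.lpt yi C D u) G.g = 0) (hU : Module.finrank L (G.U yi (G.lpt yi C D u)) + 1 = Fintype.card σ)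
    (hgD : ∑ s, G.gr (G.lpt yi C D u) s * (D s : L) ≠ 0) :
    Submodule.span L (Set.range (G.rowsV yi hyi C D u)) = ⊤ := by
  have hm : ∀ p, G.rowsV yi hyi C D u p ∈ Submodule.span L (Set.range (G.rowsV yi hyi C D u)) := fun p =>
    Submodule.subset_span ⟨p, rfl⟩
  have h1 : G.U yi (G.lpt yi C D u) ≤ Submodule.span L (Set.range (G.rowsV yi hyi C D u)) := by
    refine G.U_le yi _ _ (fun j => ?_) (fun j => ?_)
    · rw [G.euler_lpt yi hyi C D u i j hD]
      exact add_mem (hm _) (Submodule.smul_mem _ _ (hm _))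
    · rw [G.der_lpt yi hyi]
      exact add_mem (hm _) (Submodule.smul_mem _ _ (hm _))
  apply Submodule.eq_top_of_finrank_eq
  rw [Module.finrank_fintype_fun_eq_card]
  have h2 : G.U yi (G.lpt yi C D u) < Submodule.span L (Set.range (G.rowsV yi hyi C D u)) := by
    refine lt_of_le_of_ne h1 fun h => ?_
    have h3 := hm (.inl none)
    rw [← h] at h3
    have h4 := G.U_tangent yi hdis hd _ hg h3
    rw [rowsV_none] at h4
    exact hgD h4
  have h3 := Submodule.finrank_lt_finrank_of_lt h2
  have h4 := Submodule.finrank_le (Submodule.span L (Set.range (G.rowsV yi hyi C D u)))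
  rw [Module.finrank_fintype_fun_eq_card] at h4
  omega

theorem rows_span_le (hyi : Function.Injective yi) (C D : σ → KK G.b yi) (r : L) (i : κ) (hD : ∀ s, blk s ≠ i → D s = 0) :
    Module.finrank L (Submodule.span L (Set.range (G.rowsV yi hyi C D r))) ≤
      Module.finrank L (G.U yi (G.lpt yi C D r)) + 1 := by
  set W := G.U yi (G.lpt yi C D r) ⊔ Submodule.span L {G.rowsV yi hyi C D r (.inl none)}
  have hN : G.rowsV yi hyi C D r (.inl none) ∈ W := Submodule.mem_sup_right (Submodule.mem_span_singleton_self _)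
  have h1 : Submodule.span L (Set.range (G.rowsV yi hyi C D r)) ≤ W := by
    rw [Submodule.span_le]
    rintro _ ⟨(_ | j) | j, rfl⟩
    · exact hN
    · have h := G.euler_lpt yi hyi C D r i j hD
      rw [← sub_eq_iff_eq_add] at h
      rw [SetLike.mem_coe, ← h]
      exact sub_mem (Submodule.mem_sup_left (G.euler_mem yi _ j)) (Submodule.smul_mem _ _ hN)
    · have h := G.der_lpt yi hyi C D r j
      rw [← sub_eq_iff_eq_add] at h
      rw [SetLike.mem_coe, ← h]
      exact sub_mem (Submodule.mem_sup_left (G.der_mem yi _ j)) (Submodule.smul_mem _ _ hN)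
  refine (Submodule.finrank_mono h1).trans ((Submodule.finrank_add_le_finrank_add_finrank _ _).trans ?_)
  have := finrank_span_le_card (R := L) ({G.rowsV yi hyi C D r (.inl none)} : Set (σ → L))
  simp at this
  omega

theorem jac_bound [IsAlgClosed L] (hyi : Function.Injective yi) (hdis : ∀ j a, yi j ≠ G.ca a) (hd : ∀ i, 0 < d i)
    (mm : κ → ℕ) (hmm : ∀ i, Fintype.card {s // blk s = i} = mm i + 1)
    (C D : σ → KK G.b yi) (u : L) (a q : σ) (hqa : blk q = blk a) (hD : ∀ s, blk s ≠ blk a → D s = 0)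
    (hCa : C a = 0) (hDa : D a = 1) (hCq : C q = 1) (hDq : D q = 0)
    (hg : eval (G.lpt yi C D u) G.g = 0) (hU : Module.finrank L (G.U yi (G.lpt yi C D u)) + 1 = Fintype.card σ)
    (hgD : ∑ s, G.gr (G.lpt yi C D u) s * (D s : L) ≠ 0) (r : L) (c : ℕ)
    (hc : Module.finrank L (G.U yi (G.lpt yi C D r)) + 1 + c ≤ Fintype.card σ) :
    c * (minpoly (KK G.b yi) r).natDegree ≤ mm (blk a) - 1 := by
  classical
  set R := G.rowsV yi hyi C D
  have hgal : IsGalois (KK G.b yi) L := isGalois_KK G.b yi G.hb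
  have hIntg : IsIntegral (KK G.b yi) r := Algebra.IsIntegral.isIntegral _
  set S0 : Set (Option κ ⊕ J) := {.inl (some (blk a)), .inl none} with hS0
  have hli0 : LinearIndepOn L (R u) S0 := by
    rw [hS0, LinearIndepOn.pair_iff _ (by simp)]
    intro α β h
    simp only [R, rowsV_some, rowsV_none] at h
    have h1 := congrFun h q
    have h2 := congrFun h a
    simp [hqa, hCa, hDa, hCq, hDq] at h1 h2
    exact ⟨h1, h2⟩
  obtain ⟨B, hBt, hSB, hspan, hli⟩ := exists_linearIndepOn_extension hli0 (Set.subset_univ S0)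
  have hli' : LinearIndependent L (fun p : B => R u p) := hli
  have hfB : Fintype B := Fintype.ofFinite _
  have hspB : Submodule.span L (Set.range fun p : B => R u p) = ⊤ := by
    rw [eq_top_iff, ← G.rows_span_top yi hyi hdis hd C D u (blk a) hD hg hU hgD, Submodule.span_le,
      ← Set.image_univ]
    refine hspan.trans ?_
    rw [Set.image_eq_range]
  have hcB : Fintype.card σ = Fintype.card B := by
    have := finrank_span_eq_card hli'
    rw [hspB, finrank_top, Module.finrank_fintype_fun_eq_card] at this
    exact this
  let e : σ ≃ B := Fintype.equivOfCardEq hcB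
  let M : Matrix σ σ (Polynomial (KK G.b yi)) := Matrix.of fun p s => G.rowsP yi hyi C D (e p) s
  have hM : ∀ t : L, ∀ p s, Polynomial.eval t ((M p s).map (algebraMap (KK G.b yi) L)) = R t (e p) s := by
    intro t p s; rw [Polynomial.eval_map_algebraMap]; rfl
  have hdet : ∀ t, Polynomial.aeval t M.det = (Matrix.of fun p s => R t (e p) s).det := by
    intro t
    rw [AlgHom.map_det]; rfl
  have hJ0 : M.det ≠ 0 := by
    intro h
    have h1 := hdet u
    rw [h, map_zero] at h1
    have h2 : LinearIndependent L (Matrix.of fun p s => R u (e p) s).row := hli'.comp e e.injective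
    rw [Matrix.linearIndependent_rows_iff_isUnit, Matrix.isUnit_iff_isUnit_det, ← h1] at h2
    exact not_isUnit_zero h2
  have hdeg : M.det.natDegree ≤ mm (blk a) - 1 := by
    have h1 := det_degree M (Finset.univ.filter fun s => blk s = blk a) (e.symm ⟨.inl (some (blk a)), hSB (by simp [hS0])⟩)
      (e.symm ⟨.inl none, hSB (by simp [hS0])⟩) (fun h => by
        have := e.symm.injective h; simp at this) ?_ ?_ ?_ ?_ ?_
    · have h2 := hmm (blk a)
      rw [Fintype.card_subtype] at h2
      omega
    · intro s hs
      simp [M, rowsP] at hs ⊢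
      exact fun h => absurd h hs
    · intro s hs
      simp [M, rowsP] at hs ⊢
      exact hD s hs
    · intro p s
      simp only [M, Matrix.of_apply, Finset.mem_filter, Finset.mem_univ, true_and]
      rcases (e p : Option κ ⊕ J) with (_ | j) | j
      · simp [rowsP]
      · simp only [rowsP]; split_ifs <;> simp
      · simp only [rowsP]
        split_ifs with h
        · compute_degree
        · rw [hD s h, ΔK_zero]; simp
    · intro s
      simp only [M, Matrix.of_apply, Equiv.apply_symm_apply, rowsP]
      split_ifs <;> simp
    · intro s
      simp only [M, Matrix.of_apply, Equiv.apply_symm_apply, rowsP, Polynomial.natDegree_C]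
  have hdvd : (Polynomial.X - Polynomial.C r) ^ c ∣ M.det.map (algebraMap (KK G.b yi) L) := by
    have h1 : M.det.map (algebraMap (KK G.b yi) L) = ((Polynomial.mapRingHom (algebraMap (KK G.b yi) L)).mapMatrix M).det := by
      rw [← RingHom.map_det]; rfl
    rw [h1]
    apply det_dvd
    have h2 : Module.finrank L (Submodule.span L (Set.range fun p s =>
        Polynomial.eval r ((Polynomial.mapRingHom (algebraMap (KK G.b yi) L)).mapMatrix M p s))) ≤
        Module.finrank L (Submodule.span L (Set.range (R r))) := by
      apply Submodule.finrank_mono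
      apply Submodule.span_mono
      rintro _ ⟨p, rfl⟩
      exact ⟨e p, funext fun s => (hM r p s).symm⟩
    have h3 : Module.finrank L (Submodule.span L (Set.range (R r))) ≤ _ := G.rows_span_le yi hyi C D r (blk a) hD
    omega
  have h4 := pow_minpoly_dvd r hIntg c _ hdvd
  have h5 := Polynomial.natDegree_le_of_dvd h4 hJ0
  rw [Polynomial.natDegree_pow] at h5
  omega
end GS

/-! ### Part 19 -/

namespace GS
variable {L : Type} [Field L] [CharZero L] {σ κ : Type} [Fintype σ] [DecidableEq σ] [Fintype κ] [DecidableEq κ]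
    {blk : σ → κ} {d : κ → ℕ} (G : GS L blk d) {J : Type} [Fintype J] [DecidableEq J] (yi : J → G.ιb)

theorem line_contra [IsAlgClosed L] (hyi : Function.Injective yi) (hdis : ∀ j a, yi j ≠ G.ca a)
    (mm : κ → ℕ) (hmm : ∀ i, Fintype.card {s // blk s = i} = mm i + 1) (hm1 : ∀ i, 1 ≤ mm i)
    (hpm : ∀ i j, mm i + mm j + 1 ≤ d i) (T : ℕ) (hT : Fintype.card σ = T + Fintype.card κ) (j0 : J)
    (C D : σ → KK G.b yi) (u : L) (a : σ) (hTi : mm (blk a) + 1 ≤ T) (q : κ → σ) (hq : ∀ j, blk (q j) = j)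
    (hD : ∀ s, blk s ≠ blk a → D s = 0)
    (hCa : C a = 0) (hDa : D a = 1) (hCq : ∀ j, C (q j) = 1) (hDq : ∀ j, D (q j) = 0)
    (hg : eval (G.lpt yi C D u) G.g = 0) (hU : Module.finrank L (G.U yi (G.lpt yi C D u)) + 1 = Fintype.card σ)
    (hN : (minpoly (KK G.b yi) u).natDegree < d (blk a)) : False := by
  classical
  have hd : ∀ i, 0 < d i := fun i => by have := hpm i i; omega
  set i := blk a with hi
  have hgal : IsGalois (KK G.b yi) L := isGalois_KK G.b yi G.hb
  have hIntg : ∀ r : L, IsIntegral (KK G.b yi) r := fun r => Algebra.IsIntegral.isIntegral _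
  have hlq : ∀ r j, G.lpt yi C D r (q j) = 1 := fun r j => by simp [lpt, hCq, hDq]
  have hla : ∀ r, G.lpt yi C D r a = r := fun r => by simp [lpt, hCa, hDa]
  have hlx : ∀ r j, ∃ s, blk s = j ∧ G.lpt yi C D r s ≠ 0 := fun r j => ⟨q j, hq j, by rw [hlq]; exact one_ne_zero⟩
  have hloff : ∀ r s, blk s ≠ i → G.lpt yi C D r s = C s := fun r s hs => by simp [lpt, hD s hs]
  -- bound for points on the line
  have hline : ∀ (r : L) (c : ℕ), eval (G.lpt yi C D r) G.g = 0 → Fintype.card κ + 1 ≤ Module.finrank L (G.U yi (G.lpt yi C D r)) →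
      Fintype.card σ ≤ Module.finrank L (G.U yi (G.lpt yi C D r)) + c + 1 → c ≤ mm i →
      d i + 1 ≤ (minpoly (KK G.b yi) r).natDegree + mm i + c := by
    intro r c h0 h1 h2 hc
    refine G.sep_bound yi hyi hdis hd mm hmm (G.lpt yi C D r) q hq (fun j => ?_) (fun j => ?_) a r ?_
      (G.lpt_det yi C D r) h0 c h1 h2 (fun j => ?_)
    · rw [hlq]; exact one_mem _
    · rw [hlq]; exact one_ne_zero
    · rw [hla, hlq, mul_one]
    · have := hpm j i; omega
  set z := Module.finrank L ((G.U yi (G.lpt yi C D u)).map (pr L blk i)) with hz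
  have hmapx : ∀ x : σ → L, (∀ s, blk s ≠ i → x s = C s) → (∃ s, blk s = i ∧ x s ≠ 0) → z + 1 ≤ Module.finrank L (G.U yi x) := by
    intro x hx hx2
    rw [hz, G.U_map_eq yi i (G.lpt yi C D u) x (fun s hs => by rw [hloff u s hs, hx s hs])]
    exact G.finrank_U_pr yi i x hx2
  have hz1 := G.finrank_U_pr_le yi i (G.lpt yi C D u)
  rw [hmm, ← hz] at hz1
  set Gp := lineP (G.gK yi) C D with hGp
  have hTop := lineP_top (G.gK yi) d (G.MH_gK yi) C D i hD
  rw [← hGp] at hTop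
  have hevl : ∀ r, eval (G.lpt yi C D r) G.g = Polynomial.aeval r Gp := G.eval_lpt yi C D
  have hpmi := hpm i i
  have hm1i := hm1 i
  have hNu := hline u 0 hg (by omega) (by omega) (Nat.zero_le _)
  -- the line is not contained in the hypersurface
  have hGp0 : Gp ≠ 0 := by
    intro h0
    have hUy := hmapx _ (hloff (G.b (yi j0))) (hlx _ i)
    have hge := G.finrank_U_ge yi (G.lpt yi C D (G.b (yi j0))) (hlx _) _ (G.der_mem yi _ j0) (q i) a (hq i)
      (by rw [hlq]; exact one_ne_zero) (by rw [hlq]; simp) (by rw [hla, G.hΔ1]; exact one_ne_zero)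
    have := hline (G.b (yi j0)) (mm i) (by rw [hevl, h0, map_zero]) hge (by omega) le_rfl
    have hmp : minpoly (KK G.b yi) (G.b (yi j0)) = Polynomial.X - Polynomial.C ⟨_, y_mem_KK G.b yi j0⟩ :=
      minpoly.eq_X_sub_C L (⟨_, y_mem_KK G.b yi j0⟩ : KK G.b yi)
    rw [hmp, Polynomial.natDegree_X_sub_C] at this
    omega
  have hu0 : Polynomial.aeval u Gp = 0 := by rw [← hevl]; exact hg
  obtain ⟨H, hH⟩ := minpoly.dvd (KK G.b yi) u hu0
  have hH0 : H ≠ 0 := by rintro rfl; rw [mul_zero] at hH; exact hGp0 hH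
  have hq0 : minpoly (KK G.b yi) u ≠ 0 := minpoly.ne_zero (hIntg u)
  have hdegH : Gp.natDegree = (minpoly (KK G.b yi) u).natDegree + H.natDegree := by
    rw [hH, Polynomial.natDegree_mul hq0 hH0]
  have hHu : Polynomial.aeval u H ≠ 0 := by
    intro h
    have := natDegree_minpoly_le_of_root _ u H hH0 h
    omega
  have hsep : (minpoly (KK G.b yi) u).Separable := (minpoly.irreducible (hIntg u)).separable
  have hgD : ∑ s, G.gr (G.lpt yi C D u) s * (D s : L) ≠ 0 := by
    rw [gr_lpt, ← hGp, hH, Polynomial.derivative_mul, map_add, map_mul, map_mul, minpoly.aeval, zero_mul, add_zero]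
    exact mul_ne_zero (hsep.aeval_derivative_ne_zero (minpoly.aeval _ _)) hHu
  have hz2 := G.finrank_U_pr_lt yi hdis hd i (G.lpt yi C D u) hg (fun s => (D s : L)) (fun s hs => by simp [hD s hs]) hgD
  rw [hmm, ← hz] at hz2
  -- the leading coefficient
  have hlead : Gp.coeff (d i) ≠ 0 := by
    intro h0
    rw [hTop.2] at h0
    set Y : σ → L := fun s => ((if blk s = i then D s else C s : KK G.b yi) : L) with hY
    have hYg : eval Y G.g = 0 := by
      rw [← G.map_gK yi, eval_map, ← aeval_def]
      have : aeval Y (G.gK yi) = algebraMap (KK G.b yi) L (eval (fun s => if blk s = i then D s else C s) (G.gK yi)) := by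
        rw [hY]
        exact aeval_algebraMap_apply L (fun s => if blk s = i then D s else C s) (G.gK yi)
      rw [this, h0, map_zero]
    have hYU := hmapx Y (fun s hs => by simp [hY, hs]) ⟨a, rfl, by simp [hY, ← hi, hDa]⟩
    have hq' : ∀ j, Y (Function.update q i a j) = 1 := by
      intro j
      by_cases hj : j = i
      · subst hj; simp [hY, ← hi, hDa]
      · rw [Function.update_of_ne hj]
        simp [hY, hq, hj, hCq]
    have := G.sep_bound yi hyi hdis hd mm hmm Y (Function.update q i a) (fun j => ?_) (fun j => ?_) (fun j => ?_) a 1 ?_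
      ?_ hYg (mm i - 1) (by omega) (by omega) (fun j => ?_)
    · rw [minpoly.one, ← hi] at this
      have h1 : (Polynomial.X - 1 : Polynomial (KK G.b yi)).natDegree = 1 := by
        rw [← Polynomial.C_1, Polynomial.natDegree_X_sub_C]
      rw [h1] at this
      omega
    · by_cases hj : j = i
      · subst hj; simp [hi]
      · rw [Function.update_of_ne hj, hq]
    · rw [hq']; exact one_mem _
    · rw [hq']; exact one_ne_zero
    · rw [← hi, hq', mul_one]; simp [hY, ← hi, hDa]
    · intro τ _ s; exact τ.commutes _
    · have := hpm j i; omega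
  have hGd : Gp.natDegree = d i := le_antisymm hTop.1 (Polynomial.le_natDegree_of_ne_zero hlead)
  obtain ⟨r, hr⟩ := IsAlgClosed.exists_aeval_eq_zero L H (by
    intro h
    have := Polynomial.natDegree_eq_of_degree_eq_some (n := 0) h
    omega)
  have hNr := natDegree_minpoly_le_of_root _ r H hH0 hr
  have hNr1 : 0 < (minpoly (KK G.b yi) r).natDegree := minpoly.natDegree_pos (hIntg r)
  have hgr : eval (G.lpt yi C D r) G.g = 0 := by rw [hevl, hH, map_mul, hr, mul_zero]
  have hUr := hmapx _ (hloff r) (hlx r i)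
  have hUr2 := G.finrank_U_le yi hdis hd _ (hlx r) hgr
  obtain ⟨c, hc⟩ : ∃ c, Module.finrank L (G.U yi (G.lpt yi C D r)) + 1 + c = Fintype.card σ :=
    ⟨_, Nat.add_sub_cancel' hUr2⟩
  have hb1 := hline r c hgr (by omega) (by omega) (by omega)
  have hb2 := G.jac_bound yi hyi hdis hd mm hmm C D u a (q i) (hq i) hD hCa hDa (hCq i) (hDq i) hg hU hgD r c hc.le
  rw [← hi] at hb2
  have hc1 : 1 ≤ c := by omega
  obtain ⟨c', rfl⟩ := Nat.exists_eq_add_of_le hc1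
  obtain ⟨n', hn'⟩ := Nat.exists_eq_add_of_le hNr1
  rw [hn'] at hb2 hb1 hNr
  have : (1 + c') * (0 + 1 + n') = 1 + c' + n' + c' * n' := by ring
  have h0 : 0 ≤ c' * n' := Nat.zero_le _
  simp only [Nat.succ_eq_add_one] at *
  omega
end GS

/-! ### Part 20 -/

namespace GS
variable {L : Type} [Field L] [CharZero L] {σ κ : Type} [Fintype σ] [DecidableEq σ] [Fintype κ] [DecidableEq κ]
    {blk : σ → κ} {d : κ → ℕ} (G : GS L blk d) {J : Type} [Fintype J] [DecidableEq J] (yi : J → G.ιb)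

theorem orbit_bound [IsAlgClosed L] (hyi : Function.Injective yi) (hdis : ∀ j a, yi j ≠ G.ca a)
    (mm : κ → ℕ) (hmm : ∀ i, Fintype.card {s // blk s = i} = mm i + 1) (hm1 : ∀ i, 1 ≤ mm i)
    (hpm : ∀ i j, mm i + mm j + 1 ≤ d i) (T : ℕ) (hT : Fintype.card σ = T + Fintype.card κ) (j0 : J)
    (hTi : ∀ i, mm i + 1 ≤ T) (q : κ → σ) (hq : ∀ j, blk (q j) = j) (x : σ → L) (hxq : ∀ j, x (q j) = 1)
    (hg : eval x G.g = 0) (hU : Fintype.card σ ≤ Module.finrank L (G.U yi x) + 1) :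
    ∃ i, d i ≤ (Set.range fun τ : L ≃ₐ[KK G.b yi] L => (fun s => τ (x s))).ncard := by
  classical
  by_contra hcon
  push Not at hcon
  have hd : ∀ i, 0 < d i := fun i => by have := hpm i i; omega
  have hx : ∀ i, ∃ s, blk s = i ∧ x s ≠ 0 := fun i => ⟨q i, hq i, by rw [hxq]; exact one_ne_zero⟩
  have hgal : IsGalois (KK G.b yi) L := isGalois_KK G.b yi G.hb
  have hfin := orbit_finite (KK G.b yi) (isAlgebraic_KK G.b yi G.hb) x
  have hU1 := G.finrank_U_le yi hdis hd x hx hg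
  have hne : Nonempty κ := by
    by_contra h
    rw [not_nonempty_iff] at h
    have : IsEmpty σ := ⟨fun s => h.elim (blk s)⟩
    have h1 : Fintype.card σ = 0 := Fintype.card_eq_zero
    omega
  obtain ⟨i0⟩ := hne
  obtain ⟨w, hw, hCB⟩ := G.CBmain yi hyi hdis hd x hx hg (T - 1) 0 (by have := hTi i0; have := hm1 i0; omega) (by have := hTi i0; omega)
    (by have := hTi i0; omega)
  have hw0 : ∀ i, w i = 0 := fun i => by
    have := Finset.single_le_sum (f := w) (fun _ _ => Nat.zero_le _) (Finset.mem_univ i)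
    omega
  obtain ⟨i1, _, hi1⟩ := Finset.exists_min_image Finset.univ (fun i => d i - mm i - 1) ⟨i0, Finset.mem_univ _⟩
  obtain ⟨a, C, D, hDa, hCa, hxs, hD, hxa⟩ := line_structure (F := KK G.b yi) q hq x hxq (d i1 - mm i1 - 1)
    (by have := hpm i1 i1; have := hm1 i1; omega) (fun i => d i - mm i - 1) (fun i => hi1 i (Finset.mem_univ _))
    (hCB _ fun i => by rw [hmm, hw0]; have := hpm i i; omega) hfin
    (by have := hcon i1; have := hpm i1 i1; omega)
  have hxl : x = G.lpt yi C D (x a) := funext hxs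
  have hDq : ∀ j, D (q j) = 0 := by
    intro j
    by_contra h
    apply hxa
    have h1 := hxs (q j)
    rw [hxq] at h1
    refine ⟨(1 - C (q j)) / D (q j), ?_⟩
    have h2 : algebraMap (KK G.b yi) L (D (q j)) ≠ 0 := by simpa using h
    rw [map_div₀, map_sub, map_one, div_eq_iff h2]
    linear_combination h1
  have hCq : ∀ j, C (q j) = 1 := by
    intro j
    have h1 := hxs (q j)
    rw [hxq, hDq, map_zero, mul_zero, add_zero] at h1
    exact (algebraMap (KK G.b yi) L).injective (by rw [← h1, map_one])
  have hN := natDegree_minpoly_le (F := KK G.b yi) x a hfin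
  refine G.line_contra yi hyi hdis mm hmm hm1 hpm T hT j0 C D (x a) a (hTi _) q hq hD hCa hDa hCq hDq ?_ ?_
    (hN.trans_lt (hcon _))
  · rw [← hxl]; exact hg
  · rw [← hxl]; omega
end GS

/-! ### Part 21 -/

theorem mem_kA_finite {ιb L : Type} [Field L] [CharZero L] [IsAlgClosed L] (b : ιb → L) (hb : IsTranscendenceBasis ℚ b)
    (z : L) : ∃ S : Set ιb, S.Finite ∧ z ∈ kA b S := by
  classical
  set E := IntermediateField.adjoin ℚ (Set.range b)
  have hz : IsAlgebraic E z := hb.isAlgebraic_field.isAlgebraic z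
  set p := minpoly E z
  have hT : ∀ n, ∃ T : Finset L, (T : Set L) ⊆ Set.range b ∧ ((p.coeff n : E) : L) ∈ IntermediateField.adjoin ℚ (T : Set L) :=
    fun n => IntermediateField.exists_finset_of_mem_adjoin (p.coeff n).2
  choose T hTb hT2 using hT
  set S : Set ιb := b ⁻¹' (⋃ n ∈ Finset.range (p.natDegree + 1), (T n : Set L)) with hS
  refine ⟨S, Set.Finite.preimage hb.1.injective.injOn (Set.Finite.biUnion (Finset.finite_toSet _) fun n _ => (T n).finite_toSet), ?_⟩
  have hcoef : ∀ n, ((p.coeff n : E) : L) ∈ kA b S := by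
    intro n
    by_cases hn : n < p.natDegree + 1
    · refine adjoin_le_kA b S (IntermediateField.adjoin.mono _ _ _ ?_ (hT2 n))
      intro t ht
      obtain ⟨i, rfl⟩ := hTb n ht
      exact ⟨i, Set.mem_biUnion (Finset.mem_coe.2 (Finset.mem_range.2 hn)) ht, rfl⟩
    · rw [Polynomial.coeff_eq_zero_of_natDegree_lt (by omega)]
      exact (kA b S).zero_mem
  have hlift : p.map (algebraMap E L) ∈ Polynomial.lifts (algebraMap (kA b S) L) := by
    rw [Polynomial.lifts_iff_coeff_lifts]
    intro n
    rw [Polynomial.coeff_map]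
    exact ⟨⟨_, hcoef n⟩, rfl⟩
  obtain ⟨p', hp'⟩ := (Polynomial.mem_lifts _).1 hlift
  have hp0 : p' ≠ 0 := by
    rintro rfl
    rw [Polynomial.map_zero] at hp'
    exact (Polynomial.map_ne_zero (minpoly.ne_zero hz.isIntegral)) hp'.symm
  have halg : IsAlgebraic (kA b S) z := ⟨p', hp0, by
    rw [← Polynomial.eval_map_algebraMap, hp', Polynomial.eval_map_algebraMap]; exact minpoly.aeval _ _⟩
  have := isAlgClosed_kA b S
  have h1 := IsAlgClosed.degree_eq_one_of_irreducible (kA b S) (minpoly.irreducible halg.isIntegral)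
  obtain ⟨w, hw⟩ := minpoly.mem_range_of_degree_eq_one (kA b S) z h1
  rw [← hw]; exact w.2

theorem infinite_basis {ιb : Type} (b : ιb → ℂ) (hb : IsTranscendenceBasis ℚ b) : Infinite ιb := by
  by_contra h
  rw [not_infinite_iff_finite] at h
  have h1 := IsAlgClosed.cardinal_le_max_transcendence_basis' b hb
  rw [Cardinal.mk_complex] at h1
  have h2 : Cardinal.mk ιb ≤ Cardinal.aleph0 := (Cardinal.lt_aleph0_iff_finite.2 h).le
  have h3 : Cardinal.mk ℚ ≤ Cardinal.aleph0 := Cardinal.mk_le_aleph0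
  exact absurd (h1.trans (max_le (max_le h3 h2) le_rfl)) (not_le.2 Cardinal.aleph0_lt_continuum)

theorem derivation_eval {L σ : Type} [Field L] [Fintype σ] [DecidableEq σ] (Δ : Derivation ℤ L L) (x : σ → L)
    (P : MvPolynomial σ L) (hP : ∀ m, Δ (coeff m P) = 0) :
    Δ (eval x P) = ∑ s, eval x (pderiv s P) * Δ (x s) := by
  conv_lhs => rw [P.as_sum]
  have : ∀ s, eval x (pderiv s P) = ∑ m ∈ P.support, eval x (pderiv s (monomial m (coeff m P))) := by
    intro s
    conv_lhs => rw [P.as_sum]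
    simp only [map_sum]
  simp only [this, map_sum, derivation_monomial, hP, zero_mul, add_zero, Finset.sum_mul]
  rw [Finset.sum_comm]

theorem homog_eval_ne {L : Type} [Field L] [CharZero L] {J : Type} [Fintype J] [DecidableEq J] (y : J → L)
    (Δ : J → Derivation ℤ L L) (h1 : ∀ j, Δ j (y j) = 1) (h0 : ∀ i j, i ≠ j → Δ i (y j) = 0) (e : ℕ) :
    ∀ f : MvPolynomial J L, f.IsHomogeneous e → (∀ j m, Δ j (coeff m f) = 0) → eval y f = 0 → f = 0 := by
  induction e with
  | zero =>
    intro f hf _ hy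
    have h2 : f = C (coeff 0 f) := (totalDegree_eq_zero_iff_eq_C).1 (Nat.le_zero.1 hf.totalDegree_le)
    rw [h2, eval_C] at hy
    rw [h2, hy, map_zero]
  | succ e ih =>
    intro f hf hc hy
    have h2 : ∀ j, pderiv j f = 0 := by
      intro j
      refine ih _ (by simpa using hf.pderiv (i := j)) (fun l m => ?_) ?_
      · rw [coeff_pderiv, Derivation.leibniz, hc]
        have : Δ l ((m j : L) + 1) = 0 := by
          rw [map_add, Derivation.map_one_eq_zero, Derivation.map_natCast, add_zero]
        rw [this]; simp
      · have h3 := derivation_eval (Δ j) y f (hc j)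
        rw [hy, map_zero, Finset.sum_eq_single j] at h3
        · rw [h1, mul_one] at h3; exact h3.symm
        · intro l _ hl; rw [h0 _ _ (Ne.symm hl), mul_zero]
        · simp
    have h4 := hf.sum_X_mul_pderiv
    simp only [h2, mul_zero, Finset.sum_const_zero] at h4
    rw [eq_comm, nsmul_eq_mul] at h4
    rcases mul_eq_zero.1 h4 with h | h
    · exfalso
      have : ((e + 1 : ℕ) : MvPolynomial J L) ≠ 0 := Nat.cast_ne_zero.2 (by omega)
      exact this h
    · exact h

theorem MH.euler {L σ κ : Type} [Field L] [CharZero L] [Fintype σ] [DecidableEq σ] [Fintype κ] [DecidableEq κ] {blk : σ → κ}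
    (P : MvPolynomial σ L) (e : κ → ℕ) (hP : MH blk P e) (x : σ → L) (i : κ) :
    ∑ s, eval x (MvPolynomial.pderiv s P) * (if blk s = i then x s else 0) = (e i : L) * eval x P := by
  have : ∀ s, eval x (MvPolynomial.pderiv s P) = ∑ m ∈ P.support, eval x (MvPolynomial.pderiv s (monomial m (coeff m P))) := by
    intro s
    conv_lhs => rw [P.as_sum]
    simp only [map_sum]
  simp only [this, Finset.sum_mul]
  rw [Finset.sum_comm]
  conv_rhs => rw [P.as_sum, map_sum, Finset.mul_sum]
  refine Finset.sum_congr rfl fun m hm => ?_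
  rw [GS.euler_mono, hP m hm i]

theorem finrank_map_add_le {L E E' : Type} [Field L] [AddCommGroup E] [Module L E] [FiniteDimensional L E] [AddCommGroup E'] [Module L E']
    [FiniteDimensional L E'] (f : E →ₗ[L] E') (U W : Submodule L E) (h1 : W ≤ U) (h2 : ∀ v ∈ W, f v = 0) :
    Module.finrank L (U.map f) + Module.finrank L W ≤ Module.finrank L U := by
  have h := LinearMap.finrank_range_add_finrank_ker (f.domRestrict U)
  rw [LinearMap.range_domRestrict] at h
  have h3 : W ≤ (LinearMap.ker (f.domRestrict U)).map U.subtype := by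
    intro v hv
    exact ⟨⟨v, h1 hv⟩, by simpa using h2 v hv, rfl⟩
  have h4 := Submodule.finrank_mono h3
  rw [Submodule.finrank_map_subtype_eq] at h4
  omega

namespace GS
variable {L : Type} [Field L] [CharZero L] {σ κ : Type} [Fintype σ] [DecidableEq σ] [Fintype κ] [DecidableEq κ]
    {blk : σ → κ} {d : κ → ℕ} (G : GS L blk d) {J : Type} [Fintype J] [DecidableEq J] (yi : J → G.ιb)

theorem rank_generic (hyi : Function.Injective yi) (j0 : J) (F : J → MvPolynomial σ L) (e : κ → ℕ) (hF : ∀ j, MH blk (F j) e)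
    (hc : ∀ l j m, G.Δ (yi l) (coeff m (F j)) = 0) (x : σ → L) (hx : ∀ i, ∃ s, blk s = i ∧ x s ≠ 0) (μ : L) (hμ : μ ≠ 0)
    (hFx : ∀ j, eval x (F j) = μ * G.b (yi j)) :
    Fintype.card κ + Fintype.card J ≤ Module.finrank L (G.U yi x) + 1 := by
  set y : J → L := fun j => G.b (yi j) with hy
  have hΔ1 : ∀ j, G.Δ (yi j) (y j) = 1 := fun j => G.hΔ1 _
  have hΔ0 : ∀ i j, i ≠ j → G.Δ (yi i) (y j) = 0 := fun i j h => G.hΔ0 _ _ (fun h2 => h (hyi h2))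
  have hy0 : y ≠ 0 := by
    intro h
    have := hΔ1 j0
    rw [h] at this
    simp at this
  let dF : (σ → L) →ₗ[L] (J → L) := LinearMap.pi fun j => dotF (fun s => eval x (pderiv s (F j)))
  let f := (Submodule.span L {y}).mkQ.comp dF
  have hdFe : ∀ i, dF (fun s => if blk s = i then x s else 0) = ((e i : L) * μ) • y := by
    intro i; ext j
    change ∑ s, _ = _
    rw [MH.euler (F j) e (hF j) x i, hFx]
    simp [hy, mul_assoc]
  have hdFd : ∀ l, dF (fun s => G.Δ (yi l) (x s)) = G.Δ (yi l) μ • y + μ • Pi.single l 1 := by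
    intro l; ext j
    change ∑ s, _ = _
    rw [← derivation_eval _ _ _ (hc l j), hFx, Derivation.leibniz]
    by_cases h : l = j
    · subst h
      have := hΔ1 l
      simp only [hy] at this
      simp [hy, this]; ring
    · have := hΔ0 l j h
      simp only [hy] at this
      simp [hy, this, Pi.single_apply, Ne.symm h]; ring
  have hyq : (Submodule.span L {y}).mkQ y = 0 := by
    rw [Submodule.mkQ_apply, Submodule.Quotient.mk_eq_zero]; exact Submodule.mem_span_singleton_self _
  have hmap : (G.U yi x).map f = ⊤ := by
    have h1 : ∀ l, (Submodule.span L {y}).mkQ (Pi.single l 1) ∈ (G.U yi x).map f := by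
      intro l
      refine ⟨μ⁻¹ • (fun s => G.Δ (yi l) (x s)), Submodule.smul_mem _ _ (G.der_mem yi x l), ?_⟩
      rw [map_smul, LinearMap.comp_apply, hdFd, map_add, map_smul, hyq, smul_zero, zero_add, map_smul, smul_smul,
        inv_mul_cancel₀ hμ, one_smul]
    rw [eq_top_iff]
    rintro z -
    obtain ⟨v, rfl⟩ := Submodule.mkQ_surjective _ z
    have hv : v = ∑ l, v l • (Pi.single l 1 : J → L) := by
      ext j; simp [Finset.sum_apply, Pi.single_apply]
    rw [hv, map_sum]
    refine Submodule.sum_mem _ fun l _ => ?_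
    rw [map_smul]
    exact Submodule.smul_mem _ _ (h1 l)
  have hq := Submodule.finrank_quotient_add_finrank (Submodule.span L {y})
  rw [finrank_span_singleton hy0, Module.finrank_fintype_fun_eq_card] at hq
  have hE := G.euler_indep yi x hx
  have hE2 : LinearIndependent L (fun i : κ => (fun s => if blk s = i then x s else 0)) := by
    have h2 : LinearIndependent L (fun r : Set.range (RowIx.euler (blk := blk) (J := J)) => G.V yi x r) := hE
    exact h2.comp (fun i : κ => ⟨RowIx.euler i, i, rfl⟩) (fun i j h => by have h3 := congrArg Subtype.val h; exact RowIx.euler.inj h3)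
  have hE3 := finrank_span_eq_card hE2
  have hfin := finrank_map_add_le f (G.U yi x) (Submodule.span L (Set.range fun i : κ => (fun s => if blk s = i then x s else 0)))
    (by rw [Submodule.span_le]; rintro _ ⟨i, rfl⟩; exact G.euler_mem yi x i)
    (by
      intro v hv
      have : Submodule.span L (Set.range fun i : κ => (fun s => if blk s = i then x s else 0)) ≤ LinearMap.ker f := by
        rw [Submodule.span_le]
        rintro _ ⟨i, rfl⟩
        change f _ = 0
        rw [LinearMap.comp_apply, hdFe, map_smul, hyq, smul_zero]
      exact this hv)
  rw [hmap, finrank_top, hE3] at hfin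
  omega
end GS

/-! ### Part 22 -/

section Bridge
variable {k : ℕ} {m : Fin k → ℕ}

theorem sum_blk {M : Type} [AddCommMonoid M] (f : ((i : Fin k) × Fin (m i + 1)) → M) (i : Fin k) :
    ∑ s with s.1 = i, f s = ∑ j, f ⟨i, j⟩ := by
  rw [Finset.sum_filter, Fintype.sum_sigma, Finset.sum_eq_single i]
  · simp
  · intro b _ hb; simp [hb]
  · simp

theorem isMultiHomog_iff (f : MvPolynomial ((i : Fin k) × Fin (m i + 1)) ℂ) (D : Fin k → ℕ) :
    IsMultiHomog f D ↔ MH (fun s : (i : Fin k) × Fin (m i + 1) => s.1) f D := by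
  unfold IsMultiHomog MH
  simp only [sum_blk]

/-- Exponents of multidegree `d`. -/
abbrev MonA (m d : Fin k → ℕ) : Type :=
  {α : ((i : Fin k) × Fin (m i + 1)) →₀ ℕ // ∀ i, ∑ s with s.1 = i, α s = d i}

theorem monA_finite (d : Fin k → ℕ) : Finite (MonA m d) := by
  have h : ∀ a : MonA m d, ∀ s, a.1 s < d s.1 + 1 := by
    intro a s
    rw [← a.2 s.1]
    have := Finset.single_le_sum (f := fun t => a.1 t) (s := Finset.univ.filter fun t : (i : Fin k) × Fin (m i + 1) => t.1 = s.1)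
      (fun _ _ => Nat.zero_le _) (Finset.mem_filter.2 ⟨Finset.mem_univ s, rfl⟩)
    exact Nat.lt_succ_of_le this
  refine Finite.of_injective (fun a : MonA m d => fun s => (⟨a.1 s, h a s⟩ : Fin (d s.1 + 1))) ?_
  intro a b hab
  apply Subtype.ext
  ext s
  exact congrArg Fin.val (congrFun hab s)

theorem exists_GS (d : Fin k → ℕ) (g : MvPolynomial ((i : Fin k) × Fin (m i + 1)) ℂ) (hg : IsMultiHomog g d)
    (hgen : AlgebraicIndependent ℚ (fun a : MonA m d => coeff a.1 g)) :
    ∃ G : GS ℂ (fun s : (i : Fin k) × Fin (m i + 1) => s.1) d, G.g = g := by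
  classical
  obtain ⟨t, ht, hbt⟩ := exists_isTranscendenceBasis_superset (s := Set.range (fun a : MonA m d => coeff a.1 g))
    hgen.to_subtype_range
  have hD : ∀ i : t, ∃ Δ : Derivation ℤ ℂ ℂ, ∀ j : t, Δ (j : ℂ) = if i = j then 1 else 0 :=
    fun i => exists_derivation_of_basis ((↑) : t → ℂ) hbt _
  choose Δ hΔ using hD
  have := monA_finite (m := m) d
  refine ⟨{ ιb := t, A := MonA m d, fA := Fintype.ofFinite _, b := (↑), hb := hbt, Δ := Δ, hΔ1 := ?_, hΔ0 := ?_,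
            α := Subtype.val, hα := Subtype.val_injective, hαd := ?_, hαs := ?_,
            ca := fun a => ⟨coeff a.1 g, ht ⟨a, rfl⟩⟩, hca := ?_ }, ?_⟩
  · intro i; simp [hΔ]
  · intro i j h; simp [hΔ, h]
  · intro a i; exact a.2 i
  · intro a ha; exact ⟨⟨a, ha⟩, rfl⟩
  · intro a b h
    exact hgen.injective (congrArg Subtype.val h)
  · unfold GS.g
    ext β
    simp only [coeff_sum, coeff_monomial]
    by_cases hβ : ∀ i, ∑ s with s.1 = i, β s = d i
    · rw [Finset.sum_eq_single (⟨β, hβ⟩ : MonA m d)]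
      · simp
      · intro b _ hb
        rw [if_neg]
        intro h; exact hb (Subtype.ext h)
      · simp
    · rw [Finset.sum_eq_zero]
      · by_contra h
        exact hβ ((isMultiHomog_iff g d).1 hg β (mem_support_iff.2 (Ne.symm h)))
      · intro a _
        rw [if_neg]
        intro h
        exact hβ (h ▸ a.2)

theorem eval_assemble_smul {f : MvPolynomial ((i : Fin k) × Fin (m i + 1)) ℂ} {D : Fin k → ℕ} (hf : IsMultiHomog f D)
    (c : Fin k → ℂ) (v : ∀ i, Fin (m i + 1) → ℂ) :
    eval (assemble fun i => c i • v i) f = (∏ i, c i ^ D i) * eval (assemble v) f :=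
  ((isMultiHomog_iff f D).1 hf).aeval_scale c (assemble v)

theorem rep_smul {v w : ∀ i, Fin (m i + 1) → ℂ} {hv : ∀ i, v i ≠ 0} {hw : ∀ i, w i ≠ 0}
    (h : ∀ i, Projectivization.mk ℂ (v i) (hv i) = Projectivization.mk ℂ (w i) (hw i)) :
    ∃ c : Fin k → ℂ, (∀ i, c i ≠ 0) ∧ v = fun i => c i • w i := by
  have : ∀ i, ∃ a : ℂˣ, a • w i = v i := fun i => (Projectivization.mk_eq_mk_iff _ _ _ _ _).1 (h i)
  choose a ha using this
  exact ⟨fun i => a i, fun i => (a i).ne_zero, by funext i; exact (ha i).symm⟩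

theorem pvanishP_mk {f : MvPolynomial ((i : Fin k) × Fin (m i + 1)) ℂ} {D : Fin k → ℕ} (hf : IsMultiHomog f D)
    (v : ∀ i, Fin (m i + 1) → ℂ) (hv : ∀ i, v i ≠ 0) :
    PVanishP f (fun i => Projectivization.mk ℂ (v i) (hv i)) ↔ eval (assemble v) f = 0 := by
  constructor
  · intro h; exact h v hv fun _ => rfl
  · intro h w hw hwv
    obtain ⟨c, _, rfl⟩ := rep_smul hwv
    rw [eval_assemble_smul hf, h, mul_zero]

theorem mapsTo_mk {t : ℕ} (φ : PRatMap k m t) (v : ∀ i, Fin (m i + 1) → ℂ) (hv : ∀ i, v i ≠ 0)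
    (y : Fin t → ℂ) (hy : y ≠ 0) :
    φ.mapsTo (fun i => Projectivization.mk ℂ (v i) (hv i)) (Projectivization.mk ℂ y hy) ↔
      ∃ μ : ℂ, μ ≠ 0 ∧ φ.evalVec v = μ • y := by
  constructor
  · intro h
    obtain ⟨hw, h2⟩ := h v hv fun _ => rfl
    obtain ⟨a, ha⟩ := (Projectivization.mk_eq_mk_iff _ _ _ _ _).1 h2
    exact ⟨a, a.ne_zero, ha.symm⟩
  · rintro ⟨μ, hμ, h⟩ w hw hwv
    obtain ⟨c, hc, rfl⟩ := rep_smul hwv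
    have h3 : φ.evalVec (fun i => c i • v i) = ((∏ i, c i ^ φ.e i) * μ) • y := by
      funext j
      have := congrFun h j
      simp only [PRatMap.evalVec, Pi.smul_apply, smul_eq_mul] at this ⊢
      rw [eval_assemble_smul (φ.homog j), this]; ring
    have h4 : (∏ i, c i ^ φ.e i) * μ ≠ 0 := mul_ne_zero (Finset.prod_ne_zero_iff.2 fun i _ => pow_ne_zero _ (hc i)) hμ
    refine ⟨by rw [h3]; exact smul_ne_zero h4 hy, ?_⟩
    rw [Projectivization.mk_eq_mk_iff']
    exact ⟨_, h3.symm⟩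

theorem pvanish_mk {ι : Type} [Fintype ι] {f : MvPolynomial ι ℂ} {e : ℕ} (hf : f.IsHomogeneous e) (v : ι → ℂ) (hv : v ≠ 0) :
    PVanish f (Projectivization.mk ℂ v hv) ↔ eval v f = 0 := by
  constructor
  · intro h; exact h v hv rfl
  · intro h w hw hwv
    obtain ⟨a, rfl⟩ := (Projectivization.mk_eq_mk_iff' _ _ _ _ _).1 hwv
    have : eval (a • v) f = a ^ e * eval v f := by
      rw [eval_eq', eval_eq', Finset.mul_sum]
      refine Finset.sum_congr rfl fun β hβ => ?_
      have h2 : ∑ i, β i = e := by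
        have := hf (mem_support_iff.1 hβ)
        simpa [Finsupp.weight_apply, Finsupp.sum_fintype] using this
      simp only [Pi.smul_apply, smul_eq_mul, mul_pow, Finset.prod_mul_distrib]
      rw [Finset.prod_pow_eq_pow_sum, h2]; ring
    rw [this, h, mul_zero]

end Bridge

/-! ### Part 23 -/

theorem eval_fixed {σ : Type} (K : IntermediateField ℚ ℂ) (τ : ℂ ≃ₐ[K] ℂ) (P : MvPolynomial σ ℂ) (hP : ∀ m, coeff m P ∈ K)
    (x : σ → ℂ) : eval (fun s => τ (x s)) P = τ (eval x P) := by
  rw [eval_eq, eval_eq, map_sum]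
  refine Finset.sum_congr rfl fun β _ => ?_
  rw [map_mul, map_prod]
  congr 1
  · exact (τ.commutes (⟨_, hP β⟩ : K)).symm
  · exact Finset.prod_congr rfl fun i _ => (map_pow τ _ _).symm

theorem exists_inj_avoid {ιb : Type} [Infinite ιb] (S : Set ιb) (hS : S.Finite) (T : ℕ) :
    ∃ yi : Fin T → ιb, Function.Injective yi ∧ ∀ j, yi j ∉ S := by
  have : Infinite (Sᶜ : Set ιb) := hS.infinite_compl.to_subtype
  let e := Infinite.natEmbedding (Sᶜ : Set ιb)
  refine ⟨fun j => (e j : ιb), ?_, fun j => (e j).2⟩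
  intro i j h
  exact Fin.ext (e.injective (Subtype.ext h))

theorem coeffs_kA_finite {ιb : Type} (b : ιb → ℂ) (hb : IsTranscendenceBasis ℚ b) {σ : Type} (P : MvPolynomial σ ℂ) :
    ∃ S : Set ιb, S.Finite ∧ ∀ m, coeff m P ∈ kA b S := by
  have := fun z => mem_kA_finite b hb z
  choose S hS hz using this
  refine ⟨⋃ m ∈ P.support, S (coeff m P), P.support.finite_toSet.biUnion fun m _ => hS _, fun m => ?_⟩
  by_cases h : m ∈ P.support
  · exact kA_mono b (Set.subset_biUnion_of_mem (u := fun m => S (coeff m P)) (show m ∈ (P.support : Set _) from h)) (hz _)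
  · rw [notMem_support_iff.1 h]; exact zero_mem _

theorem lower_bound {k : ℕ} (hk : 2 ≤ k) (m d : Fin k → ℕ) (hm : ∀ i, 0 < m i)
    (hpm : ∀ i j, m i + m j + 1 ≤ d i) (g : MvPolynomial ((i : Fin k) × Fin (m i + 1)) ℂ) (hg : IsMultiHomog g d)
    (hgen : AlgebraicIndependent ℚ (fun a : MonA m d => coeff a.1 g)) (T : ℕ) (hTdef : T = ∑ i, m i) (δ : ℕ) (φ : PRatMap k m T)
    (hφ : φ.DominantOfDegree {x : ProdPt m | PVanishP g x} δ) : ∃ i, d i ≤ δ := by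
  classical
  obtain ⟨G, hGg⟩ := exists_GS d g hg hgen
  obtain ⟨hδ, V, ⟨Y, ⟨fs, hfs, rfl⟩, hY, hYV⟩, hV⟩ := hφ
  have hTi : ∀ i, m i + 1 ≤ ∑ i, m i := by
    intro i
    have hnt : Nontrivial (Fin k) := Fin.nontrivial_iff_two_le.2 hk
    obtain ⟨j, hj⟩ := exists_ne i
    have := Finset.add_le_sum (f := m) (s := Finset.univ) (fun _ _ => Nat.zero_le _) (Finset.mem_univ i) (Finset.mem_univ j) hj.symm
    have := hm j
    omega
  rw [← hTdef] at hTi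
  have hT0 : 0 < T := by have := hTi ⟨0, by omega⟩; omega
  -- a nonzero equation
  obtain ⟨f0, hf0, hf0n⟩ : ∃ f ∈ fs, f ≠ 0 := by
    by_contra hcon
    push Not at hcon
    apply hY
    intro y _ f hf
    rw [hcon f hf]
    intro v _ _
    simp
  obtain ⟨e0, he0⟩ := hfs f0 hf0
  obtain ⟨S0, hS0, hc0⟩ := coeffs_kA_finite G.b G.hb f0
  have := fun j => coeffs_kA_finite G.b G.hb (φ.F j)
  choose SF hSF hcF using this
  have := infinite_basis G.b G.hb
  obtain ⟨yi, hyi, hav⟩ := exists_inj_avoid ((S0 ∪ ⋃ j, SF j) ∪ Set.range G.ca)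
    ((hS0.union (Set.finite_iUnion hSF)).union (Set.finite_range _)) T
  have hsub0 : S0 ⊆ (Set.range yi)ᶜ := by
    rintro s hs ⟨j, rfl⟩; exact hav j (Or.inl (Or.inl hs))
  have hsubF : ∀ j, SF j ⊆ (Set.range yi)ᶜ := by
    rintro j s hs ⟨l, rfl⟩; exact hav l (Or.inl (Or.inr (Set.mem_iUnion.2 ⟨j, hs⟩)))
  have hdis : ∀ j a, yi j ≠ G.ca a := fun j a h => hav j (Or.inr ⟨a, h.symm⟩)
  have hc0' : ∀ n, coeff n f0 ∈ kA G.b (Set.range yi)ᶜ := fun n => kA_mono G.b hsub0 (hc0 n)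
  have hcF' : ∀ j n, coeff n (φ.F j) ∈ kA G.b (Set.range yi)ᶜ := fun j n => kA_mono G.b (hsubF j) (hcF j n)
  have hker : ∀ l z, z ∈ kA G.b (Set.range yi)ᶜ → G.Δ (yi l) z = 0 := by
    intro l z hz
    refine derivation_kA_zero G.b _ (G.Δ (yi l)) ?_ hz
    intro j hj
    exact G.hΔ0 _ _ (fun h => hj ⟨l, h⟩)
  set y : Fin T → ℂ := fun j => G.b (yi j) with hy
  have hy0 : y ≠ 0 := by
    intro h
    have h1 := G.hΔ1 (yi ⟨0, hT0⟩)
    have h2 : G.b (yi ⟨0, hT0⟩) = 0 := congrFun h _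
    rw [h2, map_zero] at h1
    exact zero_ne_one h1
  have hfy : eval y f0 ≠ 0 := fun h => hf0n (homog_eval_ne y (fun l => G.Δ (yi l)) (fun j => G.hΔ1 _)
    (fun i j h => G.hΔ0 _ _ (fun h2 => h (hyi h2))) e0 f0 he0 (fun j n => hker j _ (hc0' n)) h)
  have hyV : Projectivization.mk ℂ y hy0 ∈ V := by
    apply hYV
    refine ⟨trivial, fun h => hfy ?_⟩
    exact (pvanish_mk he0 y hy0).1 (h f0 hf0)
  obtain ⟨hfin, hcard⟩ := hV _ hyV
  have hne : (φ.fiber {x : ProdPt m | PVanishP g x} (Projectivization.mk ℂ y hy0)).Nonempty := by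
    rw [← Set.ncard_pos hfin, hcard]; exact hδ
  obtain ⟨P, hPX, hPy⟩ := hne
  -- normalized representative
  have hrep : ∀ i, ∃ (v : Fin (m i + 1) → ℂ) (hv : v ≠ 0) (q : Fin (m i + 1)), v q = 1 ∧ Projectivization.mk ℂ v hv = P i := by
    intro i
    obtain ⟨q, hq⟩ := Function.ne_iff.1 (P i).rep_nonzero
    have hq' : (P i).rep q ≠ 0 := hq
    have hv : ((P i).rep q)⁻¹ • (P i).rep ≠ 0 := smul_ne_zero (inv_ne_zero hq') (P i).rep_nonzero
    refine ⟨_, hv, q, by simp [hq'], ?_⟩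
    refine Eq.trans ?_ (P i).mk_rep
    rw [Projectivization.mk_eq_mk_iff']
    exact ⟨_, rfl⟩
  choose v hv q hvq hvP using hrep
  obtain rfl : P = fun i => Projectivization.mk ℂ (v i) (hv i) := funext fun i => (hvP i).symm
  have hgx : eval (assemble v) g = 0 := (pvanishP_mk hg v hv).1 hPX
  obtain ⟨μ, hμ, hFx⟩ := (mapsTo_mk φ v hv y hy0).1 hPy
  have hFx' : ∀ j, eval (assemble v) (φ.F j) = μ * G.b (yi j) := fun j => congrFun hFx j
  have hrank := G.rank_generic yi hyi ⟨0, hT0⟩ φ.F φ.e (fun j => (isMultiHomog_iff _ _).1 (φ.homog j))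
    (fun l j n => hker l _ (hcF' j n)) (assemble v) (fun i => ⟨⟨i, q i⟩, rfl, by
      change v i (q i) ≠ 0
      rw [hvq]; exact one_ne_zero⟩) μ hμ hFx'
  have hcσ : Fintype.card ((i : Fin k) × Fin (m i + 1)) = T + Fintype.card (Fin k) := by
    rw [Fintype.card_sigma]
    simp [Finset.sum_add_distrib, hTdef]
  obtain ⟨i, hi⟩ := G.orbit_bound yi hyi hdis m (by
      intro i
      rw [Fintype.card_subtype]
      have := sum_blk (m := m) (fun _ => 1) i
      simpa using this) (fun i => hm i) hpm T hcσ ⟨0, hT0⟩ hTi (fun i => ⟨i, q i⟩) (fun _ => rfl) (assemble v)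
      (fun j => hvq j) (by rw [hGg]; exact hgx) (by rw [Fintype.card_fin T] at hrank; omega)
  refine ⟨i, hi.trans ?_⟩
  rw [← hcard]
  -- the orbit maps injectively into the fibre
  have hτv : ∀ (τ : ℂ ≃ₐ[KK G.b yi] ℂ) i, (fun j => τ (v i j)) ≠ 0 := by
    intro τ i h
    have := congrFun h (q i)
    simp [hvq] at this
  set O := Set.range fun τ : ℂ ≃ₐ[KK G.b yi] ℂ => (fun s => τ (assemble v s)) with hO
  let Φ : (((i : Fin k) × Fin (m i + 1)) → ℂ) → ProdPt m := fun x i =>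
    if h : (fun j => x ⟨i, j⟩) ≠ 0 then Projectivization.mk ℂ (fun j => x ⟨i, j⟩) h else Projectivization.mk ℂ (v i) (hv i)
  have hΦ : ∀ τ : ℂ ≃ₐ[KK G.b yi] ℂ, Φ (fun s => τ (assemble v s)) = fun i => Projectivization.mk ℂ (fun j => τ (v i j)) (hτv τ i) := by
    intro τ; funext i
    exact dif_pos (hτv τ i)
  refine Set.ncard_le_ncard_of_injOn Φ ?_ ?_ hfin
  · rintro _ ⟨τ, rfl⟩
    rw [hΦ]
    refine ⟨(pvanishP_mk hg _ _).2 ?_, (mapsTo_mk φ _ _ _ _).2 ⟨τ μ, ?_, ?_⟩⟩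
    · have := G.eval_g_fixed (τ : ℂ →+* ℂ) (fun a => τ.commutes (⟨_, b_mem_KK G.b yi (G.ca a)⟩ : KK G.b yi)) (assemble v)
      rw [hGg, hgx, map_zero] at this
      exact this
    · simpa using hμ
    · funext j
      have h1 := eval_fixed (KK G.b yi) τ (φ.F j) (fun n => kA_le_KK G.b yi (hcF' j n)) (assemble v)
      rw [hFx', map_mul] at h1
      have h2 : τ (G.b (yi j)) = G.b (yi j) := τ.commutes (⟨_, b_mem_KK G.b yi (yi j)⟩ : KK G.b yi)
      rw [h2] at h1
      exact h1
  · rintro _ ⟨τ, rfl⟩ _ ⟨τ', rfl⟩ h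
    rw [hΦ, hΦ] at h
    funext ⟨i, j⟩
    obtain ⟨a, ha⟩ := (Projectivization.mk_eq_mk_iff' _ _ _ _ _).1 (congrFun h i)
    have h1 := congrFun ha (q i)
    simp only [Pi.smul_apply, hvq, map_one, smul_eq_mul, mul_one] at h1
    rw [h1, one_smul] at ha
    exact (congrFun ha j).symm

/-! ### Part 24 -/

theorem generic_separable {ι : Type} (f : Polynomial (MvPolynomial ι ℂ)) (n : ℕ) (hn : 0 < n) (hf : f.natDegree ≤ n)
    (y0 : ι → ℂ) (h1 : (f.map (eval y0)).coeff n ≠ 0)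
    (h2 : ∀ u, (f.map (eval y0)).eval u = 0 → (f.map (eval y0)).derivative.eval u ≠ 0) :
    ∃ D : MvPolynomial ι ℂ, eval y0 D ≠ 0 ∧ ∀ y, eval y D ≠ 0 →
      {u | (f.map (eval y)).eval u = 0}.Finite ∧ {u | (f.map (eval y)).eval u = 0}.ncard = n := by
  classical
  have hdeg : ∀ y, (f.map (eval y)).coeff n ≠ 0 → (f.map (eval y)).natDegree = n := by
    intro y h
    exact le_antisymm ((Polynomial.natDegree_map_le).trans hf) (Polynomial.le_natDegree_of_ne_zero h)
  have hres : ∀ y, (f.map (eval y)).coeff n ≠ 0 →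
      eval y (Polynomial.resultant f f.derivative n (n - 1)) = Polynomial.resultant (f.map (eval y)) (f.map (eval y)).derivative := by
    intro y h
    rw [← Polynomial.resultant_map_map, Polynomial.natDegree_derivative, hdeg y h, Polynomial.derivative_map]
  refine ⟨f.coeff n * Polynomial.resultant f f.derivative n (n - 1), ?_, ?_⟩
  · rw [map_mul, hres y0 h1]
    refine mul_ne_zero (by rwa [Polynomial.coeff_map] at h1) (Polynomial.resultant_ne_zero _ _ ?_)
    refine isCoprime_of_irreducible_dvd (fun h => h1 (by rw [h.1]; simp)) ?_
    intro p hp hp1 hp2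
    obtain ⟨u, hu⟩ := IsAlgClosed.exists_root p (Polynomial.degree_pos_of_irreducible hp).ne'
    exact h2 u (Polynomial.eval_eq_zero_of_dvd_of_eval_eq_zero hp1 hu) (Polynomial.eval_eq_zero_of_dvd_of_eval_eq_zero hp2 hu)
  · intro y hy
    rw [map_mul] at hy
    have hc : (f.map (eval y)).coeff n ≠ 0 := by rw [Polynomial.coeff_map]; exact left_ne_zero_of_mul hy
    have hr := right_ne_zero_of_mul hy
    rw [hres y hc, Ne, Polynomial.resultant_eq_zero_iff] at hr
    set p := f.map (eval y)
    have hp0 : p ≠ 0 := by rintro h; rw [h] at hc; simp at hc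
    have hcop : IsCoprime p p.derivative := by
      by_contra h
      exact hr (by tauto)
    have hnd := Polynomial.nodup_roots (p := p) hcop
    have hset : {u | p.eval u = 0} = (p.roots.toFinset : Set ℂ) := by
      ext u; simp [Polynomial.mem_roots hp0, Polynomial.IsRoot]
    rw [hset]
    refine ⟨Finset.finite_toSet _, ?_⟩
    rw [Set.ncard_coe_finset, Multiset.toFinset_card_of_nodup hnd, ← (IsAlgClosed.splits p).natDegree_eq_card_roots]
    exact hdeg y hc

theorem eval_homogComp {ι : Type} [Fintype ι] (D : MvPolynomial ι ℂ) (c : ℂ) (y : ι → ℂ) :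
    eval (c • y) D = ∑ e ∈ Finset.range (D.totalDegree + 1), eval y (homogeneousComponent e D) * c ^ e := by
  conv_lhs => rw [← sum_homogeneousComponent D]
  rw [map_sum]
  refine Finset.sum_congr rfl fun e _ => ?_
  have hf := homogeneousComponent_isHomogeneous e D
  rw [eval_eq', eval_eq', Finset.sum_mul]
  refine Finset.sum_congr rfl fun β hβ => ?_
  have h2 : ∑ i, β i = e := by
    have := hf (mem_support_iff.1 hβ)
    simpa [Finsupp.weight_apply, Finsupp.sum_fintype] using this
  simp only [Pi.smul_apply, smul_eq_mul, mul_pow, Finset.prod_mul_distrib]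
  rw [Finset.prod_pow_eq_pow_sum, h2]; ring

theorem dense_open {ι : Type} [Fintype ι] (D : MvPolynomial ι ℂ) (y0 : ι → ℂ) (hD : eval y0 D ≠ 0) (hD0 : eval 0 D = 0) :
    ContainsDenseOpenOf Set.univ {P : PPt ι | ∃ (y : ι → ℂ) (hy : y ≠ 0), Projectivization.mk ℂ y hy = P ∧ eval y D ≠ 0} := by
  refine ⟨{x | ∀ f ∈ Set.range (fun e => homogeneousComponent e D), PVanish f x}, ⟨_, ?_, rfl⟩, ?_, ?_⟩
  · rintro _ ⟨e, rfl⟩; exact ⟨e, homogeneousComponent_isHomogeneous e D⟩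
  · intro h
    have hy0 : y0 ≠ 0 := by rintro rfl; exact hD hD0
    have h1 := h (Set.mem_univ (Projectivization.mk ℂ y0 hy0))
    apply hD
    have := eval_homogComp D 1 y0
    rw [one_smul] at this
    rw [this]
    refine Finset.sum_eq_zero fun e _ => ?_
    rw [h1 _ ⟨e, rfl⟩ y0 hy0 rfl, zero_mul]
  · rintro P ⟨-, hP⟩
    simp only [Set.mem_setOf_eq, Set.mem_range, forall_exists_index, forall_apply_eq_imp_iff] at hP
    push Not at hP
    obtain ⟨e, he⟩ := hP
    obtain ⟨y, hy, rfl⟩ : ∃ y hy, Projectivization.mk ℂ y hy = P := ⟨_, P.rep_nonzero, P.mk_rep⟩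
    rw [pvanish_mk (homogeneousComponent_isHomogeneous e D)] at he
    set p : Polynomial ℂ := ∑ e ∈ Finset.range (D.totalDegree + 1), Polynomial.monomial e (eval y (homogeneousComponent e D)) with hp
    have he2 : e < D.totalDegree + 1 := by
      by_contra h
      rw [homogeneousComponent_eq_zero _ _ (by omega)] at he
      simp at he
    have hp0 : p ≠ 0 := by
      intro h
      have := congrArg (fun q => Polynomial.coeff q e) h
      simp only [hp, Polynomial.finset_sum_coeff, Polynomial.coeff_monomial, Polynomial.coeff_zero] at this
      rw [Finset.sum_ite_eq' , if_pos (Finset.mem_range.2 he2)] at this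
      exact he this
    obtain ⟨c, hc⟩ : ∃ c, p.eval c ≠ 0 := by
      by_contra h
      push Not at h
      exact hp0 (Polynomial.funext fun c => by rw [h c]; simp)
    have hc2 : eval (c • y) D ≠ 0 := by
      rw [eval_homogComp]
      simpa [hp, Polynomial.eval_finset_sum] using hc
    have hcy : c • y ≠ 0 := by
      intro h; rw [h] at hc2; exact hc2 hD0
    refine ⟨c • y, hcy, ?_, hc2⟩
    rw [Projectivization.mk_eq_mk_iff']
    exact ⟨c, rfl⟩

/-! ### Part 25 -/

section Upper
variable {k : ℕ} {m : Fin k → ℕ}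

/-- The coordinate vector of the fibre points. -/
def Xv {S : Type} (l0 : (j : Fin k) × Fin (m j)) (z : ((j : Fin k) × Fin (m j)) → S) (u : S) :
    ((i : Fin k) × Fin (m i + 1)) → S :=
  fun s => Fin.cases (motive := fun _ => S) (z l0) (fun a => if (⟨s.1, a⟩ : (j : Fin k) × Fin (m j)) = l0 then u else z ⟨s.1, a⟩) s.2

theorem Xv_zero {S : Type} (l0 : (j : Fin k) × Fin (m j)) (z : ((j : Fin k) × Fin (m j)) → S) (u : S) (j : Fin k) :
    Xv l0 z u ⟨j, 0⟩ = z l0 := rfl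

theorem Xv_succ {S : Type} (l0 : (j : Fin k) × Fin (m j)) (z : ((j : Fin k) × Fin (m j)) → S) (u : S) (j : Fin k) (a : Fin (m j)) :
    Xv l0 z u ⟨j, a.succ⟩ = if (⟨j, a⟩ : (j : Fin k) × Fin (m j)) = l0 then u else z ⟨j, a⟩ := rfl

theorem Xv_map {S S' : Type} (h : S → S') (l0 : (j : Fin k) × Fin (m j)) (z : ((j : Fin k) × Fin (m j)) → S) (u : S)
    (s : (i : Fin k) × Fin (m i + 1)) : h (Xv l0 z u s) = Xv l0 (fun l => h (z l)) (h u) s := by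
  obtain ⟨j, a⟩ := s
  refine Fin.cases ?_ (fun a => ?_) a
  · rfl
  · rw [Xv_succ, Xv_succ]; split_ifs <;> rfl

/-- The distinguished coordinate. -/
def s0 (l0 : (j : Fin k) × Fin (m j)) : (i : Fin k) × Fin (m i + 1) := ⟨l0.1, l0.2.succ⟩

theorem succ_eq_s0 (l0 : (j : Fin k) × Fin (m j)) (j : Fin k) (a : Fin (m j)) :
    (⟨j, a.succ⟩ : (i : Fin k) × Fin (m i + 1)) = s0 l0 ↔ (⟨j, a⟩ : (j : Fin k) × Fin (m j)) = l0 := by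
  obtain ⟨j0, a0⟩ := l0
  unfold s0
  constructor
  · intro h
    obtain rfl : j = j0 := congrArg Sigma.fst h
    simp only [Sigma.mk.injEq, heq_eq_eq, true_and] at h
    rw [Fin.succ_injective _ h]
  · intro h
    obtain rfl : j = j0 := congrArg Sigma.fst h
    simp only [Sigma.mk.injEq, heq_eq_eq, true_and] at h
    rw [h]

theorem zero_ne_s0 (l0 : (j : Fin k) × Fin (m j)) (j : Fin k) : (⟨j, 0⟩ : (i : Fin k) × Fin (m i + 1)) ≠ s0 l0 := by
  obtain ⟨j0, a0⟩ := l0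
  unfold s0
  intro h
  obtain rfl : j = j0 := congrArg Sigma.fst h
  simp only [Sigma.mk.injEq, heq_eq_eq, true_and] at h
  exact (Fin.succ_ne_zero _ h.symm)

/-- The universal univariate polynomial. -/
noncomputable def univPoly (l0 : (j : Fin k) × Fin (m j)) (g : MvPolynomial ((i : Fin k) × Fin (m i + 1)) ℂ) :
    Polynomial (MvPolynomial ((j : Fin k) × Fin (m j)) ℂ) :=
  aeval (Xv l0 (fun l => Polynomial.C (X l)) Polynomial.X) g

theorem univPoly_map (l0 : (j : Fin k) × Fin (m j)) (g : MvPolynomial ((i : Fin k) × Fin (m i + 1)) ℂ)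
    (y : ((j : Fin k) × Fin (m j)) → ℂ) :
    (univPoly l0 g).map (eval y) = aeval (Xv l0 (fun l => Polynomial.C (y l)) Polynomial.X) g := by
  unfold univPoly
  rw [← Polynomial.coe_mapRingHom, aeval_def, aeval_def, hom_eval₂]
  congr 1
  · ext c
    simp [Polynomial.algebraMap_eq, IsScalarTower.algebraMap_apply ℂ (MvPolynomial ((j : Fin k) × Fin (m j)) ℂ) (Polynomial (MvPolynomial ((j : Fin k) × Fin (m j)) ℂ)), algebraMap_eq]
  · funext s
    rw [Xv_map (Polynomial.mapRingHom (eval y))]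
    simp

theorem univPoly_eval (l0 : (j : Fin k) × Fin (m j)) (g : MvPolynomial ((i : Fin k) × Fin (m i + 1)) ℂ)
    (y : ((j : Fin k) × Fin (m j)) → ℂ) (u : ℂ) :
    ((univPoly l0 g).map (eval y)).eval u = eval (Xv l0 y u) g := by
  rw [univPoly_map, ← Polynomial.coe_evalRingHom, aeval_def, hom_eval₂, eval, coe_eval₂Hom]
  congr 1
  · ext c; simp
  · funext s
    rw [Xv_map (Polynomial.evalRingHom u)]
    simp

theorem univPoly_natDegree (l0 : (j : Fin k) × Fin (m j)) (g : MvPolynomial ((i : Fin k) × Fin (m i + 1)) ℂ) (d : Fin k → ℕ)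
    (hg : IsMultiHomog g d) : (univPoly l0 g).natDegree ≤ d l0.1 := by
  unfold univPoly
  rw [aeval_def, eval₂_eq]
  refine Polynomial.natDegree_sum_le_of_forall_le _ _ fun α hα => ?_
  have h1 : α (s0 l0) ≤ d l0.1 := by
    rw [← hg α hα l0.1]
    exact Finset.single_le_sum (f := fun j => α ⟨l0.1, j⟩) (fun _ _ => Nat.zero_le _) (Finset.mem_univ l0.2.succ)
  refine le_trans ?_ h1
  refine (Polynomial.natDegree_mul_le).trans ?_
  have h0 : ((algebraMap ℂ (Polynomial (MvPolynomial ((j : Fin k) × Fin (m j)) ℂ))) (coeff α g)).natDegree = 0 := by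
    rw [IsScalarTower.algebraMap_apply ℂ (MvPolynomial ((j : Fin k) × Fin (m j)) ℂ) (Polynomial (MvPolynomial ((j : Fin k) × Fin (m j)) ℂ))]
    exact Polynomial.natDegree_C _
  rw [h0, zero_add]
  refine (Polynomial.natDegree_prod_le _ _).trans ?_
  have h2 : ∀ s, (Xv l0 (fun l => Polynomial.C (X l : MvPolynomial ((j : Fin k) × Fin (m j)) ℂ)) Polynomial.X s ^ α s).natDegree
      ≤ if s = s0 l0 then α (s0 l0) else 0 := by
    rintro ⟨j, a⟩
    refine (Polynomial.natDegree_pow_le).trans ?_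
    refine Fin.cases ?_ (fun a => ?_) a
    · rw [Xv_zero]; simp
    · rw [Xv_succ]
      simp only [succ_eq_s0]
      split_ifs with h
      · rw [(succ_eq_s0 l0 j a).2 h]; simp
      · simp
  refine (Finset.sum_le_sum fun s _ => h2 s).trans ?_
  rw [Finset.sum_ite_eq']
  split_ifs <;> simp

/-- The exponent of `u^t` at the special point. -/
noncomputable def αt (l0 : (j : Fin k) × Fin (m j)) (d : Fin k → ℕ) (t : ℕ) : ((i : Fin k) × Fin (m i + 1)) →₀ ℕ :=
  Finsupp.equivFunOnFinite.symm (Xv l0 (fun _ => 0) t + fun s => if s.2 = 0 then (if s.1 = l0.1 then d s.1 - t else d s.1) else 0)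

theorem αt_zero (l0 : (j : Fin k) × Fin (m j)) (d : Fin k → ℕ) (t : ℕ) (j : Fin k) :
    αt l0 d t ⟨j, 0⟩ = if j = l0.1 then d j - t else d j := by
  simp [αt, Xv_zero]

theorem αt_succ (l0 : (j : Fin k) × Fin (m j)) (d : Fin k → ℕ) (t : ℕ) (j : Fin k) (a : Fin (m j)) :
    αt l0 d t ⟨j, a.succ⟩ = if (⟨j, a⟩ : (j : Fin k) × Fin (m j)) = l0 then t else 0 := by
  simp [αt, Xv_succ]

theorem sum_l0 (l0 : (j : Fin k) × Fin (m j)) (t : ℕ) (j : Fin k) :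
    (∑ a : Fin (m j), if (⟨j, a⟩ : (j : Fin k) × Fin (m j)) = l0 then t else 0) = if j = l0.1 then t else 0 := by
  obtain ⟨j0, a0⟩ := l0
  by_cases h : j = j0
  · subst h
    simp
  · simp [h]

theorem αt_sum (l0 : (j : Fin k) × Fin (m j)) (d : Fin k → ℕ) (t : ℕ) (ht : t ≤ d l0.1) (i : Fin k) :
    ∑ j, αt l0 d t ⟨i, j⟩ = d i := by
  rw [Fin.sum_univ_succ, αt_zero]
  simp only [αt_succ, sum_l0]
  split_ifs with h
  · subst h; omega
  · simp

theorem αt_unique (l0 : (j : Fin k) × Fin (m j)) (d : Fin k → ℕ) (α : ((i : Fin k) × Fin (m i + 1)) →₀ ℕ)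
    (h : ∀ i, ∑ j, α ⟨i, j⟩ = d i) (h0 : ∀ j (a : Fin (m j)), (⟨j, a⟩ : (j : Fin k) × Fin (m j)) ≠ l0 → α ⟨j, a.succ⟩ = 0) :
    α = αt l0 d (α (s0 l0)) := by
  have hs : ∀ j (a : Fin (m j)), α ⟨j, a.succ⟩ = if (⟨j, a⟩ : (j : Fin k) × Fin (m j)) = l0 then α (s0 l0) else 0 := by
    intro j a
    split_ifs with hja
    · rw [(succ_eq_s0 l0 j a).2 hja]
    · exact h0 j a hja
  ext ⟨j, a⟩
  refine Fin.cases ?_ (fun a => ?_) a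
  · rw [αt_zero]
    have := h j
    rw [Fin.sum_univ_succ] at this
    simp only [hs, sum_l0] at this
    split_ifs at this ⊢ <;> omega
  · rw [αt_succ, hs]

theorem univPoly_special_coeff (l0 : (j : Fin k) × Fin (m j)) (g : MvPolynomial ((i : Fin k) × Fin (m i + 1)) ℂ) (d : Fin k → ℕ)
    (hg : IsMultiHomog g d) (t : ℕ) :
    ((univPoly l0 g).map (eval (Pi.single l0 1))).coeff t = coeff (αt l0 d t) g := by
  classical
  rw [univPoly_map, aeval_def, eval₂_eq', Polynomial.finset_sum_coeff]
  have hterm : ∀ α ∈ g.support, (algebraMap ℂ (Polynomial ℂ) (coeff α g) *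
      ∏ i, Xv l0 (fun l => Polynomial.C ((Pi.single l0 1 : _ → ℂ) l)) Polynomial.X i ^ α i).coeff t
      = if α = αt l0 d t then coeff α g else 0 := by
    intro α hα
    rw [Polynomial.algebraMap_eq, Polynomial.coeff_C_mul]
    by_cases h0 : ∀ j (a : Fin (m j)), (⟨j, a⟩ : (j : Fin k) × Fin (m j)) ≠ l0 → α ⟨j, a.succ⟩ = 0
    · have hα2 := αt_unique l0 d α (hg α hα) h0
      have hprod : ∏ i, Xv l0 (fun l => Polynomial.C ((Pi.single l0 1 : _ → ℂ) l)) Polynomial.X i ^ α i = Polynomial.X ^ (α (s0 l0)) := by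
        rw [Finset.prod_eq_single (s0 l0)]
        · congr 1
          unfold s0
          rw [Xv_succ, if_pos rfl]
        · rintro ⟨j, a⟩ _ hne
          revert hne
          refine Fin.cases ?_ (fun a => ?_) a
          · intro _
            rw [Xv_zero]; simp
          · intro hne
            rw [h0 j a (fun h => hne ((succ_eq_s0 l0 j a).2 h)), pow_zero]
        · simp
      rw [hprod, Polynomial.coeff_X_pow]
      by_cases ht : t = α (s0 l0)
      · rw [if_pos ht, if_pos (by rw [ht]; exact hα2), mul_one]
      · rw [if_neg ht, if_neg, mul_zero]
        intro h
        apply ht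
        have := DFunLike.congr_fun h (s0 l0)
        unfold s0 at this ⊢
        rw [αt_succ, if_pos rfl] at this
        exact this.symm
    · push Not at h0
      obtain ⟨j, a, hja, hne⟩ := h0
      rw [if_neg, Finset.prod_eq_zero (Finset.mem_univ ⟨j, a.succ⟩)]
      · simp
      · rw [Xv_succ, if_neg hja, Pi.single_eq_of_ne hja, map_zero, zero_pow hne]
      · intro h
        apply hne
        rw [h, αt_succ, if_neg hja]
  rw [Finset.sum_congr rfl hterm, Finset.sum_ite_eq']
  split_ifs with h
  · rfl
  · exact (notMem_support_iff.1 h).symm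

theorem derivation_poly_eval (Δ : Derivation ℤ ℂ ℂ) (p : Polynomial ℂ) (u : ℂ) :
    Δ (p.eval u) = (∑ t ∈ Finset.range (p.natDegree + 1), Δ (p.coeff t) * u ^ t) + p.derivative.eval u * Δ u := by
  have h1 : p.derivative.eval u = ∑ t ∈ Finset.range (p.natDegree + 1), p.coeff t * (t * u ^ (t - 1)) := by
    rw [Polynomial.derivative_eval, Polynomial.sum_over_range]
    · exact Finset.sum_congr rfl fun t _ => by ring
    · simp
  rw [h1, Polynomial.eval_eq_sum_range, map_sum, Finset.sum_mul, ← Finset.sum_add_distrib]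
  refine Finset.sum_congr rfl fun t _ => ?_
  rw [Derivation.leibniz, Derivation.leibniz_pow]
  simp only [smul_eq_mul, nsmul_eq_mul]
  ring

theorem special_simple (l0 : (j : Fin k) × Fin (m j)) (g : MvPolynomial ((i : Fin k) × Fin (m i + 1)) ℂ) (d : Fin k → ℕ)
    (hg : IsMultiHomog g d) (hgen : AlgebraicIndependent ℚ (fun a : MonA m d => coeff a.1 g)) (u : ℂ)
    (hu : ((univPoly l0 g).map (eval (Pi.single l0 1))).eval u = 0) :
    ((univPoly l0 g).map (eval (Pi.single l0 1))).derivative.eval u ≠ 0 := by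
  intro hu2
  obtain ⟨t, ht, hbt⟩ := exists_isTranscendenceBasis_superset (s := Set.range (fun a : MonA m d => coeff a.1 g))
    hgen.to_subtype_range
  have hmem : ∀ n, n ≤ d l0.1 → ∀ i, ∑ s with s.1 = i, αt l0 d n s = d i := by
    intro n hn i
    rw [sum_blk]; exact αt_sum l0 d n hn i
  classical
  obtain ⟨Δ, hΔ⟩ := exists_derivation_of_basis ((↑) : t → ℂ) hbt (fun z => if (z : ℂ) = coeff (αt l0 d 0) g then 1 else 0)
  set p := (univPoly l0 g).map (eval (Pi.single l0 1)) with hp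
  have hdeg : p.natDegree ≤ d l0.1 := (Polynomial.natDegree_map_le).trans (univPoly_natDegree l0 g d hg)
  have hco : ∀ n, n ≤ d l0.1 → Δ (p.coeff n) = if n = 0 then 1 else 0 := by
    intro n hn
    rw [hp, univPoly_special_coeff l0 g d hg]
    have := hΔ ⟨coeff (αt l0 d n) g, ht ⟨⟨_, hmem n hn⟩, rfl⟩⟩
    simp only at this
    rw [this]
    by_cases h : n = 0
    · subst h; simp
    · rw [if_neg h, if_neg]
      intro h2
      have h3 := hgen.injective (a₁ := ⟨_, hmem n hn⟩) (a₂ := ⟨_, hmem 0 (Nat.zero_le _)⟩) h2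
      have h4 := DFunLike.congr_fun (congrArg Subtype.val h3) (⟨l0.1, l0.2.succ⟩)
      simp only [αt_succ] at h4
      exact h (by simpa using h4)
  have h1 := derivation_poly_eval Δ p u
  rw [hu, hu2, map_zero, zero_mul, add_zero, Finset.sum_eq_single 0] at h1
  · rw [hco 0 (Nat.zero_le _)] at h1
    simp at h1
  · intro n hn hn0
    rw [hco n (by have := Finset.mem_range.1 hn; omega), if_neg hn0, zero_mul]
  · simp

end Upper

/-! ### Part 26 -/

section Upper2
variable {k : ℕ} {m : Fin k → ℕ}

/-- The coordinate used by the projection. -/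
def cc (l0 l : (j : Fin k) × Fin (m j)) : (i : Fin k) × Fin (m i + 1) := if l = l0 then ⟨l.1, 0⟩ else ⟨l.1, l.2.succ⟩

theorem cc_fst (l0 l : (j : Fin k) × Fin (m j)) : (cc l0 l).1 = l.1 := by
  unfold cc; split_ifs <;> rfl

/-- The projection. -/
noncomputable def prF (l0 l : (j : Fin k) × Fin (m j)) : MvPolynomial ((i : Fin k) × Fin (m i + 1)) ℂ :=
  X (cc l0 l) * ∏ j ∈ Finset.univ.erase l.1, X ⟨j, 0⟩

theorem prF_homog (l0 l : (j : Fin k) × Fin (m j)) : IsMultiHomog (prF l0 l) (fun _ => 1) := by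
  classical
  rw [isMultiHomog_iff]
  have h1 := (MH.X (blk := fun s : (i : Fin k) × Fin (m i + 1) => s.1) (R := ℂ) (cc l0 l)).mul
    (MH.prod (blk := fun s : (i : Fin k) × Fin (m i + 1) => s.1) (R := ℂ) (Finset.univ.erase l.1) (fun j => X ⟨j, 0⟩) (fun j _ => MH.X _))
  have h2 : (Pi.single (cc l0 l).1 1 + ∑ j ∈ Finset.univ.erase l.1, Pi.single j 1 : Fin k → ℕ) = fun _ => 1 := by
    rw [cc_fst, Finset.add_sum_erase _ (fun j => (Pi.single j 1 : Fin k → ℕ)) (Finset.mem_univ l.1)]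
    funext i
    simp [Finset.sum_apply, Pi.single_apply]
  rw [← h2]
  exact h1

theorem prF_eval (l0 l : (j : Fin k) × Fin (m j)) (x : ((i : Fin k) × Fin (m i + 1)) → ℂ) (c : ℂ) (hc : ∀ j, x ⟨j, 0⟩ = c) :
    eval x (prF l0 l) = x (cc l0 l) * c ^ (k - 1) := by
  simp [prF, hc, map_prod]

theorem upper_bound {T : ℕ} (e : ((j : Fin k) × Fin (m j)) ≃ Fin T) (l0 : (j : Fin k) × Fin (m j)) (d : Fin k → ℕ) (hd : 0 < d l0.1)
    (g : MvPolynomial ((i : Fin k) × Fin (m i + 1)) ℂ) (hg : IsMultiHomog g d)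
    (hgen : AlgebraicIndependent ℚ (fun a : MonA m d => coeff a.1 g)) :
    ∃ φ : PRatMap k m T, φ.DominantOfDegree {x : ProdPt m | PVanishP g x} (d l0.1) := by
  classical
  have h1 : ((univPoly l0 g).map (eval (Pi.single l0 1))).coeff (d l0.1) ≠ 0 := by
    rw [univPoly_special_coeff l0 g d hg]
    exact hgen.ne_zero (⟨αt l0 d (d l0.1), fun i => by rw [sum_blk]; exact αt_sum l0 d _ le_rfl i⟩ : MonA m d)
  obtain ⟨D, hD, hD2⟩ := generic_separable (univPoly l0 g) (d l0.1) hd (univPoly_natDegree l0 g d hg) (Pi.single l0 1) h1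
    (special_simple l0 g d hg hgen)
  let φ : PRatMap k m T := ⟨fun t => prF l0 (e.symm t), fun _ => 1, fun t => prF_homog l0 _⟩
  refine ⟨φ, hd, _, dense_open (rename e (D * X l0)) (fun t => (Pi.single l0 1 : _ → ℂ) (e.symm t)) ?_ ?_, ?_⟩
  · rw [eval_rename]
    have : ((fun t => (Pi.single l0 1 : _ → ℂ) (e.symm t)) ∘ e) = Pi.single l0 1 := by funext l; simp
    rw [this, map_mul, eval_X, Pi.single_eq_same, mul_one]
    exact hD
  · rw [eval_rename]; simp
  rintro _ ⟨y, hy, rfl, hyD⟩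
  rw [eval_rename, map_mul, eval_X] at hyD
  set z : ((j : Fin k) × Fin (m j)) → ℂ := y ∘ e with hz
  have hz0 : z l0 ≠ 0 := right_ne_zero_of_mul hyD
  obtain ⟨hRf, hRc⟩ := hD2 z (left_ne_zero_of_mul hyD)
  simp only [univPoly_eval] at hRf hRc
  set R := {u | eval (Xv l0 z u) g = 0} with hR
  have hnz : ∀ u i, (fun j => Xv l0 z u ⟨i, j⟩) ≠ 0 := by
    intro u i h
    exact hz0 (congrFun h 0)
  let Ψ : ℂ → ProdPt m := fun u i => Projectivization.mk ℂ (fun j => Xv l0 z u ⟨i, j⟩) (hnz u i)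
  have hΨinj : Function.Injective Ψ := by
    intro u u' h
    obtain ⟨a, ha⟩ := (Projectivization.mk_eq_mk_iff' _ _ _ _ _).1 (congrFun h l0.1)
    have h2 := congrFun ha 0
    simp only [Pi.smul_apply, Xv_zero, smul_eq_mul] at h2
    have h3 : a = 1 := mul_right_cancel₀ hz0 (by rw [h2, one_mul])
    have h4 := congrFun ha l0.2.succ
    simp only [Pi.smul_apply, Xv_succ, smul_eq_mul, h3, one_mul, Sigma.eta, if_true] at h4
    exact h4.symm
  have hfib : φ.fiber {x : ProdPt m | PVanishP g x} (Projectivization.mk ℂ y hy) = Ψ '' R := by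
    ext P
    constructor
    · rintro ⟨hPX, hPy⟩
      -- all zeroth coordinates are nonzero
      have hP0 : ∀ j, (P j).rep 0 ≠ 0 := by
        have hPr : P = fun i => Projectivization.mk ℂ (P i).rep (P i).rep_nonzero := funext fun i => (P i).mk_rep.symm
        rw [hPr] at hPy
        obtain ⟨μ, hμ, h⟩ := (mapsTo_mk φ _ _ y hy).1 hPy
        have h2 := congrFun h (e l0)
        have h3 : ∏ j, (P j).rep 0 = μ * z l0 := by
          rw [← Finset.mul_prod_erase _ _ (Finset.mem_univ l0.1)]
          simp only [PRatMap.evalVec, φ, Equiv.symm_apply_apply] at h2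
          simpa [prF, cc, assemble, map_prod, hz] using h2
        have h4 : ∏ j, (P j).rep 0 ≠ 0 := by rw [h3]; exact mul_ne_zero hμ hz0
        intro j
        exact Finset.prod_ne_zero_iff.1 h4 j (Finset.mem_univ j)
      have hrep : ∀ i, ∃ (v : Fin (m i + 1) → ℂ) (hv : v ≠ 0), v 0 = z l0 ∧ Projectivization.mk ℂ v hv = P i := by
        intro i
        have hv : (z l0 / (P i).rep 0) • (P i).rep ≠ 0 := smul_ne_zero (div_ne_zero hz0 (hP0 i)) (P i).rep_nonzero
        refine ⟨_, hv, by simp [hP0 i], ?_⟩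
        refine Eq.trans ?_ (P i).mk_rep
        rw [Projectivization.mk_eq_mk_iff']
        exact ⟨_, rfl⟩
      choose v hv hv0 hvP using hrep
      obtain rfl : P = fun i => Projectivization.mk ℂ (v i) (hv i) := funext fun i => (hvP i).symm
      obtain ⟨μ, hμ, h⟩ := (mapsTo_mk φ v hv y hy).1 hPy
      have hF : ∀ l, assemble v (cc l0 l) * z l0 ^ (k - 1) = μ * z l := by
        intro l
        have h2 := congrFun h (e l)
        rw [← prF_eval l0 l (assemble v) (z l0) (fun j => hv0 j)]
        simpa [PRatMap.evalVec, φ, hz] using h2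
      have hμ2 : μ = z l0 ^ (k - 1) := by
        have h2 := hF l0
        have h3 : assemble v (cc l0 l0) = z l0 := by
          unfold cc; rw [if_pos rfl]; exact hv0 _
        rw [h3, mul_comm] at h2
        exact (mul_right_cancel₀ hz0 h2).symm
      have hF2 : ∀ l, assemble v (cc l0 l) = z l := by
        intro l
        have h2 := hF l
        rw [hμ2, mul_comm] at h2
        exact mul_left_cancel₀ (pow_ne_zero _ hz0) h2
      have hvX : ∀ i j, v i j = Xv l0 z (v l0.1 l0.2.succ) ⟨i, j⟩ := by
        intro i j
        refine Fin.cases ?_ (fun a => ?_) j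
        · rw [Xv_zero]; exact hv0 i
        · rw [Xv_succ]
          split_ifs with hl
          · subst hl; rfl
          · have h2 := hF2 ⟨i, a⟩
            unfold cc at h2
            rw [if_neg hl] at h2
            exact h2
      refine ⟨v l0.1 l0.2.succ, ?_, ?_⟩
      · have h2 := (pvanishP_mk hg v hv).1 hPX
        have h3 : assemble v = Xv l0 z (v l0.1 l0.2.succ) := by
          funext ⟨i, j⟩; exact hvX i j
        rw [h3] at h2
        exact h2
      · funext i
        change Projectivization.mk ℂ _ _ = Projectivization.mk ℂ _ _
        congr 1
        funext j
        exact (hvX i j).symm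
    · rintro ⟨u, hu, rfl⟩
      refine ⟨(pvanishP_mk hg _ _).2 hu, (mapsTo_mk φ _ _ y hy).2 ⟨z l0 ^ (k - 1), pow_ne_zero _ hz0, ?_⟩⟩
      funext t
      obtain ⟨l, rfl⟩ := e.surjective t
      have h2 := prF_eval l0 l (Xv l0 z u) (z l0) (fun j => rfl)
      have h3 : Xv l0 z u (cc l0 l) = z l := by
        unfold cc
        split_ifs with hl
        · rw [Xv_zero, hl]
        · rw [Xv_succ, if_neg hl]
      rw [h3, mul_comm] at h2
      have h4 : φ.evalVec (fun i j => Xv l0 z u ⟨i, j⟩) (e l) = eval (Xv l0 z u) (prF l0 l) := by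
        simp only [PRatMap.evalVec, φ, Equiv.symm_apply_apply]
        rfl
      rw [h4, h2]
      rfl
  rw [hfib]
  exact ⟨hRf.image _, by rw [Set.ncard_image_of_injective _ hΨinj]; exact hRc⟩

end Upper2

/-! ### Part 27 -/

theorem coeff_realize {k : ℕ} {m d : Fin k → ℕ} {N : ℕ} (ε : MonA m d ≃ Fin N) (x : Fin N → ℂ) :
    ∃ g : MvPolynomial ((i : Fin k) × Fin (m i + 1)) ℂ, IsMultiHomog g d ∧ ∀ j, coeff (ε.symm j).1 g = x j := by
  classical
  refine ⟨∑ j, monomial (ε.symm j).1 (x j), ?_, ?_⟩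
  · rw [isMultiHomog_iff]
    refine MH.sum _ _ fun j _ => ?_
    intro β hβ
    have := support_monomial_subset hβ
    rw [Finset.mem_singleton] at this
    subst this
    exact (ε.symm j).2
  · intro j
    simp only [coeff_sum, coeff_monomial]
    rw [Finset.sum_eq_single j]
    · simp
    · intro b _ hb
      rw [if_neg]
      intro h
      exact hb (ε.symm.injective (Subtype.ext h))
    · simp

theorem irr_main
    (k : ℕ) (hk : 2 ≤ k) (m d : Fin k → ℕ) (hm : ∀ i, 0 < m i)
    (hpm : ∀ i j, m i + m j + 1 ≤ d i) :
    ∃ B : ℕ → Set (MvPolynomial ((i : Fin k) × Fin (m i + 1)) ℂ),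
      (∀ i, MultiCoeffProperClosed d (B i)) ∧
      ∀ g : MvPolynomial ((i : Fin k) × Fin (m i + 1)) ℂ,
        IsMultiHomog g d → g ∉ ⋃ i, B i →
        irrProd (∑ i, m i) {x : ProdPt m | PVanishP g x} = sInf (Set.range d) := by
  classical
  have := monA_finite (m := m) d
  obtain ⟨N, ⟨ε⟩⟩ := Finite.exists_equiv_fin (MonA m d)
  have hne : Nonempty {Q : MvPolynomial (Fin N) ℚ // Q ≠ 0} := ⟨⟨1, one_ne_zero⟩⟩
  have hcount : Countable (MvPolynomial (Fin N) ℚ) := by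
    rw [← Cardinal.mk_le_aleph0_iff]
    refine (MvPolynomial.cardinalMk_le_max).trans ?_
    simp
  obtain ⟨Q, hQ⟩ := exists_surjective_nat {Q : MvPolynomial (Fin N) ℚ // Q ≠ 0}
  refine ⟨fun n => {g | aeval (fun j => coeff (ε.symm j).1 g) (Q n).1 = 0}, ?_, ?_⟩
  · intro n
    refine ⟨N, fun j => (ε.symm j).1, map (algebraMap ℚ ℂ) (Q n).1, ?_, ?_⟩
    · intro g hg
      rw [eval_map]
      exact hg
    · have h0 : map (algebraMap ℚ ℂ) (Q n).1 ≠ 0 := by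
        intro h
        apply (Q n).2
        apply map_injective _ (algebraMap ℚ ℂ).injective
        rw [h, map_zero]
      obtain ⟨x, hx⟩ : ∃ x, eval x (map (algebraMap ℚ ℂ) (Q n).1) ≠ 0 := by
        by_contra h
        push Not at h
        exact h0 (MvPolynomial.funext fun x => by rw [h x, map_zero])
      obtain ⟨g, hg, hgx⟩ := coeff_realize ε x
      refine ⟨g, hg, ?_⟩
      rw [show (fun j => coeff (ε.symm j).1 g) = x from _root_.funext hgx]
      exact hx
  · intro g hg hgB
    have hgen : AlgebraicIndependent ℚ (fun a : MonA m d => coeff a.1 g) := by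
      rw [algebraicIndependent_iff]
      intro P hP
      by_contra hP0
      apply hgB
      have h1 : rename ε P ≠ 0 := fun h => hP0 (rename_injective _ ε.injective (by rw [h, map_zero]))
      obtain ⟨n, hn⟩ := hQ ⟨rename ε P, h1⟩
      refine Set.mem_iUnion.2 ⟨n, ?_⟩
      change aeval _ (Q n).1 = 0
      rw [hn, aeval_rename, ← hP]
      congr 2
      funext a
      simp
    have : Nonempty (Fin k) := ⟨⟨0, by omega⟩⟩
    obtain ⟨i0, hi0⟩ : sInf (Set.range d) ∈ Set.range d := Nat.sInf_mem (Set.range_nonempty d)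
    unfold irrProd
    rw [← hi0]
    have hup := upper_bound finSigmaFinEquiv (⟨i0, ⟨0, hm i0⟩⟩ : (j : Fin k) × Fin (m j)) d
      (by have := hpm i0 i0; simp only; omega) g hg hgen
    apply le_antisymm
    · exact Nat.sInf_le hup
    · refine le_csInf ⟨_, hup⟩ ?_
      rintro δ ⟨φ, hφ⟩
      obtain ⟨i, hi⟩ := lower_bound hk m d hm hpm g hg hgen _ rfl δ φ hφ
      rw [hi0]
      exact (Nat.sInf_le (Set.mem_range_self i)).trans hi

/-- **Theorem E.** Let `P = ℙ^{m 0} × ⋯ × ℙ^{m (k-1)}` with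
`k ≥ 2` and let `X = {g = 0}` be a very general hypersurface of multidegree
`d`.  If `p = min_i (d i − m i − 1) ≥ max_i (m i)` (equivalently
`m i + m j + 1 ≤ d i` for all `i, j`), then `irr(X) = min_i (d i)`.
Here `dim X = (∑ i, m i) − 1` so the target projective space has `∑ i, m i`
homogeneous coordinates.  "Very general" is formalized by a countable family of
proper Zariski-closed subsets of the space of multidegree-`d` forms outside
whose union the conclusion holds. -/
theorem irr_very_general_hypersurface_in_product
    (k : ℕ) (hk : 2 ≤ k) (m d : Fin k → ℕ) (hm : ∀ i, 0 < m i)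
    (hpm : ∀ i j, m i + m j + 1 ≤ d i) :
    ∃ B : ℕ → Set (MvPolynomial ((i : Fin k) × Fin (m i + 1)) ℂ),
      (∀ i, MultiCoeffProperClosed d (B i)) ∧
      ∀ g : MvPolynomial ((i : Fin k) × Fin (m i + 1)) ℂ,
        IsMultiHomog g d → g ∉ ⋃ i, B i →
        irrProd (∑ i, m i) {x : ProdPt m | PVanishP g x} = sInf (Set.range d) := by
  exact irr_main k hk m d hm hpm
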